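/- arXiv:2412.20208 — 2 statements merged into one kernel-verified Lean document; each statement's English description precedes it below -/
import Mathlib

section
/- Let X be a nontrivial finite group with k := k(X) conjugacy classes, let H ≤ Sym({1,…,n}) be a transitive permutation group of degree n that is semiprimitive (every normal subgroup of H is transitive or semiregular), and let G = X ≀ H be the wreath product where H permutes the n coordinates of X^n. Then there exists an absolute constant C such that whenever n ≥ C or k ≥ C, one has k(G) ≤ k^n. -/
open Equiv MulAction

/-- The number of conjugacy classes of a group. -/
noncomputable def kclass (G : Type*) [Group G] : ℕ := Nat.card (ConjClasses G)

/-- The coordinate-permuting action of `Perm ι` on `ι → X`, as automorphisms. -/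
def permAut (ι X : Type*) [Group X] : Perm ι →* MulAut (ι → X) where
  toFun e :=
    { toFun := fun f => f ∘ e.symm
      invFun := fun f => f ∘ e
      left_inv := fun f => by funext i; simp
      right_inv := fun f => by funext i; simp
      map_mul' := fun f g => rfl }
  map_one' := by ext f; rfl
  map_mul' := fun e₁ e₂ => by ext f; rfl

/-- The wreath product `X ≀ H` of a group `X` with a permutation group `H ≤ Perm ι`,
i.e. the semidirect product `X^ι ⋊ H` where `H` permutes the direct factors of `X^ι`. -/
abbrev Wreath (X : Type*) [Group X] {ι : Type*} (H : Subgroup (Perm ι)) :=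
  SemidirectProduct (ι → X) H ((permAut ι X).comp H.subtype)

/-- A group acting on `Ω` acts on the functions `Ω → S` by permuting coordinates. -/
instance funMulAction (G Ω S : Type*) [Group G] [MulAction G Ω] : MulAction G (Ω → S) where
  smul g f := fun ω => f (g⁻¹ • ω)
  one_smul f := funext fun ω => by
    show f ((1 : G)⁻¹ • ω) = f ω
    rw [inv_one, one_smul]
  mul_smul g h f := funext fun ω => by
    show f ((g * h)⁻¹ • ω) = f (h⁻¹ • g⁻¹ • ω)
    rw [mul_inv_rev, mul_smul]

/-- `σ(h)`: the number of cycles of a permutation `h` in its disjoint cycle decomposition,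
with fixed points counted as cycles of length 1; equivalently, the number of orbits of
the cyclic group generated by `h`. -/
noncomputable def cycleCount {ι : Type*} (h : Perm ι) : ℕ :=
  Nat.card (orbitRel.Quotient (Subgroup.zpowers h) ι)

/-- `n(G, α)`: the number of orbits of a group action. -/
noncomputable def orbitCount (G : Type*) [Group G] (α : Type*) [MulAction G α] : ℕ :=
  Nat.card (orbitRel.Quotient G α)

namespace WS
open Finset
set_option linter.unusedSectionVars false

/-- The elements of a permutation group, as a finset of permutations. -/
noncomputable def els {Ω : Type*} [Finite Ω] (G : Subgroup (Perm Ω)) : Finset (Perm Ω) :=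
  (Set.toFinite (G : Set (Perm Ω))).toFinset

lemma mem_els {Ω : Type*} [Finite Ω] {G : Subgroup (Perm Ω)} {g : Perm Ω} :
    g ∈ els G ↔ g ∈ G := by simp [els]

lemma card_els {Ω : Type*} [Finite Ω] (G : Subgroup (Perm Ω)) :
    (els G).card = Nat.card G := by
  rw [els, ← Nat.card_eq_card_finite_toFinset]; rfl

lemma card_els_pos {Ω : Type*} [Finite Ω] (G : Subgroup (Perm Ω)) : 0 < (els G).card :=
  Finset.card_pos.2 ⟨1, mem_els.2 G.one_mem⟩

lemma sum_els {Ω : Type*} [Finite Ω] (G : Subgroup (Perm Ω)) [Fintype G] {M : Type*}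
    [AddCommMonoid M] (f : Perm Ω → M) : ∑ g ∈ els G, f g = ∑ g : G, f g := by
  refine Finset.sum_subtype _ (fun x => mem_els) f

/-- Number of colourings constant on the cycles of `h`. -/
noncomputable def inv {Ω : Type*} (K : Type*) (h : Perm Ω) : ℕ :=
  Nat.card {c : Ω → K // ∀ i, c (h i) = c i}

lemma burnside_range {L A B : Type*} [Group L] [Fintype L] [Finite A] [MulAction L A]
    (Φ : A → B) (hΦ : ∀ (g : L) a, Φ (g • a) = Φ a) :
    Nat.card (Set.range Φ) * Fintype.card L ≤ ∑ g : L, Nat.card (fixedBy A g) := by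
  classical
  have := Fintype.ofFinite A
  have := Fintype.ofFinite (Quotient (orbitRel L A))
  have key := sum_card_fixedBy_eq_card_orbits_mul_card_group L A
  simp only [Nat.card_eq_fintype_card]
  rw [key]
  refine Nat.mul_le_mul_right _ ?_
  have hs : Function.Surjective (Quotient.lift (s := orbitRel L A)
    (fun a => (⟨Φ a, a, rfl⟩ : Set.range Φ)) (by
      rintro a b ⟨g, rfl⟩
      simp [hΦ])) := by
    rintro ⟨_, a, rfl⟩
    exact ⟨Quotient.mk _ a, rfl⟩
  exact Fintype.card_le_of_surjective _ hs

section wreath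
variable {Ω : Type*} [Fintype Ω] {X : Type*} [Group X] {H : Subgroup (Perm Ω)}

lemma conj_inl {f f' : Ω → X} {t : H} (x : Ω → X)
    (h : ∀ i, x i * f i = f' i * x ((t : Perm Ω).symm i)) :
    IsConj (⟨f, t⟩ : Wreath X H) ⟨f', t⟩ := by
  rw [isConj_iff]
  refine ⟨SemidirectProduct.inl x, ?_⟩
  rw [mul_inv_eq_iff_eq_mul]
  ext i
  · exact h i
  · simp

lemma conj_inr {f f' : Ω → X} {t t' : H} (g : H) (hg : g * t = t' * g)
    (h : ∀ i, f ((g : Perm Ω).symm i) = f' i) :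
    IsConj (⟨f, t⟩ : Wreath X H) ⟨f', t'⟩ := by
  rw [isConj_iff]
  refine ⟨SemidirectProduct.inr g, ?_⟩
  rw [mul_inv_eq_iff_eq_mul]
  ext i
  · show 1 * f ((g : Perm Ω).symm i) = f' i * 1
    simp [h]
  · simp only [SemidirectProduct.mul_right, SemidirectProduct.right_inr]
    rw [hg]

/-- A chosen representative of the cycle of `i`. -/
noncomputable def rep (t : Perm Ω) (i : Ω) : Ω :=
  (Quotient.mk (Perm.SameCycle.setoid t) i).out

lemma rep_same (t : Perm Ω) (i : Ω) : t.SameCycle (rep t i) i :=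
  Quotient.exact (s := Perm.SameCycle.setoid t) (Quotient.out_eq _)

lemma rep_congr {t : Perm Ω} {i j : Ω} (h : t.SameCycle i j) : rep t i = rep t j := by
  unfold rep; rw [Quotient.sound (s := Perm.SameCycle.setoid t) h]

lemma rep_fixed {t : Perm Ω} {i : Ω} (h : t i = i) : rep t i = i :=
  (rep_same t i).eq_of_right h

lemma exists_depth (t : Perm Ω) (i : Ω) : ∃ j : ℕ, (t ^ j) (rep t i) = i :=
  (rep_same t i).exists_nat_pow_eq

open scoped Classical in
noncomputable def depth (t : Perm Ω) (i : Ω) : ℕ := Nat.find (exists_depth t i)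

lemma depth_spec (t : Perm Ω) (i : Ω) : (t ^ depth t i) (rep t i) = i := by
  classical exact Nat.find_spec (exists_depth t i)

lemma depth_le {t : Perm Ω} {i : Ω} {j : ℕ} (h : (t ^ j) (rep t i) = i) : depth t i ≤ j := by
  classical exact Nat.find_min' (exists_depth t i) h

lemma depth_succ {t : Perm Ω} {i : Ω} (h : rep t i ≠ i) :
    depth t i = depth t (t.symm i) + 1 := by
  have hr : rep t (t.symm i) = rep t i := rep_congr (by simp [Perm.SameCycle.refl])
  apply le_antisymm
  · apply depth_le
    rw [pow_succ', Perm.mul_apply, ← hr, depth_spec]; simp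
  · have h0 : depth t i ≠ 0 := by
      intro h0
      have := depth_spec t i
      rw [h0] at this
      exact h (by simpa using this)
    obtain ⟨d, hd⟩ := Nat.exists_eq_succ_of_ne_zero h0
    rw [hd]
    apply Nat.succ_le_succ
    apply depth_le
    have := depth_spec t i
    rw [hd, pow_succ', Perm.mul_apply] at this
    rw [hr, Equiv.eq_symm_apply, this]

/-- partial products along a cycle -/
def pprod (t : Perm Ω) (f : Ω → X) (r : Ω) : ℕ → X
  | 0 => 1
  | j + 1 => pprod t f r j * (f ((t ^ (j + 1)) r))⁻¹

open scoped Classical in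
/-- Normal form of an element over `t`. -/
noncomputable def nf (t : Perm Ω) (c : Ω → ConjClasses X) : Ω → X :=
  fun i => if rep t i = i then (c i).exists_rep.choose else 1

lemma conj_nf (f : Ω → X) (t : H) :
    ∃ c : Ω → ConjClasses X, (∀ i, c ((t : Perm Ω) i) = c i) ∧
      IsConj (⟨f, t⟩ : Wreath X H) ⟨nf (t : Perm Ω) c, t⟩ := by
  classical
  set p : Perm Ω := (t : Perm Ω) with hp
  let x : Ω → X := fun i => pprod p f (rep p i) (depth p i)
  let f' : Ω → X := fun i => x i * f i * (x (p.symm i))⁻¹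
  have hf' : ∀ i, rep p i ≠ i → f' i = 1 := by
    intro i hi
    have h1 := depth_succ hi
    have hr : rep p (p.symm i) = rep p i := rep_congr (by simp [Perm.SameCycle.refl])
    simp only [f', x]
    rw [h1, hr, pprod, ← h1, depth_spec]
    simp
  have c1 : IsConj (⟨f, t⟩ : Wreath X H) ⟨f', t⟩ := by
    apply conj_inl x
    intro i
    simp [f', hp]
  let c : Ω → ConjClasses X := fun i => ConjClasses.mk (f' (rep p i))
  have hy : ∀ r, ∃ y : X, y * f' r * y⁻¹ = (ConjClasses.mk (f' r)).exists_rep.choose := by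
    intro r
    have := (ConjClasses.mk (f' r)).exists_rep.choose_spec
    rw [ConjClasses.mk_eq_mk_iff_isConj, isConj_comm, isConj_iff] at this
    exact this
  choose y hy using hy
  refine ⟨c, ?_, c1.trans ?_⟩
  · intro i
    simp only [c]
    rw [rep_congr (t := p) (i := p i) (j := i) (by simp [Perm.SameCycle.refl])]
  · apply conj_inl (fun i => y (rep p i))
    intro i
    have hr : rep p (p.symm i) = rep p i := rep_congr (by simp [Perm.SameCycle.refl])
    rw [← hp, hr]
    by_cases hi : rep p i = i
    · simp only [nf, hi, if_true]
      rw [← mul_inv_eq_iff_eq_mul, hy]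
      simp [c, hi]
    · simp [nf, hi, hf' i hi]

lemma disj_rep {g t : Perm Ω} (h : g.Disjoint t) (i : Ω) : rep t (g i) = g i ↔ rep t i = i := by
  rcases h i with h1 | h1
  · rw [h1]
  · have : t (g i) = g i := by
      have := h.commute.eq
      have h2 := congrArg (fun p : Perm Ω => p i) this
      simp [Perm.mul_apply, h1] at h2
      exact h2.symm
    simp [rep_fixed h1, rep_fixed this]


lemma range_bound [Finite X] (t : H) (L : Subgroup (Perm Ω)) (hL : L ≤ H)
    (hd : ∀ g ∈ L, g.Disjoint (t : Perm Ω)) :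
    (Nat.card (Set.range (fun c : {c : Ω → ConjClasses X // ∀ i, c ((t : Perm Ω) i) = c i} =>
      ConjClasses.mk (⟨nf (t : Perm Ω) c.1, t⟩ : Wreath X H))) : ℝ) ≤
      (∑ g ∈ els L, (inv (ConjClasses X) (g * (t : Perm Ω)) : ℝ)) / (els L).card := by
  classical
  have : Fintype L := Fintype.ofFinite L
  have : Finite (ConjClasses X) := Quotient.finite _
  let A := {c : Ω → ConjClasses X // ∀ i, c ((t : Perm Ω) i) = c i}
  have hcomm : ∀ g ∈ L, ∀ i, g ((t : Perm Ω) i) = (t : Perm Ω) (g i) := by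
    intro g hg i
    have := congrArg (fun p : Perm Ω => p i) (hd g hg).commute.eq
    simpa using this
  let act : MulAction L A :=
    { smul := fun g c => ⟨fun i => c.1 ((g⁻¹ : L) • i), fun i => by
        have h1 := hcomm _ (g⁻¹ : L).2 i
        show c.1 (((g⁻¹ : L) : Perm Ω) ((t : Perm Ω) i)) = c.1 (((g⁻¹ : L) : Perm Ω) i)
        rw [h1, c.2]⟩
      one_smul := fun c => by
        apply Subtype.ext
        funext i
        show c.1 ((1 : L)⁻¹ • i) = c.1 i
        simp
      mul_smul := fun g h c => by
        apply Subtype.ext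
        funext i
        show c.1 ((g * h)⁻¹ • i) = c.1 (h⁻¹ • g⁻¹ • i)
        rw [mul_inv_rev, mul_smul] }
  have hsm : ∀ (g : L) (c : A) i, (g • c).1 i = c.1 ((g : Perm Ω)⁻¹ i) := fun g c i => rfl
  have key := burnside_range (L := L) (A := A)
    (fun c : A => ConjClasses.mk (⟨nf (t : Perm Ω) c.1, t⟩ : Wreath X H)) (by
      intro g c
      rw [ConjClasses.mk_eq_mk_iff_isConj, isConj_comm]
      apply conj_inr ⟨g, hL g.2⟩
      · apply Subtype.ext
        exact (hd g g.2).commute.eq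
      · intro i
        have hdi : rep (t : Perm Ω) ((g : Perm Ω).symm i) = (g : Perm Ω).symm i ↔
            rep (t : Perm Ω) i = i := by
          rw [← disj_rep (hd g g.2)]; simp
        show nf (t : Perm Ω) c.1 ((g : Perm Ω).symm i) = nf (t : Perm Ω) (g • c).1 i
        simp only [nf, hdi, hsm, Perm.inv_def])
  rw [le_div_iff₀ (by exact_mod_cast card_els_pos L), sum_els, card_els, Nat.card_eq_fintype_card (α := L)]
  have key' := (Nat.cast_le (α := ℝ)).2 key
  push_cast at key'
  refine key'.trans ?_
  refine Finset.sum_le_sum fun g _ => ?_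
  have : Nat.card (fixedBy A g) ≤ inv (ConjClasses X) ((g : Perm Ω) * (t : Perm Ω)) := by
    refine Nat.card_le_card_of_injective
      (fun c => (⟨c.1.1, fun i => ?_⟩ :
        {c : Ω → ConjClasses X // ∀ i, c (((g : Perm Ω) * (t : Perm Ω)) i) = c i})) ?_
    · have h1 : g • c.1 = c.1 := c.2
      have h2 : c.1.1 ((g : Perm Ω) ((t : Perm Ω) i)) = c.1.1 ((t : Perm Ω) i) := by
        conv_lhs => rw [← h1]
        rw [hsm]; simp
      rw [Perm.mul_apply, h2, c.1.2]
    · intro a b hab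
      simp only [Subtype.mk.injEq] at hab
      exact Subtype.ext (Subtype.ext hab)
  exact_mod_cast this

lemma master [Finite X] (T : Finset (Perm Ω)) (hTH : ∀ t ∈ T, t ∈ H)
    (hT : ∀ h ∈ H, ∃ t ∈ T, ∃ g ∈ H, g * h * g⁻¹ = t)
    (L : Perm Ω → Subgroup (Perm Ω)) (hL : ∀ t ∈ T, L t ≤ H)
    (hd : ∀ t ∈ T, ∀ g ∈ L t, g.Disjoint t) :
    (kclass (Wreath X H) : ℝ) ≤
      ∑ t ∈ T, (∑ g ∈ els (L t), (inv (ConjClasses X) (g * t) : ℝ)) / (els (L t)).card := by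
  classical
  have : Finite (ConjClasses X) := Quotient.finite _
  let S : T → Set (ConjClasses (Wreath X H)) := fun t =>
    Set.range (fun c : {c : Ω → ConjClasses X // ∀ i, c (t.1 i) = c i} =>
      ConjClasses.mk (⟨nf t.1 c.1, ⟨t.1, hTH _ t.2⟩⟩ : Wreath X H))
  have hcov : (Set.univ : Set (ConjClasses (Wreath X H))) = ⋃ t, S t := by
    symm
    rw [Set.eq_univ_iff_forall]
    intro q
    obtain ⟨⟨f, h⟩, rfl⟩ := ConjClasses.exists_rep q
    obtain ⟨t, ht, g, hg, hgt⟩ := hT h h.2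
    have c1 : IsConj (⟨f, h⟩ : Wreath X H) ⟨fun i => f (g.symm i), ⟨t, hTH t ht⟩⟩ := by
      apply conj_inr ⟨g, hg⟩
      · apply Subtype.ext
        show g * h = t * g
        rw [← hgt]; group
      · intro i; rfl
    obtain ⟨c, hc, c2⟩ := conj_nf (H := H) (fun i => f (g.symm i)) ⟨t, hTH t ht⟩
    rw [Set.mem_iUnion]
    refine ⟨⟨t, ht⟩, ⟨c, hc⟩, ?_⟩
    rw [ConjClasses.mk_eq_mk_iff_isConj]
    exact (c1.trans c2).symm
  have hfin : ∀ t, (S t).Finite := fun t => Set.finite_range _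
  have h1 : kclass (Wreath X H) ≤ ∑ t : T, Nat.card (S t) := by
    unfold kclass
    rw [← Set.ncard_univ, hcov, Finset.sum_congr rfl (fun t _ => Nat.card_coe_set_eq (S t))]
    have : (⋃ t, S t) = ⋃ t ∈ (Finset.univ : Finset T), S t := by simp
    rw [this]
    exact Finset.set_ncard_biUnion_le _ _
  rw [← Finset.sum_coe_sort T]
  refine le_trans (Nat.cast_le.2 h1) ?_
  push_cast
  refine Finset.sum_le_sum fun t _ => ?_
  exact range_bound (H := H) (X := X) ⟨t.1, hTH _ t.2⟩ (L t) (hL _ t.2) (hd _ t.2)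

end wreath
end WS

namespace WS
open Finset
set_option linter.unusedSectionVars false

noncomputable def yy : ℝ := (Real.sqrt 2)⁻¹

lemma yy_pos : 0 < yy := by unfold yy; positivity
lemma yy_sq : yy ^ 2 = 1 / 2 := by
  unfold yy; rw [inv_pow, Real.sq_sqrt (by norm_num)]; norm_num
lemma yy_lt_one : yy < 1 := by
  have := yy_sq; have := yy_pos; nlinarith
lemma yy_pow_le {a b : ℕ} (h : a ≤ b) : yy ^ b ≤ yy ^ a :=
  pow_le_pow_of_le_one yy_pos.le yy_lt_one.le h
lemma yy_pow_le_one (a : ℕ) : yy ^ a ≤ 1 := pow_le_one₀ yy_pos.le yy_lt_one.le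
lemma yy_pow_pos (a : ℕ) : 0 < yy ^ a := pow_pos yy_pos a

section
variable {Ω : Type*} [Fintype Ω] [DecidableEq Ω]

/-- number of cycles: `2 * #cycles + supp ≤ 2 n`. -/
lemma cyc_bound (h : Perm Ω) :
    2 * Nat.card (Quotient (Perm.SameCycle.setoid h)) + h.support.card ≤ 2 * Fintype.card Ω := by
  classical
  let Q := Quotient (Perm.SameCycle.setoid h)
  have : Fintype Q := Fintype.ofFinite Q
  let π : Ω → Q := fun i => Quotient.mk (Perm.SameCycle.setoid h) i
  rw [Nat.card_eq_fintype_card]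
  have h1 : ∀ q : Q, 2 + (h.support.filter (fun i => π i = q)).card ≤
      2 * (univ.filter (fun i => π i = q)).card := by
    intro q
    obtain ⟨i, rfl⟩ := Quotient.exists_rep q
    by_cases hi : h i = i
    · have : h.support.filter (fun j => π j = π i) = ∅ := by
        ext j
        simp only [mem_filter, Perm.mem_support, notMem_empty, iff_false, not_and]
        intro hj hji
        have hs : h.SameCycle j i := Quotient.exact (s := Perm.SameCycle.setoid h) hji
        exact hj (hs.apply_eq_self_iff.2 hi)
      change 2 + (h.support.filter (fun j => π j = π i)).card ≤
        2 * (univ.filter (fun j => π j = π i)).card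
      rw [this]
      have : 0 < (univ.filter (fun j => π j = π i)).card := card_pos.2 ⟨i, by simp⟩
      rw [card_empty]; omega
    · change 2 + (h.support.filter (fun j => π j = π i)).card ≤
        2 * (univ.filter (fun j => π j = π i)).card
      have h2 : (h.support.filter (fun j => π j = π i)).card ≤
        (univ.filter (fun j => π j = π i)).card := card_le_card (filter_subset_filter _ (subset_univ _))
      have h3 : 2 ≤ (univ.filter (fun j => π j = π i)).card := by
        rw [← Finset.card_pair hi]
        apply card_le_card
        intro j hj
        simp only [mem_insert, mem_singleton] at hj
        simp only [mem_filter, mem_univ, true_and]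
        rcases hj with rfl | rfl
        · exact Quotient.sound (s := Perm.SameCycle.setoid h)
            (by show h.SameCycle (h i) i; simp [Perm.SameCycle.refl])
        · rfl
      omega
  have h2 := Finset.sum_le_sum (s := (univ : Finset Q)) (fun q _ => h1 q)
  rw [Finset.sum_add_distrib, ← Finset.mul_sum,
    ← card_eq_sum_card_fiberwise (fun _ _ => by simp),
    ← card_eq_sum_card_fiberwise (fun _ _ => by simp)] at h2
  simpa [mul_comm] using h2

lemma inv_le_pow (K : Type*) [Finite K] (h : Perm Ω) :
    inv K h ≤ Nat.card K ^ Nat.card (Quotient (Perm.SameCycle.setoid h)) := by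
  classical
  have : Finite (Quotient (Perm.SameCycle.setoid h)) := Quotient.finite _
  rw [← Nat.card_fun]
  have key : ∀ (c : {c : Ω → K // ∀ i, c (h i) = c i}) (a b : Ω), h.SameCycle a b →
      c.1 a = c.1 b := by
    intro c a b hab
    obtain ⟨j, hj⟩ := hab.exists_nat_pow_eq
    rw [← hj]
    clear hj
    induction j with
    | zero => simp
    | succ j ih => rw [pow_succ', Perm.mul_apply, c.2, ih]
  refine Nat.card_le_card_of_injective (fun c q => Quotient.lift (s := Perm.SameCycle.setoid h) c.1
    (key c) q) ?_
  intro c d hcd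
  apply Subtype.ext
  funext i
  exact congrFun hcd (Quotient.mk (Perm.SameCycle.setoid h) i)

lemma inv_le (K : Type*) [Finite K] (hK : 2 ≤ Nat.card K) (h : Perm Ω) :
    (inv K h : ℝ) ≤ (Nat.card K : ℝ) ^ Fintype.card Ω * yy ^ h.support.card := by
  have h1 := inv_le_pow K h
  have h2 := cyc_bound h
  set q := Nat.card (Quotient (Perm.SameCycle.setoid h))
  set k := Nat.card K
  obtain ⟨e, he⟩ : ∃ e, Fintype.card Ω = q + e := ⟨Fintype.card Ω - q, by omega⟩
  have h3 : yy ^ (2 * e) ≤ yy ^ h.support.card := yy_pow_le (by omega)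
  rw [pow_mul, yy_sq] at h3
  have hk : (2 : ℝ) ≤ k := by exact_mod_cast hK
  have h4 : (1 : ℝ) ≤ (k : ℝ) ^ e * (1 / 2) ^ e := by
    rw [← mul_pow]; apply one_le_pow₀; linarith
  calc (inv K h : ℝ) ≤ (k : ℝ) ^ q := by exact_mod_cast h1
    _ ≤ (k : ℝ) ^ q * ((k : ℝ) ^ e * (1 / 2) ^ e) := le_mul_of_one_le_right (by positivity) h4
    _ = (k : ℝ) ^ (q + e) * (1 / 2) ^ e := by ring
    _ ≤ _ := by rw [he]; gcongr

lemma inv_le_of_ne (K : Type*) [Finite K] (hK : 2 ≤ Nat.card K) {h : Perm Ω} (h1 : h ≠ 1) :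
    (inv K h : ℝ) ≤ (Nat.card K : ℝ) ^ (Fintype.card Ω - 1) := by
  have h1' := inv_le_pow K h
  have h2 := cyc_bound h
  have h3 : 2 ≤ h.support.card := Perm.two_le_card_support_of_ne_one h1
  have h1' := (Nat.cast_le (α := ℝ)).2 h1'
  push_cast at h1'
  refine h1'.trans ?_
  apply pow_le_pow_right₀
  · exact_mod_cast (by omega : 1 ≤ Nat.card K)
  · omega

lemma inv_one (K : Type*) [Finite K] : inv K (1 : Perm Ω) = Nat.card K ^ Fintype.card Ω := by
  unfold inv
  rw [Nat.card_congr (Equiv.subtypeUnivEquiv (by simp)), Nat.card_fun, Nat.card_eq_fintype_card (α := Ω)]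

/-- average of `yy ^ supp` over a transitive group -/
lemma avg_bound (H : Subgroup (Perm Ω)) (htr : IsPretransitive H Ω) (hn : 0 < Fintype.card Ω) :
    (∑ g ∈ els H, yy ^ g.support.card) / (els H).card ≤
      yy ^ (Fintype.card Ω / 2) + 2 / Fintype.card Ω := by
  classical
  have : Fintype H := Fintype.ofFinite H
  have hne : Nonempty Ω := Fintype.card_pos_iff.1 hn
  set n := Fintype.card Ω
  have hb : (∑ g ∈ els H, (n - g.support.card)) = (els H).card := by
    have := Fintype.ofFinite (Quotient (orbitRel H Ω))
    have key := sum_card_fixedBy_eq_card_orbits_mul_card_group H Ω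
    have h1 : Fintype.card (Quotient (orbitRel H Ω)) = 1 := by
      rw [Fintype.card_eq_one_iff]
      refine ⟨Quotient.mk _ hne.some, fun q => ?_⟩
      obtain ⟨x, rfl⟩ := Quotient.exists_rep q
      apply Quotient.sound (s := orbitRel H Ω)
      exact exists_smul_eq H _ _
    rw [h1, one_mul] at key
    rw [card_els, Nat.card_eq_fintype_card, ← key, sum_els]
    refine Finset.sum_congr rfl fun g _ => ?_
    have : Fintype.card (fixedBy Ω g) = ((g : Perm Ω).supportᶜ).card := by
      rw [Fintype.card_subtype]
      congr 1
      ext x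
      simp [mem_fixedBy, Subgroup.smul_def]
    rw [this, card_compl]
  have hnr : (0 : ℝ) < n := by exact_mod_cast hn
  have h2 : ∀ g ∈ els H, yy ^ g.support.card ≤
      yy ^ (n / 2) + 2 / n * ((n - g.support.card : ℕ) : ℝ) := by
    intro g _
    have hle : g.support.card ≤ n := card_le_univ _
    by_cases h : n / 2 ≤ g.support.card
    · have := yy_pow_le h
      have : (0 : ℝ) ≤ 2 / n * ((n - g.support.card : ℕ) : ℝ) := by positivity
      linarith
    · have h3 : (1 : ℝ) ≤ 2 / n * ((n - g.support.card : ℕ) : ℝ) := by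
        rw [div_mul_eq_mul_div, le_div_iff₀ hnr, one_mul]
        exact_mod_cast (by omega : n ≤ 2 * (n - g.support.card))
      have := yy_pow_le_one g.support.card
      have := yy_pow_pos (n / 2)
      linarith
  have hc : (0 : ℝ) < (els H).card := by exact_mod_cast card_els_pos H
  rw [div_le_iff₀ hc]
  refine (Finset.sum_le_sum h2).trans ?_
  rw [Finset.sum_add_distrib, ← Finset.mul_sum, ← Nat.cast_sum, hb]
  simp
  linarith
end
end WS

namespace WS
open Finset
set_option linter.unusedSectionVars false

lemma equi {Γ Y : Type*} [DecidableEq Y] (E : Finset Γ) (ψ : Γ → Y) (S : Finset Y)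
    (hS : ∀ g ∈ E, ψ g ∈ S) (N : ℕ) (hN : ∀ y ∈ S, (E.filter (fun g => ψ g = y)).card = N)
    (P : Y → Prop) [DecidablePred P] :
    (E.filter (fun g => P (ψ g))).card * S.card = E.card * (S.filter P).card := by
  have h1 : E.card = S.card * N := by
    rw [card_eq_sum_card_fiberwise (f := ψ) (t := S) (fun g hg => hS g hg), sum_congr rfl hN]
    simp
  have h2 : (E.filter (fun g => P (ψ g))).card = (S.filter P).card * N := by
    rw [card_eq_sum_card_fiberwise (f := ψ) (t := S.filter P)]
    · rw [sum_congr rfl (g := fun _ => N)]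
      · simp
      · intro y hy
        rw [mem_filter] at hy
        rw [← hN y hy.1, filter_filter]
        congr 1
        apply filter_congr
        intro g _
        constructor
        · exact fun h => h.2
        · exact fun h => ⟨h ▸ hy.2, h⟩
    · intro g hg
      simp only [coe_filter, Set.mem_ofPred_eq] at hg ⊢
      exact ⟨hS g hg.1, hg.2⟩
  rw [h1, h2]; ring

section
variable {Ω : Type*} [Fintype Ω] [DecidableEq Ω]

def TwoTr (G : Subgroup (Perm Ω)) : Prop :=
  ∀ a b c d : Ω, a ≠ b → c ≠ d → ∃ g ∈ G, g a = c ∧ g b = d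

lemma equi_two {G : Subgroup (Perm Ω)} (hG : TwoTr G) {a b : Ω} (hab : a ≠ b)
    (P : Ω × Ω → Prop) [DecidablePred P] :
    ((els G).filter (fun g => P (g a, g b))).card * (Fintype.card Ω * (Fintype.card Ω - 1)) =
      (els G).card * ((univ : Finset Ω).offDiag.filter P).card := by
  have := equi (els G) (fun g => (g a, g b)) (univ : Finset Ω).offDiag (by
    intro g _; simp [hab])
    ((els G).filter (fun g => (g a, g b) = (a, b))).card (by
      rintro ⟨c, d⟩ hcd
      simp only [mem_offDiag, mem_univ, true_and] at hcd
      obtain ⟨t, htG, rfl, rfl⟩ := hG a b c d hab hcd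
      apply card_bij' (fun g _ => t⁻¹ * g) (fun g _ => t * g)
      · intro g hg
        simp only [mem_filter, mem_els, Prod.mk.injEq] at hg ⊢
        refine ⟨G.mul_mem (G.inv_mem htG) hg.1, ?_⟩
        simp [hg.2.1, hg.2.2]
      · intro g hg
        simp only [mem_filter, mem_els, Prod.mk.injEq] at hg ⊢
        refine ⟨G.mul_mem htG hg.1, ?_⟩
        simp [hg.2.1, hg.2.2]
      · intro g _; simp
      · intro g _; simp) P
  rw [← this, offDiag_card, card_univ, Nat.mul_sub_one]

lemma equi_one {G : Subgroup (Perm Ω)} (hG : IsPretransitive G Ω) (a : Ω)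
    (P : Ω → Prop) [DecidablePred P] :
    ((els G).filter (fun g => P (g a))).card * Fintype.card Ω =
      (els G).card * ((univ : Finset Ω).filter P).card := by
  have := equi (els G) (fun g => g a) (univ : Finset Ω) (by
    intro g _; simp)
    ((els G).filter (fun g => g a = a)).card (by
      rintro c -
      obtain ⟨⟨t, htG⟩, hta⟩ := exists_smul_eq G a c
      have hta : t a = c := hta
      apply card_bij' (fun g _ => t⁻¹ * g) (fun g _ => t * g)
      · intro g hg
        simp only [mem_filter, mem_els] at hg ⊢
        refine ⟨G.mul_mem (G.inv_mem htG) hg.1, ?_⟩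
        simp [hg.2, ← hta]
      · intro g hg
        simp only [mem_filter, mem_els] at hg ⊢
        refine ⟨G.mul_mem htG hg.1, ?_⟩
        simp [hg.2, hta]
      · intro g _; simp
      · intro g _; simp) P
  rw [← this, card_univ]

lemma comm_support (u v : Perm Ω) :
    (u * v * u⁻¹ * v⁻¹).support ⊆ (u.support ∩ v.support) ∪
      ((u.support ∩ v.support).image u ∪ (u.support ∩ v.support).image v) := by
  intro x hx
  by_contra hn
  simp only [mem_union, not_or, mem_image, not_exists, not_and, mem_inter] at hn
  obtain ⟨h1, h2, h3⟩ := hn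
  rw [Perm.mem_support] at hx
  apply hx
  simp only [Perm.mul_apply]
  by_cases hxv : x ∈ v.support
  · have hxu : x ∉ u.support := fun h => h1 h hxv
    have h4 : v⁻¹ x ∉ u.support := by
      intro h
      exact h3 (v⁻¹ x) ⟨h, by rwa [← Perm.support_inv, Perm.apply_mem_support, Perm.support_inv]⟩ (by simp)
    rw [Perm.notMem_support] at h4 hxu
    have h5 : u⁻¹ (v⁻¹ x) = v⁻¹ x := by rw [Perm.inv_eq_iff_eq, h4]
    rw [h5]; simp [hxu]
  · have h0 : v⁻¹ x = x := by
      rw [Perm.notMem_support] at hxv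
      rw [Perm.inv_eq_iff_eq, hxv]
    rw [h0]
    have h4 : u⁻¹ x ∉ v.support := by
      intro h
      by_cases h5 : u⁻¹ x ∈ u.support
      · exact h2 (u⁻¹ x) ⟨h5, h⟩ (by simp)
      · rw [Perm.notMem_support] at h5
        have : u⁻¹ x = x := by
          have h6 : u (u⁻¹ x) = x := by simp
          rw [← h5, h6]
        rw [this] at h; exact hxv h
    rw [Perm.notMem_support] at h4
    rw [h4]; simp

lemma comm_support_card (u v : Perm Ω) :
    (u * v * u⁻¹ * v⁻¹).support.card ≤ 3 * (u.support ∩ v.support).card := by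
  refine (card_le_card (comm_support u v)).trans ?_
  refine (card_union_le _ _).trans ?_
  have := card_union_le ((u.support ∩ v.support).image u) ((u.support ∩ v.support).image v)
  have h1 := card_image_le (s := u.support ∩ v.support) (f := u)
  have h2 := card_image_le (s := u.support ∩ v.support) (f := v)
  omega

lemma bochert {G : Subgroup (Perm Ω)} (hp : IsPreprimitive G Ω) (hG : TwoTr G)
    (hA : ¬ alternatingGroup Ω ≤ G) (hm : 27 ≤ Fintype.card Ω) :
    ∀ u ∈ G, u ≠ 1 → Fintype.card Ω < 8 * u.support.card := by
  classical
  by_contra hcon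
  push Not at hcon
  obtain ⟨u0, hu0, hu01, hu0s⟩ := hcon
  obtain ⟨u, hu, humin⟩ := exists_min_image ((els G).erase 1) (fun g => g.support.card)
    ⟨u0, by simp [hu01, mem_els, hu0]⟩
  simp only [mem_erase, mem_els] at hu humin
  obtain ⟨hu1, huG⟩ := hu
  have hus : 8 * u.support.card ≤ Fintype.card Ω :=
    le_trans (Nat.mul_le_mul_left 8 (humin u0 ⟨hu01, hu0⟩)) hu0s
  set S := u.support with hS
  set s := S.card with hs
  set m := Fintype.card Ω with hmdef
  have hs2 : 2 ≤ s := Perm.two_le_card_support_of_ne_one hu1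
  let I : Perm Ω → Finset Ω := fun x => S.filter (fun a => x a ∈ S)
  let N : Perm Ω → Finset Ω := fun x => S.filter (fun a => x a ∈ S ∧ x (u a) ∉ S)
  have hsupp : ∀ x : Perm Ω, S ∩ (x⁻¹ * u * x).support = I x := by
    intro x
    ext a
    simp only [mem_inter, I, mem_filter, hS, Perm.mem_support, Perm.mul_apply, ne_eq,
      Perm.inv_eq_iff_eq]
  have hnc : ∀ x : Perm Ω, (N x).Nonempty →
      u * (x⁻¹ * u * x) * u⁻¹ * (x⁻¹ * u * x)⁻¹ ≠ 1 := by
    rintro x ⟨a, ha⟩ h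
    simp only [N, mem_filter] at ha
    obtain ⟨-, h1, h2⟩ := ha
    set v := x⁻¹ * u * x with hv
    have hc : u * v = v * u := by
      rw [mul_inv_eq_one] at h
      exact mul_inv_eq_iff_eq_mul.1 h
    have hva : v a ≠ a := by
      rw [hv]; simp only [Perm.mul_apply, ne_eq, Perm.inv_eq_iff_eq]
      exact Perm.mem_support.1 h1
    have hvu : v (u a) = u a := by
      rw [hv]; simp only [Perm.mul_apply, Perm.inv_eq_iff_eq]
      exact Perm.notMem_support.1 h2
    have := congrArg (fun p : Perm Ω => p a) hc
    simp only [Perm.mul_apply, hvu] at this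
    exact hva (u.injective this)
  have hmem : ∀ x ∈ els G, u * (x⁻¹ * u * x) * u⁻¹ * (x⁻¹ * u * x)⁻¹ ∈ G := by
    intro x hx
    rw [mem_els] at hx
    have : x⁻¹ * u * x ∈ G := G.mul_mem (G.mul_mem (G.inv_mem hx) huG) hx
    exact G.mul_mem (G.mul_mem (G.mul_mem huG this) (G.inv_mem huG)) (G.inv_mem this)
  have K1 : ∀ x ∈ els G, (I x).card ≠ 1 := by
    intro x hx h1
    obtain ⟨a, ha⟩ := card_eq_one.1 h1
    have haI : a ∈ I x := by rw [ha]; simp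
    simp only [I, mem_filter] at haI
    have hNx : (N x).Nonempty := by
      refine ⟨a, ?_⟩
      simp only [N, mem_filter]
      refine ⟨haI.1, haI.2, fun h => ?_⟩
      have : u a ∈ I x := by
        simp only [I, mem_filter]
        exact ⟨Perm.apply_mem_support.2 haI.1, h⟩
      rw [ha, mem_singleton] at this
      exact (Perm.mem_support.1 haI.1) this
    have h3 := comm_support_card u (x⁻¹ * u * x)
    rw [← hS, hsupp, h1] at h3
    have h2 := Perm.two_le_card_support_of_ne_one (hnc x hNx)
    apply hA
    refine Perm.alternatingGroup_le_of_isPreprimitive_of_isThreeCycle_mem hp ?_ (hmem x hx)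
    rw [← _root_.card_support_eq_three_iff]
    by_contra h4
    have h5 : (u * (x⁻¹ * u * x) * u⁻¹ * (x⁻¹ * u * x)⁻¹).support.card = 2 := by omega
    rw [Perm.card_support_eq_two] at h5
    have h6 := h5.sign_eq
    simp only [Perm.sign_mul, Perm.sign_inv] at h6
    rcases Int.units_eq_one_or (Perm.sign u) with h | h <;>
    rcases Int.units_eq_one_or (Perm.sign x) with h' | h' <;> simp [h, h'] at h6
  have K2 : ∀ x ∈ els G, s * (N x).card ≤ 3 * (I x).card ^ 2 := by
    intro x hx
    rcases (N x).eq_empty_or_nonempty with h | h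
    · rw [h]; simp
    · have h1 := humin _ ⟨hnc x h, hmem x hx⟩
      have h3 := comm_support_card u (x⁻¹ * u * x)
      rw [← hS, hsupp] at h3
      have h4 : (N x).card ≤ (I x).card := by
        apply card_le_card
        intro a ha
        simp only [N, I, mem_filter] at ha ⊢
        exact ⟨ha.1, ha.2.1⟩
      have h5 : s ≤ 3 * (I x).card := h1.trans h3
      calc s * (N x).card ≤ (3 * (I x).card) * (I x).card := Nat.mul_le_mul h5 h4
        _ = _ := by ring
  -- sums
  have hm1 : 1 ≤ m := by omega
  set g := (els G).card with hg
  have hgpos : 0 < g := card_els_pos G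
  have S1 : (∑ x ∈ els G, (I x).card) * m = g * s ^ 2 := by
    have : ∑ x ∈ els G, (I x).card = ∑ a ∈ S, ((els G).filter (fun x => x a ∈ S)).card :=
      sum_card_bipartiteAbove_eq_sum_card_bipartiteBelow (fun (x : Perm Ω) a => x a ∈ S)
    rw [this, sum_mul, sum_congr rfl (fun a _ => equi_one hp.toIsPretransitive a (· ∈ S))]
    simp
    ring
  have S2 : (∑ x ∈ els G, ((I x).card * (I x).card - (I x).card)) * (m * (m - 1)) =
      g * (s * s - s) ^ 2 := by
    have h1 : ∑ x ∈ els G, ((I x).card * (I x).card - (I x).card) =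
        ∑ p ∈ S.offDiag, ((els G).filter (fun x => x p.1 ∈ S ∧ x p.2 ∈ S)).card := by
      refine Eq.trans ?_ (sum_card_bipartiteAbove_eq_sum_card_bipartiteBelow (s := els G)
        (t := S.offDiag) (fun (x : Perm Ω) (p : Ω × Ω) => x p.1 ∈ S ∧ x p.2 ∈ S))
      refine sum_congr rfl fun x _ => ?_
      rw [← offDiag_card]
      congr 1
      ext p
      simp only [mem_offDiag, I, mem_filter, bipartiteAbove]
      tauto
    rw [h1, sum_mul, sum_congr rfl (g := fun _ => g * (s * s - s))]
    · rw [sum_const, offDiag_card, smul_eq_mul]; ring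
    · rintro ⟨a, b⟩ hab
      have hab' : a ≠ b := (mem_offDiag.1 hab).2.2
      have := equi_two hG hab' (fun p => p.1 ∈ S ∧ p.2 ∈ S)
      rw [this, ← offDiag_card]
      congr 2
      ext p
      simp only [mem_filter, mem_offDiag, mem_univ]
      tauto
  have S3 : (∑ x ∈ els G, (N x).card) * (m * (m - 1)) = g * (s * (s * (m - s))) := by
    have h1 : ∑ x ∈ els G, (N x).card =
        ∑ a ∈ S, ((els G).filter (fun x => x a ∈ S ∧ x (u a) ∉ S)).card :=
      sum_card_bipartiteAbove_eq_sum_card_bipartiteBelow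
        (fun (x : Perm Ω) a => x a ∈ S ∧ x (u a) ∉ S)
    rw [h1, sum_mul, sum_congr rfl (g := fun _ => g * (s * (m - s)))]
    · simp; ring
    · intro a ha
      have hab' : a ≠ u a := (Perm.mem_support.1 ha).symm
      have := equi_two hG hab' (fun p => p.1 ∈ S ∧ p.2 ∉ S)
      rw [this]
      have h3 : s * (m - s) = (S ×ˢ Sᶜ).card := by rw [card_product, card_compl]
      rw [h3]
      congr 2
      ext p
      simp only [mem_filter, mem_offDiag, mem_univ, mem_product, mem_compl]
      constructor
      · exact fun h => h.2
      · exact fun h => ⟨⟨trivial, trivial, fun he => h.2 (he ▸ h.1)⟩, h⟩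
  have A1 : ∑ x ∈ els G, (I x).card ≤ ∑ x ∈ els G, ((I x).card * (I x).card - (I x).card) := by
    refine sum_le_sum fun x hx => ?_
    have := K1 x hx
    rcases Nat.eq_zero_or_pos (I x).card with h | h
    · simp [h]
    · have h2 : 2 ≤ (I x).card := by omega
      have : 2 * (I x).card ≤ (I x).card * (I x).card := Nat.mul_le_mul_right _ h2
      omega
  have A2 : s * ∑ x ∈ els G, (N x).card ≤
      3 * (∑ x ∈ els G, ((I x).card * (I x).card - (I x).card) + ∑ x ∈ els G, (I x).card) := by
    rw [← sum_add_distrib, mul_sum, mul_sum]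
    refine sum_le_sum fun x hx => ?_
    have := K2 x hx
    have h3 : (I x).card ≤ (I x).card * (I x).card := Nat.le_mul_self _
    rw [Nat.sub_add_cancel h3, ← sq]; exact this
  generalize (∑ x ∈ els G, (I x).card) = σ1 at *
  generalize (∑ x ∈ els G, ((I x).card * (I x).card - (I x).card)) = σ2 at *
  generalize (∑ x ∈ els G, (N x).card) = σ3 at *
  have B1 : m - 1 ≤ (s - 1) ^ 2 := by
    have h1 : g * s ^ 2 * (m - 1) ≤ g * s ^ 2 * (s - 1) ^ 2 := by
      calc g * s ^ 2 * (m - 1) = σ1 * m * (m - 1) := by rw [S1]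
        _ ≤ σ2 * (m * (m - 1)) := by rw [mul_assoc]; exact Nat.mul_le_mul_right _ A1
        _ = g * (s * s - s) ^ 2 := S2
        _ = _ := by rw [← Nat.mul_sub_one]; ring
    exact Nat.le_of_mul_le_mul_left h1 (by positivity)
  have B2 : s * (m - s) ≤ 3 * ((s - 1) ^ 2 + (m - 1)) := by
    have h1 : g * s ^ 2 * (s * (m - s)) ≤ g * s ^ 2 * (3 * ((s - 1) ^ 2 + (m - 1))) := by
      calc g * s ^ 2 * (s * (m - s)) = s * (σ3 * (m * (m - 1))) := by rw [S3]; ring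
        _ = s * σ3 * (m * (m - 1)) := by ring
        _ ≤ 3 * (σ2 + σ1) * (m * (m - 1)) := Nat.mul_le_mul_right _ A2
        _ = 3 * (σ2 * (m * (m - 1)) + (σ1 * m) * (m - 1)) := by ring
        _ = _ := by rw [S2, S1, ← Nat.mul_sub_one]; ring
    exact Nat.le_of_mul_le_mul_left h1 (by positivity)
  obtain ⟨s', hs'⟩ : ∃ s', s = s' + 1 := ⟨s - 1, by omega⟩
  obtain ⟨m', hm'⟩ : ∃ m', m = m' + 1 := ⟨m - 1, by omega⟩
  obtain ⟨r, hr⟩ : ∃ r, m = s + r := ⟨m - s, by omega⟩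
  have e1 : m - s = r := by omega
  have e2 : m - 1 = m' := by omega
  have e3 : s - 1 = s' := by omega
  rw [e2, e3] at B1
  rw [e1, e2, e3] at B2
  have : s ≤ 6 := by
    by_contra h7
    have h7 : 7 ≤ s := by omega
    nlinarith
  have : s' ≤ 5 := by omega
  nlinarith
end
end WS

namespace WS
open Finset
set_option linter.unusedSectionVars false
set_option linter.unusedSimpArgs false

section
variable {Ω : Type*} [Fintype Ω] [DecidableEq Ω]

lemma minPer_pos (g : Perm Ω) (x : Ω) : 0 < Function.minimalPeriod g x := by
  apply Function.minimalPeriod_pos_of_mem_periodicPts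
  refine ⟨orderOf g, orderOf_pos g, ?_⟩
  show g^[orderOf g] x = x
  rw [Perm.iterate_eq_pow, pow_orderOf_eq_one]; rfl

lemma minPer_dvd_iff (g : Perm Ω) (x : Ω) (N : ℕ) : Function.minimalPeriod g x ∣ N ↔ (g ^ N) x = x := by
  rw [← Function.isPeriodicPt_iff_minimalPeriod_dvd]
  show g^[N] x = x ↔ _
  rw [Perm.iterate_eq_pow]

lemma minPer_le (g : Perm Ω) (x : Ω) : Function.minimalPeriod g x ≤ Fintype.card Ω := by
  have : Set.InjOn (fun k => g^[k] x) (Set.Iio (Function.minimalPeriod g x)) :=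
    Function.iterate_injOn_Iio_minimalPeriod
  have h := Finset.card_le_card_of_injOn (s := range (Function.minimalPeriod g x)) (t := (univ : Finset Ω))
    (fun k => g^[k] x) (fun _ _ => by simp) (by simpa using this)
  simpa using h

lemma prime_trick (g : Perm Ω) (P : ℕ) (hP : Fintype.card Ω < P ^ 4) (ps : Finset ℕ)
    (hprime : ∀ p ∈ ps, p.Prime) (hbig : ∀ p ∈ ps, P < p) (hcard : ps.card = 25)
    (hpt : ∀ p ∈ ps, ∃ x, p ∣ Function.minimalPeriod g x) :
    ∃ N : ℕ, g ^ N ≠ 1 ∧ 25 * (g ^ N).support.card ≤ 3 * Fintype.card Ω := by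
  classical
  have h3 : ∀ x : Ω, (ps.filter (fun p => p ∣ Function.minimalPeriod g x)).card ≤ 3 := by
    intro x
    by_contra h
    have h' : 4 ≤ (ps.filter (fun p => p ∣ Function.minimalPeriod g x)).card := by omega
    obtain ⟨q, hq, hq4⟩ := exists_subset_card_eq h'
    have h1 : ∏ p ∈ q, p ∣ Function.minimalPeriod g x := by
      apply Finset.prod_primes_dvd
      · intro p hp
        exact (hprime p (mem_filter.1 (hq hp)).1).prime
      · intro p hp
        exact (mem_filter.1 (hq hp)).2
    have h2 : P ^ 4 ≤ ∏ p ∈ q, p := by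
      rw [← hq4, ← Finset.prod_const]
      exact Finset.prod_le_prod' (fun p hp => (hbig p (mem_filter.1 (hq hp)).1).le)
    have h4 := Nat.le_of_dvd (minPer_pos g x) h1
    have := minPer_le g x
    omega
  have hsum : ∑ p ∈ ps, ((univ : Finset Ω).filter (fun x => p ∣ Function.minimalPeriod g x)).card
      ≤ 3 * Fintype.card Ω := by
    have := sum_card_bipartiteAbove_eq_sum_card_bipartiteBelow (s := ps) (t := (univ : Finset Ω))
      (fun p x => p ∣ Function.minimalPeriod g x)
    refine le_trans (le_of_eq this) ?_
    refine (sum_le_sum (fun x _ => h3 x)).trans ?_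
    simp [mul_comm]
  obtain ⟨p, hp, hple⟩ : ∃ p ∈ ps, 25 * ((univ : Finset Ω).filter
      (fun x => p ∣ Function.minimalPeriod g x)).card ≤ 3 * Fintype.card Ω := by
    by_contra! h
    have hne : ps.Nonempty := by rw [← card_pos]; omega
    have := sum_lt_sum_of_nonempty hne h
    rw [sum_const, hcard, smul_eq_mul, ← mul_sum] at this
    omega
  have hpp := hprime p hp
  have ho : orderOf g ≠ 0 := (orderOf_pos g).ne'
  refine ⟨ordCompl[p] (orderOf g), ?_, ?_⟩
  · intro h1
    obtain ⟨x, hx⟩ := hpt p hp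
    have h2 : Function.minimalPeriod g x ∣ ordCompl[p] (orderOf g) := by
      rw [minPer_dvd_iff, h1]; rfl
    exact Nat.not_dvd_ordCompl hpp ho (hx.trans h2)
  · refine le_trans (Nat.mul_le_mul_left 25 (card_le_card ?_)) hple
    intro x hx
    rw [mem_filter]
    refine ⟨mem_univ _, ?_⟩
    by_contra hnd
    rw [Perm.mem_support] at hx
    apply hx
    rw [← minPer_dvd_iff]
    have h1 : Function.minimalPeriod g x ∣ orderOf g := by
      rw [minPer_dvd_iff, pow_orderOf_eq_one]; rfl
    rw [← Nat.ordProj_mul_ordCompl_eq_self (orderOf g) p] at h1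
    refine Nat.Coprime.dvd_of_dvd_mul_left ?_ h1
    exact Nat.Coprime.pow_right _ ((Nat.Prime.coprime_iff_not_dvd hpp).2 hnd).symm

lemma exists_primes (P : ℕ) (hP : 0 < P) :
    ∃ p : ℕ → ℕ, StrictMono p ∧ (∀ i, (p i).Prime) ∧ (∀ i, P < p i) ∧ ∀ i, p i ≤ 2 ^ (i + 1) * P := by
  have hex : ∀ a : ℕ, ∃ q : ℕ, 0 < a → q.Prime ∧ a < q ∧ q ≤ 2 * a := by
    intro a
    by_cases h : a = 0
    · exact ⟨0, fun h' => by omega⟩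
    · obtain ⟨q, hq⟩ := Nat.exists_prime_lt_and_le_two_mul a h
      exact ⟨q, fun _ => hq⟩
  choose f hf using hex
  let p : ℕ → ℕ := fun i => Nat.rec (f P) (fun _ a => f a) i
  have h0 : p 0 = f P := rfl
  have hs : ∀ i, p (i + 1) = f (p i) := fun i => rfl
  have hpp : ∀ i, (p i).Prime ∧ P < p i ∧ p i ≤ 2 ^ (i + 1) * P := by
    intro i
    induction i with
    | zero => rw [h0]; have := hf P hP; refine ⟨this.1, this.2.1, by simpa using this.2.2⟩
    | succ i ih =>
      have := hf (p i) ih.1.pos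
      rw [hs]
      refine ⟨this.1, by omega, this.2.2.trans ?_⟩
      calc 2 * p i ≤ 2 * (2 ^ (i + 1) * P) := by omega
        _ = _ := by ring
  refine ⟨p, strictMono_nat_of_lt_succ fun i => ?_, fun i => (hpp i).1, fun i => (hpp i).2.1,
    fun i => (hpp i).2.2⟩
  rw [hs]; exact (hf (p i) (hpp i).1.pos).2.1

/-- orbit of the pointwise stabilizer of a list -/
noncomputable def orb (G : Subgroup (Perm Ω)) (Δ : List Ω) (x : Ω) : Finset Ω := by
  classical
  exact ((els G).filter (fun g => ∀ d ∈ Δ, g d = d)).image (fun g => g x)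

lemma mem_orb {G : Subgroup (Perm Ω)} {Δ : List Ω} {x y : Ω} :
    y ∈ orb G Δ x ↔ ∃ g ∈ G, (∀ d ∈ Δ, g d = d) ∧ g x = y := by
  classical
  simp only [orb, mem_image, mem_filter, mem_els, and_assoc]

noncomputable def lorb (G : Subgroup (Perm Ω)) (Δ : List Ω) : Finset (List Ω) := by
  classical
  exact (els G).image (fun g : Perm Ω => Δ.map g)

lemma mem_lorb {G : Subgroup (Perm Ω)} {Δ l : List Ω} :
    l ∈ lorb G Δ ↔ ∃ g ∈ G, Δ.map g = l := by
  classical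
  simp only [lorb, mem_image, mem_els]

lemma lorb_cons (G : Subgroup (Perm Ω)) (Δ : List Ω) (x : Ω) :
    (lorb G Δ).card * (orb G Δ x).card ≤ (lorb G (x :: Δ)).card := by
  classical
  rw [card_eq_sum_card_fiberwise (f := List.tail) (t := lorb G Δ) (s := lorb G (x :: Δ))]
  · rw [← smul_eq_mul]
    apply card_nsmul_le_sum
    intro l hl
    obtain ⟨h, hh, rfl⟩ := mem_lorb.1 hl
    refine card_le_card_of_injOn (fun y => h y :: Δ.map h) ?_ ?_
    · intro y hy
      obtain ⟨g, hg, hgd, rfl⟩ := mem_orb.1 hy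
      simp only [coe_filter, Set.mem_ofPred_eq, mem_lorb, List.tail_cons, and_true]
      refine ⟨h * g, G.mul_mem hh hg, ?_⟩
      simp only [List.map_cons, Perm.mul_apply, List.cons.injEq, true_and]
      apply List.map_congr_left
      intro a ha
      simp [hgd a ha]
    · intro y _ y' _ hyy
      simp only [List.cons.injEq, EmbeddingLike.apply_eq_iff_eq, and_true] at hyy
      exact hyy
  · intro l hl
    obtain ⟨g, hg, rfl⟩ := mem_lorb.1 hl
    exact mem_lorb.2 ⟨g, hg, rfl⟩

lemma greedy (G : Subgroup (Perm Ω)) (t : ℕ) (c : ℝ) (hc : 1 < c)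
    (h : ∀ Δ : List Ω, Δ.length < t → ∃ x, c ≤ (orb G Δ x).card) :
    ∀ s ≤ t, ∃ α : List Ω, α.length = s ∧ α.Nodup ∧ c ^ s ≤ (lorb G α).card := by
  intro s
  induction s with
  | zero =>
    intro _
    refine ⟨[], rfl, List.nodup_nil, ?_⟩
    have : 0 < (lorb G ([] : List Ω)).card := card_pos.2 ⟨[], mem_lorb.2 ⟨1, G.one_mem, rfl⟩⟩
    simp only [pow_zero]; exact_mod_cast this
  | succ s ih =>
    intro hs
    obtain ⟨α, h1, h2, h3⟩ := ih (by omega)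
    obtain ⟨x, hx⟩ := h α (by omega)
    refine ⟨x :: α, by simp [h1], ?_, ?_⟩
    · rw [List.nodup_cons]
      refine ⟨fun hxa => ?_, h2⟩
      have : orb G α x ⊆ {x} := by
        intro y hy
        obtain ⟨g, -, hg, rfl⟩ := mem_orb.1 hy
        rw [hg x hxa]; simp
      have := card_le_card this
      rw [card_singleton] at this
      have : ((orb G α x).card : ℝ) ≤ 1 := by exact_mod_cast this
      linarith
    · have := lorb_cons G α x
      have h4 : ((lorb G α).card : ℝ) * (orb G α x).card ≤ (lorb G (x :: α)).card := by
        exact_mod_cast this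
      refine le_trans ?_ h4
      rw [pow_succ]
      have : (0:ℝ) ≤ c := by linarith
      exact mul_le_mul h3 hx this (by positivity)

lemma exists_rotated (G : Subgroup (Perm Ω)) {I : Type*} [Fintype I] (π : Perm I) (c : ℝ)
    (hc : 1 < c) (h : ∀ Δ : List Ω, Δ.length < Fintype.card I → ∃ x, c ≤ (orb G Δ x).card)
    (hct : (Fintype.card Ω : ℝ) ^ Fintype.card I < 2 * c ^ Fintype.card I) :
    ∃ g ∈ G, ∃ b : I → Ω, Function.Injective b ∧ ∀ j, g (b j) = b (π j) := by
  classical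
  obtain ⟨α, h1, h2, h3⟩ := greedy G _ c hc h _ le_rfl
  let e : I ≃ Fin α.length := Fintype.equivFinOfCardEq h1.symm
  let b : I → Ω := fun j => α.get (e j)
  have hb : Function.Injective b := fun i j hij => e.injective (List.nodup_iff_injective_get.1 h2 hij)
  let O : Finset (I → Ω) := (els G).image (fun (g : Perm Ω) j => g (b j))
  have hO : (lorb G α).card ≤ O.card := by
    have : lorb G α = O.image (fun f => List.ofFn (fun i => f (e.symm i))) := by
      ext l
      simp only [mem_lorb, O, mem_image, mem_els, exists_exists_and_eq_and]
      have : ∀ g : Perm Ω, α.map g = List.ofFn (fun i => g (b (e.symm i))) := by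
        intro g
        simp only [b, Equiv.apply_symm_apply]
        have h := List.map_ofFn (f := α.get) (g := g)
        rw [List.ofFn_get] at h
        exact h
      simp only [this]
    rw [this]; exact card_image_le
  let O' := O.image (fun f => f ∘ π)
  have hO' : O'.card = O.card := card_image_of_injective _ (fun f f' hff => by
    funext j
    have := congrFun hff (π.symm j)
    simpa using this)
  have hinter : ¬ Disjoint O O' := by
    intro hd
    have h4 := card_le_univ (O ∪ O')
    rw [card_union_of_disjoint hd, hO', Fintype.card_fun] at h4
    have h5 : (O.card : ℝ) + O.card ≤ (Fintype.card Ω : ℝ) ^ Fintype.card I := by exact_mod_cast h4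
    have h6 : ((lorb G α).card : ℝ) ≤ O.card := by exact_mod_cast hO
    linarith
  obtain ⟨f, hf, hf'⟩ := not_disjoint_iff.1 hinter
  simp only [O', O, mem_image, mem_els] at hf hf'
  obtain ⟨g1, hg1, rfl⟩ := hf
  obtain ⟨_, ⟨g2, hg2, rfl⟩, hgg⟩ := hf'
  refine ⟨g2⁻¹ * g1, G.mul_mem (G.inv_mem hg2) hg1, b, hb, fun j => ?_⟩
  have := congrFun hgg j
  simp only [Function.comp] at this
  rw [Perm.mul_apply, ← this]; simp

lemma exists_small (G : Subgroup (Perm Ω)) (hb : ∀ u ∈ G, u ≠ 1 → Fintype.card Ω < 8 * u.support.card)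
    (P : ℕ) (hP0 : 0 < P) (hP : Fintype.card Ω < P ^ 4) :
    ∃ t : ℕ, 0 < t ∧ t ≤ 2 ^ 30 * P ∧ ∀ c : ℝ, 1 < c → (Fintype.card Ω : ℝ) ^ t < 2 * c ^ t →
      ∃ Δ : List Ω, Δ.length < t ∧ ∀ x, ((orb G Δ x).card : ℝ) < c := by
  classical
  obtain ⟨p, hmono, hprime, hbig, hsmall⟩ := exists_primes P hP0
  have : ∀ i, NeZero (p i) := fun i => ⟨(hprime i).ne_zero⟩
  let I := Σ i : Fin 25, ZMod (p i)
  let π : Perm I := Equiv.sigmaCongrRight (fun i => Equiv.addRight (1 : ZMod (p i)))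
  have hcI : Fintype.card I = ∑ i : Fin 25, p i := by
    simp only [I, Fintype.card_sigma, ZMod.card]
  refine ⟨Fintype.card I, ?_, ?_, ?_⟩
  · exact Fintype.card_pos_iff.2 ⟨⟨0, 0⟩⟩
  · rw [hcI]
    calc ∑ i : Fin 25, p i ≤ ∑ i : Fin 25, 2 ^ 25 * P := by
          refine sum_le_sum fun i _ => (hsmall i).trans (Nat.mul_le_mul_right _ ?_)
          exact Nat.pow_le_pow_right (by norm_num) (by omega)
      _ = 25 * (2 ^ 25 * P) := by simp
      _ ≤ _ := by omega
  · intro c hc hct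
    by_contra! hcon
    obtain ⟨g, hg, b, hbi, hgb⟩ := exists_rotated G π c hc hcon hct
    have hiter : ∀ (i : Fin 25) (k : ℕ) (a : ZMod (p i)), (g ^ k) (b ⟨i, a⟩) = b ⟨i, a + k⟩ := by
      intro i k
      induction k with
      | zero => intro a; simp
      | succ k ih =>
        intro a
        rw [pow_succ', Perm.mul_apply, ih, hgb]
        have : π ⟨i, a + k⟩ = ⟨i, a + k + 1⟩ := rfl
        rw [this]
        push_cast; rw [add_assoc]
    obtain ⟨N, hN1, hN⟩ := prime_trick g P hP ((univ : Finset (Fin 25)).image (fun i : Fin 25 => p i))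
      (by simp only [mem_image, mem_univ, true_and, forall_exists_index, forall_apply_eq_imp_iff]
          exact fun i => hprime i)
      (by simp only [mem_image, mem_univ, true_and, forall_exists_index, forall_apply_eq_imp_iff]
          exact fun i => hbig i)
      (by rw [card_image_of_injective]
          · simp
          · intro i j hij; exact Fin.ext (hmono.injective hij))
      (by simp only [mem_image, mem_univ, true_and, forall_exists_index, forall_apply_eq_imp_iff]
          intro i
          refine ⟨b ⟨i, 0⟩, ?_⟩
          have h1 : Function.minimalPeriod g (b ⟨i, 0⟩) ∣ p i := by
            rw [minPer_dvd_iff, hiter]; simp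
          rcases (Nat.dvd_prime (hprime i)).1 h1 with h | h
          · exfalso
            have : Function.minimalPeriod g (b ⟨i, 0⟩) ∣ 1 := by rw [h]
            rw [minPer_dvd_iff, hiter] at this
            have := hbi this
            have h5 := eq_of_heq (Sigma.mk.inj this).2
            simp only [zero_add, Nat.cast_one] at h5
            have : Fact (1 < p i) := ⟨(hprime i).one_lt⟩
            exact one_ne_zero h5
          · rw [h])
    have := hb _ (G.pow_mem hg N) hN1
    omega

end
end WS

namespace WS
open Finset
set_option linter.unusedSectionVars false
set_option linter.unusedSimpArgs false

section
variable {Ω : Type*} [Fintype Ω] [DecidableEq Ω]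

lemma base_bound (G : Subgroup (Perm Ω)) (hG : TwoTr G) (hm : 2 ≤ Fintype.card Ω) (Δ : List Ω)
    (ε : ℝ) (hε0 : 0 < ε) (hε1 : ε < 1)
    (hΔ : ∀ x, ((orb G Δ x).card : ℝ) ≤ (1 - ε) * Fintype.card Ω) (q : ℕ)
    (hq : (Fintype.card Ω : ℝ) ^ 2 * (1 - ε) ^ q < 1) :
    (els G).card ≤ Fintype.card Ω ^ (q * Δ.length) := by
  classical
  set m := Fintype.card Ω with hmd
  have hmR : (2:ℝ) ≤ m := by exact_mod_cast hm
  -- pairs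
  have hpairs : (((univ : Finset Ω).offDiag.filter (fun p => p.2 ∈ orb G Δ p.1)).card : ℝ)
      ≤ (1 - ε) * (m * (m - 1 : ℕ)) := by
    have h1 : ((univ : Finset Ω).offDiag.filter (fun p => p.2 ∈ orb G Δ p.1)).card =
        ∑ x : Ω, ((orb G Δ x).erase x).card := by
      rw [card_eq_sum_card_fiberwise (f := Prod.fst) (t := univ) (by intro x _; simp)]
      refine sum_congr rfl fun x _ => ?_
      refine card_bij (fun p _ => p.2) ?_ ?_ ?_
      · rintro ⟨a, b⟩ hp
        simp only [mem_filter, mem_offDiag, mem_univ, true_and] at hp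
        obtain ⟨⟨h1, h2⟩, rfl⟩ := hp
        simp only [mem_erase]
        exact ⟨Ne.symm h1, h2⟩
      · rintro ⟨a, b⟩ hp ⟨a', b'⟩ hp' h
        simp only [mem_filter] at hp hp'
        ext
        · exact hp.2.trans hp'.2.symm
        · exact h
      · intro b hb
        rw [mem_erase] at hb
        refine ⟨(x, b), ?_, rfl⟩
        simp only [mem_filter, mem_offDiag, mem_univ, true_and, and_true]
        exact ⟨hb.1.symm, hb.2⟩
    rw [h1]
    push_cast
    have h2 : ∀ x : Ω, (((orb G Δ x).erase x).card : ℝ) ≤ (1 - ε) * (m - 1 : ℕ) := by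
      intro x
      have hx : x ∈ orb G Δ x := mem_orb.2 ⟨1, G.one_mem, by simp, rfl⟩
      rw [card_erase_of_mem hx]
      have hpos : 1 ≤ (orb G Δ x).card := card_pos.2 ⟨x, hx⟩
      rw [Nat.cast_sub hpos, Nat.cast_sub (by omega : 1 ≤ m)]
      have := hΔ x
      push_cast
      nlinarith
    refine (sum_le_sum fun x _ => h2 x).trans ?_
    simp only [sum_const, card_univ, nsmul_eq_mul]
    rw [← hmd]
    apply le_of_eq; ring
  set g := (els G).card with hg
  have hgpos : (0:ℝ) < g := by exact_mod_cast card_els_pos G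
  have hbad : ∀ x y : Ω, x ≠ y →
      (((els G).filter (fun γ => γ y ∈ orb G Δ (γ x))).card : ℝ) ≤ (1 - ε) * g := by
    intro x y hxy
    have h1 := equi_two hG hxy (fun p => p.2 ∈ orb G Δ p.1)
    have h2 : ((((els G).filter (fun γ => γ y ∈ orb G Δ (γ x))).card : ℝ)) * (m * (m - 1 : ℕ)) =
        g * (((univ : Finset Ω).offDiag.filter (fun p => p.2 ∈ orb G Δ p.1)).card : ℝ) := by
      exact_mod_cast h1
    have hpos : (0:ℝ) < m * (m - 1 : ℕ) := by
      have : 0 < m * (m - 1) := Nat.mul_pos (by omega) (by omega)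
      exact_mod_cast this
    have h3 : ((((els G).filter (fun γ => γ y ∈ orb G Δ (γ x))).card : ℝ)) * (m * (m - 1 : ℕ)) ≤
        ((1 - ε) * g) * (m * (m - 1 : ℕ)) := by
      rw [h2]
      calc _ ≤ g * ((1 - ε) * (m * (m - 1 : ℕ))) := mul_le_mul_of_nonneg_left hpairs hgpos.le
        _ = _ := by ring
    exact le_of_mul_le_mul_right h3 hpos
  obtain ⟨γ, hγG, hγ⟩ : ∃ γ : Fin q → Perm Ω, (∀ j, γ j ∈ G) ∧
      ∀ x y, x ≠ y → ∃ j, γ j y ∉ orb G Δ (γ j x) := by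
    by_contra! hcon
    have hsub : Fintype.piFinset (fun _ : Fin q => els G) ⊆
        (univ : Finset Ω).offDiag.biUnion (fun p => Fintype.piFinset (fun _ : Fin q =>
          (els G).filter (fun γ => γ p.2 ∈ orb G Δ (γ p.1)))) := by
      intro γ hγ
      rw [Fintype.mem_piFinset] at hγ
      obtain ⟨x, y, hxy, h⟩ := hcon γ (fun j => mem_els.1 (hγ j))
      rw [mem_biUnion]
      refine ⟨(x, y), by simp [hxy], ?_⟩
      rw [Fintype.mem_piFinset]
      intro j
      rw [mem_filter]
      exact ⟨hγ j, h j⟩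
    have h1 := (card_le_card hsub).trans card_biUnion_le
    simp only [Fintype.card_piFinset, prod_const, card_univ, Fintype.card_fin] at h1
    have h2 : (g : ℝ) ^ q ≤ ∑ p ∈ (univ : Finset Ω).offDiag,
        (((els G).filter (fun γ => γ p.2 ∈ orb G Δ (γ p.1))).card : ℝ) ^ q := by
      exact_mod_cast h1
    have h3 : ∑ p ∈ (univ : Finset Ω).offDiag,
        (((els G).filter (fun γ => γ p.2 ∈ orb G Δ (γ p.1))).card : ℝ) ^ q ≤
        ∑ p ∈ (univ : Finset Ω).offDiag, ((1 - ε) * g) ^ q := by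
      refine sum_le_sum fun p hp => ?_
      exact pow_le_pow_left₀ (by positivity) (hbad p.1 p.2 (mem_offDiag.1 hp).2.2) q
    rw [sum_const, nsmul_eq_mul, mul_pow] at h3
    have h4 : ((univ : Finset Ω).offDiag.card : ℝ) ≤ (m : ℝ) ^ 2 := by
      rw [offDiag_card, card_univ, ← hmd]
      have : m * m - m ≤ m ^ 2 := by rw [sq]; omega
      exact_mod_cast this
    have h5 : (0:ℝ) ≤ (1 - ε) ^ q := pow_nonneg (by linarith) _
    have h6 : (0:ℝ) < (g:ℝ) ^ q := by positivity
    have h7 : ((univ : Finset Ω).offDiag.card : ℝ) * ((1 - ε) ^ q * (g:ℝ) ^ q) ≤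
        (m : ℝ) ^ 2 * ((1 - ε) ^ q * (g:ℝ) ^ q) := mul_le_mul_of_nonneg_right h4 (by positivity)
    have h8 : (m : ℝ) ^ 2 * ((1 - ε) ^ q * (g:ℝ) ^ q) < 1 * (g:ℝ) ^ q := by
      rw [← mul_assoc]; exact mul_lt_mul_of_pos_right hq h6
    linarith
  have hcard : Fintype.card (Fin q × Fin Δ.length → Ω) = m ^ (q * Δ.length) := by
    simp [hmd]
  rw [← hcard, hg, ← card_univ]
  refine card_le_card_of_injOn (fun (h : Perm Ω) (p : Fin q × Fin Δ.length) =>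
    h ((γ p.1)⁻¹ (Δ.get p.2))) (fun _ _ => by simp) ?_
  intro h hh h' hh' heq
  have hh := mem_els.1 hh
  have hh' := mem_els.1 hh'
  by_contra hne
  obtain ⟨x, hx⟩ : ∃ x, (h⁻¹ * h') x ≠ x := by
    by_contra! hc
    apply hne
    ext x
    have := hc x
    rw [Perm.mul_apply, Perm.inv_eq_iff_eq] at this
    exact this.symm
  set k := h⁻¹ * h' with hk
  have hkG : k ∈ G := G.mul_mem (G.inv_mem hh) hh'
  obtain ⟨j, hj⟩ := hγ x (k x) (Ne.symm hx)
  apply hj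
  rw [mem_orb]
  refine ⟨γ j * k * (γ j)⁻¹, G.mul_mem (G.mul_mem (hγG j) hkG) (G.inv_mem (hγG j)), ?_, by simp⟩
  intro d hd
  obtain ⟨i, rfl⟩ := List.get_of_mem hd
  have := congrFun heq (j, i)
  simp only at this
  simp only [Perm.mul_apply, hk]
  rw [← this]
  simp

lemma sum_le_of_bochert (G : Subgroup (Perm Ω))
    (hb : ∀ u ∈ G, u ≠ 1 → Fintype.card Ω < 8 * u.support.card) :
    ∑ g ∈ (els G).erase 1, yy ^ g.support.card ≤ (els G).card * yy ^ (Fintype.card Ω / 8) := by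
  calc ∑ g ∈ (els G).erase 1, yy ^ g.support.card
      ≤ ∑ g ∈ (els G).erase 1, yy ^ (Fintype.card Ω / 8) := by
        refine sum_le_sum fun g hg => ?_
        rw [mem_erase, mem_els] at hg
        have := hb g hg.2 hg.1
        exact yy_pow_le (by omega)
    _ ≤ ∑ g ∈ (els G), yy ^ (Fintype.card Ω / 8) :=
        sum_le_sum_of_subset_of_nonneg (erase_subset _ _) (fun _ _ _ => (yy_pow_pos _).le)
    _ = _ := by simp
end
end WS

namespace WS
open Finset
set_option linter.unusedSectionVars false
set_option linter.unusedSimpArgs false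

lemma log_yy : Real.log yy = - (Real.log 2 / 2) := by
  have h := congrArg Real.log yy_sq
  rw [Real.log_pow, one_div, Real.log_inv] at h
  push_cast at h
  linarith

lemma analytic1 (A : ℝ) (hA : 1 ≤ A) (δ : ℝ) (hδ : 0 < δ) : ∃ P0 : ℕ, ∀ P m t s : ℕ, P0 ≤ P →
    (P - 1) ^ 4 ≤ m → m < P ^ 4 → (t : ℝ) ≤ A * P → (s : ℝ) ≤ 2 * Real.log m + 2 →
    (m : ℝ) ^ (3 * t * s * t) * yy ^ (m / 8) ≤ δ := by
  obtain ⟨P0, hP0⟩ := exists_nat_ge (512 * (432 * A ^ 2 + 1 + |Real.log δ|) + 2)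
  refine ⟨P0, fun P m t s hP hm1 hm2 ht hs => ?_⟩
  have hPR : 512 * (432 * A ^ 2 + 1 + |Real.log δ|) + 2 ≤ (P:ℝ) := hP0.trans (by exact_mod_cast hP)
  have hab : 0 ≤ |Real.log δ| := abs_nonneg _
  have hA2 : 1 ≤ A ^ 2 := one_le_pow₀ hA
  have hP2 : (2:ℝ) ≤ P := by nlinarith
  have hP2' : 2 ≤ P := by exact_mod_cast hP2
  have hmpos : 1 ≤ m := by
    have : 1 ≤ (P - 1) ^ 4 := Nat.one_le_pow _ _ (by omega)
    omega
  have hm0 : (0:ℝ) < m := by exact_mod_cast hmpos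
  have hmlow : (P:ℝ) ^ 4 / 16 ≤ m := by
    have h1 : ((P - 1 : ℕ) : ℝ) ^ 4 ≤ m := by exact_mod_cast hm1
    rw [Nat.cast_sub (by omega : 1 ≤ P)] at h1
    push_cast at h1
    have h2 : (P:ℝ) / 2 ≤ P - 1 := by linarith
    have h3 : ((P:ℝ) / 2) ^ 4 ≤ (P - 1) ^ 4 := pow_le_pow_left₀ (by positivity) h2 4
    have : ((P:ℝ) / 2) ^ 4 = (P:ℝ) ^ 4 / 16 := by ring
    linarith
  have hlogm0 : 0 ≤ Real.log m := Real.log_nonneg (by exact_mod_cast hmpos)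
  set r := Real.sqrt P with hr
  have hr2 : r ^ 2 = P := Real.sq_sqrt (by positivity)
  have hr1 : 1 ≤ r := by rw [hr]; exact Real.one_le_sqrt.2 (by linarith)
  have hlogm : Real.log m ≤ 8 * r := by
    have h1 : Real.log m ≤ Real.log ((P:ℝ) ^ 4) :=
      Real.log_le_log hm0 (by exact_mod_cast hm2.le)
    rw [← hr2, ← pow_mul, Real.log_pow] at h1
    have h2 := Real.log_le_sub_one_of_pos (show 0 < r by linarith)
    push_cast at h1
    linarith
  have hs' : (s:ℝ) ≤ 18 * r := by linarith
  have hexp : ((3 * t * s * t : ℕ) : ℝ) * Real.log m ≤ 432 * A ^ 2 * P ^ 3 := by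
    push_cast
    calc (3 * (t:ℝ) * s * t) * Real.log m = 3 * (t * t) * (s * Real.log m) := by ring
      _ ≤ 3 * ((A * P) * (A * P)) * ((18 * r) * (8 * r)) := by gcongr
      _ = 432 * A ^ 2 * P ^ 2 * r ^ 2 := by ring
      _ = _ := by rw [hr2]; ring
  have hfl : (m:ℝ) / 8 - 1 ≤ ((m / 8 : ℕ) : ℝ) := by
    have : m ≤ 8 * (m / 8) + 8 := by omega
    have : (m:ℝ) ≤ 8 * ((m / 8 : ℕ) : ℝ) + 8 := by exact_mod_cast this
    linarith
  have hlog2 : (1:ℝ)/2 ≤ Real.log 2 := by have := Real.log_two_gt_d9; linarith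
  have hpos : 0 < (m : ℝ) ^ (3 * t * s * t) * yy ^ (m / 8) :=
    mul_pos (by positivity) (yy_pow_pos _)
  rw [← Real.log_le_log_iff hpos hδ, Real.log_mul (by positivity) (yy_pow_pos _).ne',
    Real.log_pow, Real.log_pow, log_yy]
  have h1 : ((m:ℝ) / 8 - 1) / 4 ≤ ((m / 8 : ℕ) : ℝ) * (Real.log 2 / 2) := by
    have h0 : (0:ℝ) ≤ ((m / 8 : ℕ) : ℝ) := by positivity
    nlinarith
  have h2 : -|Real.log δ| ≤ Real.log δ := neg_abs_le _
  have h3 : (432 * A ^ 2 + 1 + |Real.log δ|) * P ^ 3 ≤ (P:ℝ) ^ 4 / 512 := by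
    have : (432 * A ^ 2 + 1 + |Real.log δ|) ≤ P / 512 := by linarith
    calc _ ≤ (P:ℝ) / 512 * P ^ 3 := mul_le_mul_of_nonneg_right this (by positivity)
      _ = _ := by ring
  have h4 : (1:ℝ) ≤ P ^ 3 := one_le_pow₀ (by linarith)
  have h5 : |Real.log δ| ≤ |Real.log δ| * (P:ℝ) ^ 3 := le_mul_of_one_le_right hab h4
  nlinarith

lemma two_tr_case (δ : ℝ) (hδ : 0 < δ) : ∃ m0 : ℕ, ∀ (Ω : Type) [Fintype Ω] [DecidableEq Ω]
    (G : Subgroup (Perm Ω)), IsPreprimitive G Ω → TwoTr G → ¬ alternatingGroup Ω ≤ G →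
    m0 ≤ Fintype.card Ω → ∑ g ∈ (els G).erase 1, yy ^ g.support.card ≤ δ := by
  obtain ⟨P0, hP0⟩ := analytic1 (2 ^ 30) (by norm_num) δ hδ
  refine ⟨max 27 (P0 ^ 4), fun Ω _ _ G hp hG hA hm => ?_⟩
  have hm27 : 27 ≤ Fintype.card Ω := le_trans (le_max_left _ _) hm
  have hmP : P0 ^ 4 ≤ Fintype.card Ω := le_trans (le_max_right _ _) hm
  have hb := bochert hp hG hA hm27
  set m := Fintype.card Ω with hmd
  have hex : ∃ P : ℕ, m < P ^ 4 := ⟨m + 1, by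
    calc m < m + 1 := by omega
      _ = (m + 1) ^ 1 := by ring
      _ ≤ _ := Nat.pow_le_pow_right (by omega) (by omega)⟩
  classical
  set P := Nat.find hex with hPd
  have hP : m < P ^ 4 := Nat.find_spec hex
  have hPpos : 0 < P := by
    by_contra h
    have : P = 0 := by omega
    rw [this] at hP; simp at hP
  have hP1 : (P - 1) ^ 4 ≤ m := by
    have := Nat.find_min hex (m := P - 1) (by omega)
    omega
  have hPP0 : P0 ≤ P := by
    by_contra h
    have : P ^ 4 ≤ P0 ^ 4 := Nat.pow_le_pow_left (by omega) 4
    omega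
  obtain ⟨t, ht0, htP, ht⟩ := exists_small G hb P hPpos hP
  have htR : (1:ℝ) ≤ t := by exact_mod_cast ht0
  have hmR : (27:ℝ) ≤ m := by exact_mod_cast hm27
  set ε : ℝ := 1 / (3 * t) with hε
  have hεt : t * ε = 1 / 3 := by rw [hε]; field_simp
  have hε0 : 0 < ε := by positivity
  have hε3 : ε ≤ 1 / 3 := by nlinarith
  obtain ⟨Δ, hΔ, hΔo⟩ := ht ((1 - ε) * m) (by nlinarith) (by
    rw [mul_pow]
    have := one_add_mul_le_pow (show -2 ≤ -ε by linarith) t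
    have h2 : 2 / 3 ≤ (1 - ε) ^ t := by
      have e : 1 + -ε = 1 - ε := by ring
      rw [e] at this; linarith
    have h3 : (0:ℝ) < (m:ℝ) ^ t := by positivity
    nlinarith)
  set s := ⌈2 * Real.log m⌉₊ + 1 with hs
  have hlog : 0 ≤ 2 * Real.log m := by
    have := Real.log_nonneg (show (1:ℝ) ≤ m by linarith); linarith
  have hs1 : 2 * Real.log m < s := by
    have := Nat.le_ceil (2 * Real.log m)
    rw [hs]; push_cast; linarith
  have hs2 : (s:ℝ) ≤ 2 * Real.log m + 2 := by
    have := Nat.ceil_lt_add_one hlog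
    rw [hs]; push_cast; linarith
  have hq : (m:ℝ) ^ 2 * (1 - ε) ^ (3 * t * s) < 1 := by
    have h1 : (1 - ε) ^ (3 * t * s) ≤ Real.exp (-s) := by
      have : 1 - ε ≤ Real.exp (-ε) := by have := Real.add_one_le_exp (-ε); linarith
      calc (1 - ε) ^ (3 * t * s) ≤ Real.exp (-ε) ^ (3 * t * s) :=
            pow_le_pow_left₀ (by linarith) this _
        _ = Real.exp (-s) := by
            rw [← Real.exp_nat_mul]
            congr 1
            push_cast
            have : (3 * (t:ℝ) * s) * -ε = -3 * s * (t * ε) := by ring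
            rw [this, hεt]; ring
    have h2 : (m:ℝ) ^ 2 = Real.exp (2 * Real.log m) := by
      rw [two_mul, Real.exp_add, Real.exp_log (by linarith)]; ring
    calc (m:ℝ) ^ 2 * (1 - ε) ^ (3 * t * s) ≤ Real.exp (2 * Real.log m) * Real.exp (-s) := by
          rw [h2]; gcongr
      _ = Real.exp (2 * Real.log m - s) := by rw [← Real.exp_add]; rfl
      _ < 1 := by rw [Real.exp_lt_one_iff]; linarith
  have hG' := base_bound G hG (by omega) Δ ε hε0 (by linarith) (fun x => (hΔo x).le) (3 * t * s) hq
  refine (sum_le_of_bochert G hb).trans (le_trans ?_ (hP0 P m t s hPP0 hP1 hP (by exact_mod_cast htP) hs2))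
  refine mul_le_mul_of_nonneg_right ?_ (yy_pow_pos _).le
  have h9 : m ^ (3 * t * s * Δ.length) ≤ m ^ (3 * t * s * t) :=
    Nat.pow_le_pow_right (by omega) (Nat.mul_le_mul_left _ hΔ.le)
  exact_mod_cast hG'.trans h9
end WS

namespace WS
open Finset
set_option linter.unusedSectionVars false
set_option linter.unusedSimpArgs false

section
variable {Ω : Type*} [Fintype Ω] [DecidableEq Ω]

lemma mem_orb1 {G : Subgroup (Perm Ω)} {z x y : Ω} :
    y ∈ orb G [z] x ↔ ∃ g ∈ G, g z = z ∧ g x = y := by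
  rw [mem_orb]; simp

lemma orb1_refl (G : Subgroup (Perm Ω)) (z x : Ω) : x ∈ orb G [z] x :=
  mem_orb1.2 ⟨1, G.one_mem, rfl, rfl⟩

lemma orb1_symm {G : Subgroup (Perm Ω)} {z x y : Ω} (h : y ∈ orb G [z] x) : x ∈ orb G [z] y := by
  obtain ⟨g, hg, h1, rfl⟩ := mem_orb1.1 h
  exact mem_orb1.2 ⟨g⁻¹, G.inv_mem hg, by rw [Perm.inv_eq_iff_eq, h1], by simp⟩

lemma orb1_trans {G : Subgroup (Perm Ω)} {z x y w : Ω} (h : y ∈ orb G [z] x)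
    (h' : w ∈ orb G [z] y) : w ∈ orb G [z] x := by
  obtain ⟨g, hg, h1, rfl⟩ := mem_orb1.1 h
  obtain ⟨g', hg', h1', rfl⟩ := mem_orb1.1 h'
  exact mem_orb1.2 ⟨g' * g, G.mul_mem hg' hg, by simp [h1, h1'], by simp⟩

lemma orb1_self (G : Subgroup (Perm Ω)) (z : Ω) {y : Ω} (h : y ∈ orb G [z] z) : y = z := by
  obtain ⟨g, hg, h1, rfl⟩ := mem_orb1.1 h
  exact h1

lemma orb1_map {G : Subgroup (Perm Ω)} {g : Perm Ω} (hg : g ∈ G) {z x y : Ω}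
    (h : y ∈ orb G [z] x) : g y ∈ orb G [g z] (g x) := by
  obtain ⟨k, hk, h1, rfl⟩ := mem_orb1.1 h
  exact mem_orb1.2 ⟨g * k * g⁻¹, G.mul_mem (G.mul_mem hg hk) (G.inv_mem hg), by simp [h1], by simp⟩

lemma orb1_map_iff {G : Subgroup (Perm Ω)} {g : Perm Ω} (hg : g ∈ G) {z x y : Ω} :
    g y ∈ orb G [g z] (g x) ↔ y ∈ orb G [z] x := by
  refine ⟨fun h => ?_, orb1_map hg⟩
  have := orb1_map (G.inv_mem hg) h
  simpa using this

lemma orb1_card_map {G : Subgroup (Perm Ω)} {g : Perm Ω} (hg : g ∈ G) (z x : Ω) :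
    (orb G [g z] (g x)).card = (orb G [z] x).card := by
  have : orb G [g z] (g x) = (orb G [z] x).image g := by
    ext y
    rw [mem_image]
    constructor
    · intro h
      refine ⟨g⁻¹ y, ?_, by simp⟩
      rw [← orb1_map_iff hg]; simpa using h
    · rintro ⟨y, h, rfl⟩
      exact orb1_map hg h
  rw [this, card_image_of_injective _ g.injective]

lemma stab_card {G : Subgroup (Perm Ω)} (x y : Ω) :
    ((els G).filter (fun g => g x = x)).card =
      (orb G [x] y).card * ((els G).filter (fun g => g x = x ∧ g y = y)).card := by
  rw [card_eq_sum_card_fiberwise (f := fun g : Perm Ω => g y) (t := orb G [x] y)]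
  · rw [sum_congr rfl (g := fun _ => ((els G).filter (fun g => g x = x ∧ g y = y)).card)]
    · simp
    · intro w hw
      obtain ⟨k, hk, hkx, rfl⟩ := mem_orb1.1 hw
      apply card_bij' (fun g _ => k⁻¹ * g) (fun g _ => k * g)
      · intro g hg
        simp only [mem_filter, mem_els] at hg ⊢
        refine ⟨G.mul_mem (G.inv_mem hk) hg.1.1, ?_, ?_⟩
        · rw [Perm.mul_apply, hg.1.2, Perm.inv_eq_iff_eq, hkx]
        · rw [Perm.mul_apply, hg.2]; simp
      · intro g hg
        simp only [mem_filter, mem_els] at hg ⊢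
        refine ⟨⟨G.mul_mem hk hg.1, ?_⟩, ?_⟩
        · simp [hg.2.1, hkx]
        · simp [hg.2.2]
      · intro g _; simp
      · intro g _; simp
  · intro g hg
    simp only [coe_filter, Set.mem_ofPred_eq, mem_els] at hg
    exact mem_orb1.2 ⟨g, hg.1, hg.2, rfl⟩

lemma val_symm {G : Subgroup (Perm Ω)} (hG : IsPretransitive G Ω) (x y : Ω) :
    (orb G [x] y).card = (orb G [y] x).card := by
  have hm : 0 < Fintype.card Ω := Fintype.card_pos_iff.2 ⟨x⟩
  have h : ∀ a : Ω, ((els G).filter (fun g => g a = a)).card * Fintype.card Ω = (els G).card := by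
    intro a
    have := equi_one hG a (· = a)
    simpa [filter_eq'] using this
  have h1 : ((els G).filter (fun g => g x = x)).card = ((els G).filter (fun g => g y = y)).card :=
    Nat.eq_of_mul_eq_mul_right hm ((h x).trans (h y).symm)
  rw [stab_card x y, stab_card y x] at h1
  have h2 : (els G).filter (fun g => g y = y ∧ g x = x) =
      (els G).filter (fun g => g x = x ∧ g y = y) := by
    apply filter_congr; intro g _; tauto
  rw [h2] at h1
  refine Nat.eq_of_mul_eq_mul_right ?_ h1
  exact card_pos.2 ⟨1, by simp [mem_els, G.one_mem]⟩

/-- the points whose stabilizer separates x from w -/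
noncomputable def DD (G : Subgroup (Perm Ω)) (x w : Ω) : Finset Ω :=
  univ.filter (fun z => w ∉ orb G [z] x)

lemma mem_DD {G : Subgroup (Perm Ω)} {x w z : Ω} : z ∈ DD G x w ↔ w ∉ orb G [z] x := by
  simp [DD]

lemma DD_symm (G : Subgroup (Perm Ω)) (x w : Ω) : DD G x w = DD G w x := by
  ext z
  rw [mem_DD, mem_DD, not_iff_not]
  exact ⟨orb1_symm, orb1_symm⟩

lemma DD_tri (G : Subgroup (Perm Ω)) (x y w : Ω) : DD G x w ⊆ DD G x y ∪ DD G y w := by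
  intro z hz
  rw [mem_union]
  by_contra! h
  rw [mem_DD, mem_DD, not_not, not_not] at h
  exact mem_DD.1 hz (orb1_trans h.1 h.2)

lemma DD_card_map {G : Subgroup (Perm Ω)} {g : Perm Ω} (hg : g ∈ G) (x w : Ω) :
    (DD G (g x) (g w)).card = (DD G x w).card := by
  have : DD G (g x) (g w) = (DD G x w).image g := by
    ext z
    rw [mem_image, mem_DD]
    constructor
    · intro h
      refine ⟨g⁻¹ z, ?_, by simp⟩
      rw [mem_DD, ← orb1_map_iff hg]; simpa using h
    · rintro ⟨y, h, rfl⟩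
      rw [orb1_map_iff hg]; exact mem_DD.1 h
  rw [this, card_image_of_injective _ g.injective]

/-- orbital graph -/
def OG (G : Subgroup (Perm Ω)) (x y : Ω) (hxy : x ≠ y) : SimpleGraph Ω where
  Adj a b := ∃ g ∈ G, (g x = a ∧ g y = b) ∨ (g x = b ∧ g y = a)
  symm := by
    constructor
    rintro a b ⟨g, hg, h⟩
    exact ⟨g, hg, h.symm⟩
  loopless := by
    constructor
    rintro a ⟨g, hg, ⟨h1, h2⟩ | ⟨h1, h2⟩⟩ <;> exact hxy (g.injective (h1.trans h2.symm))

variable {G : Subgroup (Perm Ω)} {x y : Ω} {hxy : x ≠ y}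

lemma OG_map {k : Perm Ω} (hk : k ∈ G) {a b : Ω} (h : (OG G x y hxy).Adj a b) :
    (OG G x y hxy).Adj (k a) (k b) := by
  obtain ⟨g, hg, h⟩ := h
  refine ⟨k * g, G.mul_mem hk hg, ?_⟩
  rcases h with ⟨rfl, rfl⟩ | ⟨rfl, rfl⟩
  · left; simp
  · right; simp

lemma OG_reach {k : Perm Ω} (hk : k ∈ G) {a b : Ω} (h : (OG G x y hxy).Reachable a b) :
    (OG G x y hxy).Reachable (k a) (k b) := by
  let f : OG G x y hxy →g OG G x y hxy := ⟨k, fun h => OG_map hk h⟩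
  exact h.map f

lemma OG_conn (hp : IsPreprimitive G Ω) : (OG G x y hxy).Connected := by
  have : Nonempty Ω := ⟨x⟩
  let C : Set Ω := {b | (OG G x y hxy).Reachable x b}
  have hC : IsBlock G C := by
    rw [isBlock_iff_smul_eq_of_mem]
    rintro ⟨g, hg⟩ a ha hga
    have hga : (OG G x y hxy).Reachable x (g a) := hga
    have ha : (OG G x y hxy).Reachable x a := ha
    have hxg : (OG G x y hxy).Reachable x (g x) := hga.trans (OG_reach hg ha).symm
    ext b
    rw [Set.mem_smul_set]
    constructor
    · rintro ⟨c, hc, rfl⟩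
      have hc : (OG G x y hxy).Reachable x c := hc
      exact hxg.trans (OG_reach hg hc)
    · intro hb
      have hb : (OG G x y hxy).Reachable x b := hb
      refine ⟨g⁻¹ b, ?_, ?_⟩
      · have h1 := OG_reach (G.inv_mem hg) (hxg.symm.trans hb)
        have h2 : g⁻¹ (g x) = x := by simp
        rw [h2] at h1; exact h1
      · show g (g⁻¹ b) = b
        simp
  have hxC : x ∈ C := SimpleGraph.Reachable.refl _
  have hyC : y ∈ C := SimpleGraph.Adj.reachable ⟨1, G.one_mem, Or.inl ⟨rfl, rfl⟩⟩
  have huniv : C = Set.univ := by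
    rcases hp.isTrivialBlock_of_isBlock hC with h | h
    · exact absurd (h hxC hyC) hxy
    · exact h
  have hr : ∀ a, (OG G x y hxy).Reachable x a := by
    intro a
    have : a ∈ C := by rw [huniv]; trivial
    exact this
  exact ⟨fun a b => (hr a).symm.trans (hr b)⟩

lemma OG_DD {a b : Ω} (h : (OG G x y hxy).Adj a b) : (DD G a b).card = (DD G x y).card := by
  obtain ⟨g, hg, ⟨rfl, rfl⟩ | ⟨rfl, rfl⟩⟩ := h
  · exact DD_card_map hg x y
  · rw [DD_symm]; exact DD_card_map hg x y

lemma walk_DD {a b : Ω} (p : (OG G x y hxy).Walk a b) :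
    (DD G a b).card ≤ p.length * (DD G x y).card := by
  induction p with
  | nil =>
    rename_i a
    have : DD G a a = ∅ := by
      ext z; rw [mem_DD]; simp [orb1_refl]
    rw [this]; simp
  | cons h p ih =>
    rename_i a b c
    have h1 := card_le_card (DD_tri G a b c)
    have h2 := card_union_le (DD G a b) (DD G b c)
    rw [OG_DD h] at h2
    rw [SimpleGraph.Walk.length_cons, add_mul, one_mul]
    omega

open Classical in
noncomputable def nb (Γ : SimpleGraph Ω) (a : Ω) : Finset Ω := univ.filter (fun b => Γ.Adj a b)

lemma mem_nb {Γ : SimpleGraph Ω} {a b : Ω} : b ∈ nb Γ a ↔ Γ.Adj a b := by simp [nb]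

lemma nb_card (hG : IsPretransitive G Ω) (a : Ω) :
    (nb (OG G x y hxy) a).card = (nb (OG G x y hxy) x).card := by
  obtain ⟨⟨k, hk⟩, hka⟩ := exists_smul_eq G x a
  have hka : k x = a := hka
  subst hka
  have : nb (OG G x y hxy) (k x) = (nb (OG G x y hxy) x).image k := by
    ext b
    rw [mem_nb, mem_image]
    constructor
    · intro h
      refine ⟨k⁻¹ b, ?_, by simp⟩
      rw [mem_nb]
      have := OG_map (G.inv_mem hk) h
      simpa using this
    · rintro ⟨b, hb, rfl⟩
      exact OG_map hk (mem_nb.1 hb)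
  rw [this, card_image_of_injective _ k.injective]

lemma nb_ge : (orb G [x] y).card ≤ (nb (OG G x y hxy) x).card := by
  apply card_le_card
  intro b hb
  obtain ⟨g, hg, h1, h2⟩ := mem_orb1.1 hb
  exact mem_nb.2 ⟨g, hg, Or.inl ⟨h1, h2⟩⟩

lemma nb_le (hG : IsPretransitive G Ω) :
    (nb (OG G x y hxy) x).card ≤ 2 * (orb G [x] y).card := by
  obtain ⟨⟨k, hk⟩, hka⟩ := exists_smul_eq G y x
  have hka : k y = x := hka
  have : nb (OG G x y hxy) x ⊆ orb G [x] y ∪ (orb G [y] x).image k := by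
    intro b hb
    rw [mem_union]
    obtain ⟨g, hg, ⟨h1, h2⟩ | ⟨h1, h2⟩⟩ := mem_nb.1 hb
    · left; exact mem_orb1.2 ⟨g, hg, h1, h2⟩
    · right
      rw [mem_image]
      refine ⟨k⁻¹ b, mem_orb1.2 ⟨k⁻¹ * g, G.mul_mem (G.inv_mem hk) hg, ?_, ?_⟩, by simp⟩
      · rw [Perm.mul_apply, h2, Perm.inv_eq_iff_eq, hka]
      · rw [Perm.mul_apply, h1]
  have h1 := (card_le_card this).trans (card_union_le _ _)
  rw [card_image_of_injective _ k.injective, ← val_symm hG x y] at h1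
  omega

lemma F1 (hp : IsPreprimitive G Ω) :
    Fintype.card Ω ≤ (DD G x y).card * (nb (OG G x y hxy) x).card := by
  have hsub : (univ : Finset Ω) ⊆ (nb (OG G x y hxy) x).biUnion (fun b => DD G x b) := by
    intro z _
    rw [mem_biUnion]
    by_contra! hcon
    have hb : ∀ b, (OG G x y hxy).Adj x b → b ∈ orb G [z] x := by
      intro b hb
      have := hcon b (mem_nb.2 hb)
      rw [mem_DD, not_not] at this; exact this
    have hcl : ∀ a b, a ∈ orb G [z] x → (OG G x y hxy).Adj a b → b ∈ orb G [z] x := by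
      intro a b ha hab
      obtain ⟨g, hg, h1, rfl⟩ := mem_orb1.1 ha
      have h2 := OG_map (G.inv_mem hg) hab
      have h3 : g⁻¹ (g x) = x := by simp
      rw [h3] at h2
      have h4 := orb1_map hg (hb _ h2)
      rw [h1] at h4
      have h5 : g (g⁻¹ b) = b := by simp
      rw [h5] at h4
      exact orb1_trans ha h4
    have hall : ∀ a b, (OG G x y hxy).Walk a b → a ∈ orb G [z] x → b ∈ orb G [z] x := by
      intro a b p
      induction p with
      | nil => exact id
      | cons h p ih => exact fun ha => ih (hcl _ _ ha h)
    have hconn := OG_conn (hxy := hxy) hp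
    obtain ⟨p⟩ := hconn.preconnected x z
    obtain ⟨q⟩ := hconn.preconnected x y
    have hz := hall _ _ p (orb1_refl G z x)
    have hxz : x = z := orb1_self G z (orb1_symm hz)
    have hy := hall _ _ q (orb1_refl G z x)
    subst hxz
    exact hxy (orb1_self G x hy).symm
  have h1 := (card_le_card hsub).trans card_biUnion_le
  rw [card_univ, sum_congr rfl (g := fun _ => (DD G x y).card)] at h1
  · simpa [mul_comm] using h1
  · intro b hb
    exact OG_DD (mem_nb.1 hb)

lemma exists_level {Γ : SimpleGraph Ω} (hc : Γ.Connected) (a : Ω) :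
    ∀ i : ℕ, ∀ v, Γ.dist a v = i → ∀ j ≤ i, ∃ u, Γ.dist a u = j := by
  intro i
  induction i with
  | zero => intro v hv j hj; exact ⟨v, by omega⟩
  | succ i ih =>
    intro v hv j hj
    rcases Nat.lt_or_ge i j with h | h
    · exact ⟨v, by omega⟩
    · obtain ⟨p, hp⟩ := hc.exists_walk_length_eq_dist v a
      rw [SimpleGraph.dist_comm, hv] at hp
      cases p with
      | nil => simp at hp
      | cons hadj p =>
        rename_i u
        rw [SimpleGraph.Walk.length_cons] at hp
        have h1 : Γ.dist u a ≤ p.length := SimpleGraph.dist_le p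
        have h2 : Γ.dist a v ≤ Γ.dist a u + Γ.dist u v := hc.dist_triangle
        rw [SimpleGraph.dist_eq_one_iff_adj.2 hadj.symm] at h2
        rw [SimpleGraph.dist_comm] at h1
        exact ih u (by omega) j h

lemma F3 (hp : IsPreprimitive G Ω) (a b : Ω) :
    ((OG G x y hxy).dist a b + 1) * (nb (OG G x y hxy) x).card ≤ 3 * Fintype.card Ω := by
  have hc := OG_conn (hxy := hxy) hp
  set Γ := OG G x y hxy with hΓ
  have hex : ∀ i, ∃ u, i ≤ Γ.dist a b → Γ.dist a u = i := by
    intro i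
    by_cases h : i ≤ Γ.dist a b
    · obtain ⟨u, hu⟩ := exists_level hc a _ b rfl i h
      exact ⟨u, fun _ => hu⟩
    · exact ⟨a, fun h' => absurd h' h⟩
  choose v hv using hex
  classical
  have h1 := sum_card_bipartiteAbove_eq_sum_card_bipartiteBelow (s := range (Γ.dist a b + 1))
    (t := (univ : Finset Ω)) (fun i u => Γ.Adj (v i) u)
  have h2 : ∑ i ∈ range (Γ.dist a b + 1), (bipartiteAbove (fun i u => Γ.Adj (v i) u)
      (univ : Finset Ω) i).card = (Γ.dist a b + 1) * (nb Γ x).card := by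
    rw [sum_congr rfl (g := fun _ => (nb Γ x).card)]
    · simp
    · intro i _
      rw [← nb_card (hxy := hxy) hp.toIsPretransitive (v i)]
      congr 1
  rw [← h2, h1]
  have h3 : ∀ u ∈ (univ : Finset Ω), (bipartiteBelow (fun i u => Γ.Adj (v i) u)
      (range (Γ.dist a b + 1)) u).card ≤ 3 := by
    intro u _
    have : bipartiteBelow (fun i u => Γ.Adj (v i) u) (range (Γ.dist a b + 1)) u ⊆
        Icc (Γ.dist a u - 1) (Γ.dist a u + 1) := by
      intro i hi
      simp only [bipartiteBelow, mem_filter, mem_range] at hi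
      have h4 := hv i (by omega)
      have h5 : Γ.dist a (v i) ≤ Γ.dist a u + Γ.dist u (v i) := hc.dist_triangle
      have h6 : Γ.dist a u ≤ Γ.dist a (v i) + Γ.dist (v i) u := hc.dist_triangle
      rw [SimpleGraph.dist_eq_one_iff_adj.2 hi.2] at h6
      rw [SimpleGraph.dist_eq_one_iff_adj.2 hi.2.symm] at h5
      rw [mem_Icc]; omega
    refine (card_le_card this).trans ?_
    rw [Nat.card_Icc]; omega
  refine (sum_le_sum h3).trans ?_
  simp [mul_comm]

end
end WS

namespace WS
open Finset
set_option linter.unusedSectionVars false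
set_option linter.unusedSimpArgs false

section
variable {Ω : Type*} [Fintype Ω] [DecidableEq Ω] {G : Subgroup (Perm Ω)}

lemma orb1_eq {z x y : Ω} (h : y ∈ orb G [z] x) : orb G [z] y = orb G [z] x := by
  ext w
  exact ⟨fun h' => orb1_trans h h', fun h' => orb1_trans (orb1_symm h) h'⟩

lemma orb1_disj {z x y : Ω} (h : y ∉ orb G [z] x) : Disjoint (orb G [z] y) (orb G [z] x) := by
  rw [disjoint_left]
  intro w h1 h2
  exact h (orb1_trans h2 (orb1_symm h1))

lemma orb1_small (hG : IsPretransitive G Ω) (hnt : ¬ TwoTr G) (hm : 3 ≤ Fintype.card Ω) (z x : Ω) :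
    (orb G [z] x).card + 2 ≤ Fintype.card Ω := by
  by_contra hcon
  by_cases hxz : x = z
  · subst hxz
    have : orb G [x] x ⊆ {x} := by
      intro w hw; rw [orb1_self G x hw]; simp
    have := card_le_card this
    rw [card_singleton] at this
    omega
  · have hsub : orb G [z] x ⊆ univ.erase z := by
      intro w hw
      rw [mem_erase]
      refine ⟨?_, mem_univ _⟩
      rintro rfl
      exact hxz (orb1_self G w (orb1_symm hw))
    have heq : orb G [z] x = univ.erase z := by
      apply eq_of_subset_of_card_le hsub
      rw [card_erase_of_mem (mem_univ _), card_univ]; omega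
    apply hnt
    intro a b c d hab hcd
    obtain ⟨⟨g1, hg1⟩, h1⟩ := exists_smul_eq G a z
    obtain ⟨⟨g2, hg2⟩, h2⟩ := exists_smul_eq G c z
    have h1 : g1 a = z := h1
    have h2 : g2 c = z := h2
    have e1 : g1 b ∈ orb G [z] x := by
      rw [heq, mem_erase]
      exact ⟨fun h => hab (g1.injective (h1.trans h.symm)), mem_univ _⟩
    have e2 : g2 d ∈ orb G [z] x := by
      rw [heq, mem_erase]
      exact ⟨fun h => hcd (g2.injective (h2.trans h.symm)), mem_univ _⟩
    obtain ⟨k, hk, hkz, hkd⟩ := mem_orb1.1 (orb1_trans (orb1_symm e1) e2)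
    refine ⟨g2⁻¹ * k * g1, G.mul_mem (G.mul_mem (G.inv_mem hg2) hk) hg1, ?_, ?_⟩
    · simp only [Perm.mul_apply, Perm.inv_eq_iff_eq, h1, h2, hkz]
    · simp only [Perm.mul_apply, Perm.inv_eq_iff_eq, hkd]

lemma F2 (ρ : ℕ) (hρ : ∀ z x, (orb G [z] x).card + ρ ≤ Fintype.card Ω)
    (x : Ω) : ∃ a b, ρ ≤ (DD G a b).card := by
  by_contra! hcon
  have : Nonempty Ω := ⟨x⟩
  have h1 : ∑ a : Ω, ∑ b : Ω, (DD G a b).card < ∑ a : Ω, ∑ b : Ω, ρ := by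
    apply sum_lt_sum_of_nonempty univ_nonempty
    intro a _
    apply sum_lt_sum_of_nonempty univ_nonempty
    intro b _
    exact hcon a b
  have h2 : ∑ a : Ω, ∑ b : Ω, ρ ≤ ∑ a : Ω, ∑ b : Ω, (DD G a b).card := by
    refine sum_le_sum fun a _ => ?_
    have h3 := sum_card_bipartiteAbove_eq_sum_card_bipartiteBelow (s := (univ : Finset Ω))
      (t := (univ : Finset Ω)) (fun b z => b ∉ orb G [z] a)
    have h4 : ∑ b : Ω, (DD G a b).card = ∑ z : Ω, (bipartiteBelow (fun b z => b ∉ orb G [z] a)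
      (univ : Finset Ω) z).card := h3
    rw [h4]
    refine sum_le_sum fun z _ => ?_
    have h5 : bipartiteBelow (fun b z => b ∉ orb G [z] a) (univ : Finset Ω) z = (orb G [z] a)ᶜ := by
      ext b; simp [bipartiteBelow]
    rw [h5, card_compl]
    have := hρ z a
    omega
  omega

lemma uni_bound (hp : IsPreprimitive G Ω) (hnt : ¬ TwoTr G) (hm : 3 ≤ Fintype.card Ω) {x y : Ω}
    (hxy : x ≠ y) : Fintype.card Ω ≤ 36 * (DD G x y).card ^ 3 := by
  classical
  have htr := hp.toIsPretransitive
  obtain ⟨⟨z0, x0⟩, -, hmax⟩ := exists_max_image (univ : Finset (Ω × Ω))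
    (fun p => (orb G [p.1] p.2).card) ⟨(x, y), mem_univ _⟩
  set μ := (orb G [z0] x0).card with hμ
  have hmax : ∀ z w, (orb G [z] w).card ≤ μ := fun z w => hmax (z, w) (mem_univ _)
  have hμ2 : μ + 2 ≤ Fintype.card Ω := orb1_small htr hnt hm z0 x0
  obtain ⟨ρ, hρ⟩ : ∃ ρ, Fintype.card Ω = μ + ρ := ⟨Fintype.card Ω - μ, by omega⟩
  set m := Fintype.card Ω with hmd
  have hbig : ∀ z, ∃ w, (orb G [z] w).card = μ := by
    intro z
    obtain ⟨⟨g, hg⟩, h⟩ := exists_smul_eq G z0 z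
    have h : g z0 = z := h
    exact ⟨g x0, by rw [← h, orb1_card_map hg]⟩
  have hdich : ∀ z w v, (orb G [z] w).card = μ → v ∉ orb G [z] w → (orb G [z] v).card ≤ ρ := by
    intro z w v hw hv
    have h1 := card_le_univ (orb G [z] v ∪ orb G [z] w)
    rw [card_union_of_disjoint (orb1_disj hv), hw] at h1
    omega
  obtain ⟨a, b, hab⟩ := F2 (G := G) ρ (fun z w => by have := hmax z w; omega) x
  set δ := (DD G x y).card with hδ
  set w := (nb (OG G x y hxy) x).card with hw
  have hA : m ≤ δ * w := F1 (hxy := hxy) hp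
  have hwpos : 0 < w := by
    rcases Nat.eq_zero_or_pos w with h | h
    · rw [h] at hA; omega
    · exact h
  have hδpos : 1 ≤ δ := by
    rcases Nat.eq_zero_or_pos δ with h | h
    · rw [h] at hA; omega
    · exact h
  have hconn := OG_conn (hxy := hxy) hp
  have hDdist : ∀ a b, (DD G a b).card ≤ (OG G x y hxy).dist a b * δ := by
    intro a b
    obtain ⟨p, hp'⟩ := hconn.exists_walk_length_eq_dist a b
    rw [← hp']; exact walk_DD p
  have hC : ∀ a b, ((OG G x y hxy).dist a b + 1) * w ≤ 3 * m := fun a b => F3 hp a b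
  have hρδ : ρ ≤ 3 * δ ^ 2 := by
    have h1 := hDdist a b
    have h2 := hC a b
    set d := (OG G x y hxy).dist a b
    have h3 : ρ * w ≤ (3 * δ ^ 2) * w := by
      calc ρ * w ≤ (d * δ) * w := Nat.mul_le_mul_right _ (hab.trans h1)
        _ = δ * (d * w) := by ring
        _ ≤ δ * (3 * m) := Nat.mul_le_mul_left _ (by nlinarith)
        _ ≤ δ * (3 * (δ * w)) := by gcongr
        _ = _ := by ring
    exact Nat.le_of_mul_le_mul_right h3 hwpos
  have hδ3 : δ ^ 2 ≤ δ ^ 3 := Nat.pow_le_pow_right hδpos (by omega)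
  have hnl : w ≤ 2 * (orb G [x] y).card := nb_le htr
  obtain ⟨x1, hx1⟩ := hbig x
  by_cases hy1 : y ∈ orb G [x] x1
  · have h1 : (orb G [x] y).card = μ := by rw [orb1_eq hy1, hx1]
    by_cases h2 : m ≤ 2 * ρ
    · calc m ≤ 2 * (3 * δ ^ 2) := by omega
        _ ≤ 36 * δ ^ 3 := by omega
    · have hge : (orb G [x] y).card ≤ w := nb_ge
      obtain ⟨y', hy', hy'x⟩ : ∃ y', y' ∉ orb G [x] x1 ∧ x ≠ y' := by
        have : 1 < ((orb G [x] x1)ᶜ).card := by rw [card_compl, hx1]; omega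
        obtain ⟨u, v, hu, hv, huv⟩ := one_lt_card_iff.1 this
        rw [mem_compl] at hu hv
        by_cases h : x = u
        · exact ⟨v, hv, by rw [h]; exact huv⟩
        · exact ⟨u, hu, h⟩
      have hs := hdich x x1 y' hx1 hy'
      have h3 : m ≤ (DD G x y').card * (nb (OG G x y' hy'x) x).card := F1 (hxy := hy'x) hp
      have h4 : (nb (OG G x y' hy'x) x).card ≤ 2 * (orb G [x] y').card := nb_le htr
      have h5 := hDdist x y'
      have h6 := hC x y'
      have h7 : (OG G x y hxy).dist x y' ≤ 5 := by
        by_contra hcon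
        have : 7 * w ≤ ((OG G x y hxy).dist x y' + 1) * w := Nat.mul_le_mul_right _ (by omega)
        omega
      calc m ≤ (DD G x y').card * (nb (OG G x y' hy'x) x).card := h3
        _ ≤ (5 * δ) * (2 * ρ) := by
            apply Nat.mul_le_mul
            · exact h5.trans (Nat.mul_le_mul_right _ h7)
            · omega
        _ ≤ (5 * δ) * (2 * (3 * δ ^ 2)) := by gcongr
        _ = 30 * δ ^ 3 := by ring
        _ ≤ 36 * δ ^ 3 := by omega
  · have hs := hdich x x1 y hx1 hy1
    calc m ≤ δ * w := hA
      _ ≤ δ * (2 * (3 * δ ^ 2)) := by gcongr; omega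
      _ = 6 * δ ^ 3 := by ring
      _ ≤ 36 * δ ^ 3 := by omega

end
end WS

namespace WS
open Finset
set_option linter.unusedSectionVars false
set_option linter.unusedSimpArgs false

section
variable {Ω : Type*} [Fintype Ω] [DecidableEq Ω] {G : Subgroup (Perm Ω)}

lemma base_sum (B : Finset Ω) (hB : ∀ g ∈ G, (∀ b ∈ B, g b = b) → g = 1) (r : ℕ) :
    ∑ g ∈ (els G).erase 1, yy ^ (r * (g.support ∩ B).card) ≤
      (1 + Fintype.card Ω * yy ^ r) ^ (Fintype.card Ω) - 1 := by
  have hy : 0 < yy ^ r := yy_pow_pos r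
  have h1 : ∑ g ∈ (els G), yy ^ (r * (g.support ∩ B).card) ≤
      (1 + Fintype.card Ω * yy ^ r) ^ (Fintype.card Ω) := by
    let u : Ω → Ω → ℝ := fun b w => if w = b then 1 else yy ^ r
    have hu : ∀ b w, 0 ≤ u b w := by
      intro b w; simp only [u]; split_ifs <;> positivity
    have h2 : ∏ b : Ω, ∑ w ∈ (univ : Finset Ω), u b w =
        ∑ φ ∈ Fintype.piFinset (fun _ : Ω => (univ : Finset Ω)), ∏ b, u b (φ b) :=
      Finset.prod_univ_sum _ _
    have h3 : ∏ b : Ω, ∑ w ∈ (univ : Finset Ω), u b w ≤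
        (1 + Fintype.card Ω * yy ^ r) ^ (Fintype.card Ω) := by
      rw [← card_univ, ← prod_const]
      apply prod_le_prod
      · intro b _; exact sum_nonneg fun w _ => hu b w
      · intro b _
        calc ∑ w ∈ (univ : Finset Ω), u b w ≤ ∑ w : Ω, ((if w = b then 1 else 0) + yy ^ r) := by
              refine sum_le_sum fun w _ => ?_
              simp only [u]; split_ifs <;> linarith
          _ = _ := by rw [sum_add_distrib]; simp
    refine le_trans ?_ h3
    rw [h2]
    let ψ : Perm Ω → (Ω → Ω) := fun g b => if b ∈ B then g b else b
    have hψ : Set.InjOn ψ (els G) := by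
      intro g hg g' hg' heq
      have hg := mem_els.1 hg
      have hg' := mem_els.1 hg'
      have := hB (g⁻¹ * g') (G.mul_mem (G.inv_mem hg) hg') (by
        intro b hb
        have := congrFun heq b
        simp only [ψ, hb, if_true] at this
        rw [Perm.mul_apply, ← this]; simp)
      rw [inv_mul_eq_one] at this
      exact this
    calc ∑ g ∈ (els G), yy ^ (r * (g.support ∩ B).card) = ∑ g ∈ els G, ∏ b, u b (ψ g b) := by
          refine sum_congr rfl fun g _ => ?_
          have : ∀ b, u b (ψ g b) = if b ∈ g.support ∩ B then yy ^ r else 1 := by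
            intro b
            simp only [u, ψ, mem_inter, Perm.mem_support]
            by_cases h : b ∈ B <;> by_cases h' : g b = b <;> simp [h, h']
          simp only [this]
          rw [prod_ite_mem, univ_inter, prod_const, pow_mul]
      _ = ∑ φ ∈ (els G).image ψ, ∏ b, u b (φ b) := by
          rw [sum_image hψ]
      _ ≤ _ := by
          apply sum_le_sum_of_subset_of_nonneg
          · intro φ _; simp
          · intro φ _ _; exact prod_nonneg fun b _ => hu _ _
  have h5 : (1 : Perm Ω) ∈ els G := mem_els.2 G.one_mem
  have h4 := add_sum_erase (els G) (fun g => yy ^ (r * (g.support ∩ B).card)) h5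
  simp only [Perm.support_one, empty_inter, card_empty, mul_zero, pow_zero] at h4
  linarith

lemma colour_sum (r : ℕ) (hr : 0 < r) (f : Ω → Fin r)
    (hf : ∀ i, ∀ g ∈ G, (∀ b, f b = i → g b = b) → g = 1) :
    ∑ g ∈ (els G).erase 1, yy ^ g.support.card ≤
      r * ((1 + Fintype.card Ω * yy ^ r) ^ (Fintype.card Ω) - 1) := by
  calc ∑ g ∈ (els G).erase 1, yy ^ g.support.card
      ≤ ∑ g ∈ (els G).erase 1, ∑ i : Fin r,
          yy ^ (r * (g.support ∩ univ.filter (fun b => f b = i)).card) := by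
        refine sum_le_sum fun g _ => ?_
        have h1 : g.support.card = ∑ i : Fin r, (g.support ∩ univ.filter (fun b => f b = i)).card := by
          rw [card_eq_sum_card_fiberwise (f := f) (t := univ) (fun _ _ => by simp)]
          refine sum_congr rfl fun i _ => ?_
          congr 1
          ext b; simp
        obtain ⟨i, hi⟩ : ∃ i : Fin r,
            r * (g.support ∩ univ.filter (fun b => f b = i)).card ≤ g.support.card := by
          by_contra! hcon
          have : Nonempty (Fin r) := ⟨⟨0, hr⟩⟩
          have h2 := sum_lt_sum_of_nonempty (univ_nonempty (α := Fin r)) (fun i _ => hcon i)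
          rw [← mul_sum, ← h1] at h2
          simp at h2
        refine (yy_pow_le hi).trans ?_
        exact single_le_sum (f := fun i => yy ^ (r * (g.support ∩ univ.filter (fun b => f b = i)).card))
          (fun i _ => (yy_pow_pos _).le) (mem_univ i)
    _ = ∑ i : Fin r, ∑ g ∈ (els G).erase 1,
          yy ^ (r * (g.support ∩ univ.filter (fun b => f b = i)).card) := sum_comm
    _ ≤ ∑ i : Fin r, ((1 + Fintype.card Ω * yy ^ r) ^ (Fintype.card Ω) - 1) := by
        refine sum_le_sum fun i _ => base_sum _ (fun g hg h => hf i g hg fun b hb => h b ?_) r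
        simp [hb]
    _ = _ := by simp; ring

lemma exists_colour (r : ℕ) (hr : 0 < r) (d : ℕ)
    (hd : ∀ x y : Ω, x ≠ y → d ≤ (DD G x y).card)
    (hsm : (Fintype.card Ω : ℝ) ^ 2 * r * (1 - 1 / r) ^ d < 1) :
    ∃ f : Ω → Fin r, ∀ i, ∀ g ∈ G, (∀ b, f b = i → g b = b) → g = 1 := by
  classical
  set m := Fintype.card Ω with hm
  suffices h : ∃ f : Ω → Fin r, ∀ x y, x ≠ y → ∀ i, ∃ z ∈ DD G x y, f z = i by
    obtain ⟨f, hf⟩ := h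
    refine ⟨f, fun i g hg h => ?_⟩
    ext x
    by_contra hx
    obtain ⟨z, hz, hzi⟩ := hf x (g x) (fun h => hx h.symm) i
    exact mem_DD.1 hz (mem_orb1.2 ⟨g, hg, h z hzi, rfl⟩)
  by_contra! hcon
  let bad : (Ω × Ω) × Fin r → Finset (Ω → Fin r) := fun p =>
    Fintype.piFinset (fun z => if z ∈ DD G p.1.1 p.1.2 then univ.erase p.2 else univ)
  have hsub : (univ : Finset (Ω → Fin r)) ⊆ ((univ : Finset Ω).offDiag ×ˢ (univ : Finset (Fin r))).biUnion bad := by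
    intro f _
    obtain ⟨x, y, hxy, i, h⟩ := hcon f
    rw [mem_biUnion]
    refine ⟨((x, y), i), by simp [hxy], ?_⟩
    simp only [bad, Fintype.mem_piFinset]
    intro z
    split_ifs with hz
    · simp [h z hz]
    · simp
  have h1 := (card_le_card hsub).trans card_biUnion_le
  have hrR : (0:ℝ) < r := by exact_mod_cast hr
  have hr1 : (1:ℝ) ≤ r := by exact_mod_cast hr
  have hq0 : (0:ℝ) ≤ 1 - 1 / r := by rw [sub_nonneg, div_le_one hrR]; exact hr1
  have hq1 : (1:ℝ) - 1 / r ≤ 1 := by have : (0:ℝ) < 1 / r := by positivity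
                                     linarith
  have h2 : ∀ p ∈ (univ : Finset Ω).offDiag ×ˢ (univ : Finset (Fin r)),
      ((bad p).card : ℝ) ≤ (r:ℝ) ^ m * (1 - 1 / r) ^ d := by
    rintro ⟨⟨x, y⟩, i⟩ hp
    simp only [mem_product, mem_offDiag, mem_univ, true_and, and_true] at hp
    simp only [bad, Fintype.card_piFinset]
    push_cast
    calc ∏ z : Ω, ((if z ∈ DD G x y then univ.erase i else univ : Finset (Fin r)).card : ℝ)
        = ∏ z : Ω, ((r:ℝ) * (if z ∈ DD G x y then (1 - 1 / (r:ℝ)) else 1)) := by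
          refine prod_congr rfl fun z _ => ?_
          split_ifs
          · rw [card_erase_of_mem (mem_univ _), card_univ, Fintype.card_fin, Nat.cast_sub hr]
            field_simp; simp
          · simp
      _ = (r:ℝ) ^ m * (1 - 1 / r) ^ (DD G x y).card := by
          rw [prod_mul_distrib, prod_const, card_univ, prod_ite_mem, univ_inter, prod_const]
      _ ≤ _ := by
          refine mul_le_mul_of_nonneg_left ?_ (by positivity)
          exact pow_le_pow_of_le_one hq0 hq1 (hd x y hp)
  have h3 : (r:ℝ) ^ m ≤ ∑ p ∈ (univ : Finset Ω).offDiag ×ˢ (univ : Finset (Fin r)), ((bad p).card : ℝ) := by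
    have h4 : (univ : Finset (Ω → Fin r)).card = r ^ m := by simp [hm]
    rw [h4] at h1
    exact_mod_cast h1
  have h5 := h3.trans (sum_le_sum h2)
  rw [sum_const, card_product, nsmul_eq_mul, card_univ, Fintype.card_fin] at h5
  have h6 : (((univ : Finset Ω).offDiag.card : ℕ) : ℝ) ≤ (m:ℝ) ^ 2 := by
    rw [offDiag_card, card_univ, ← hm]
    have : m * m - m ≤ m ^ 2 := by rw [sq]; omega
    exact_mod_cast this
  push_cast at h5
  have h7 : (0:ℝ) < (r:ℝ) ^ m := by positivity
  have h8 : (0:ℝ) ≤ (1 - 1 / (r:ℝ)) ^ d := pow_nonneg hq0 _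
  have h9 : (((univ : Finset Ω).offDiag.card : ℕ) : ℝ) * r * ((r:ℝ) ^ m * (1 - 1 / r) ^ d) ≤
      (m:ℝ) ^ 2 * r * ((r:ℝ) ^ m * (1 - 1 / r) ^ d) := by gcongr
  have h10 : (m:ℝ) ^ 2 * r * ((r:ℝ) ^ m * (1 - 1 / r) ^ d) =
      (r:ℝ) ^ m * ((m:ℝ) ^ 2 * r * (1 - 1 / r) ^ d) := by ring
  have h11 : (r:ℝ) ^ m * ((m:ℝ) ^ 2 * r * (1 - 1 / r) ^ d) < (r:ℝ) ^ m * 1 :=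
    mul_lt_mul_of_pos_left hsm h7
  linarith

end

lemma analytic2 (δ : ℝ) (hδ : 0 < δ) : ∃ m0 : ℕ, 3 ≤ m0 ∧ ∀ m : ℕ, m0 ≤ m →
    1 ≤ Real.log m ∧ 288 * (10 * Real.log m) ^ 6 < m ∧ 2 * (10 * Real.log m) ≤ δ * m := by
  have h1 : (fun x : ℝ => Real.log x ^ 6) =o[Filter.atTop] id := Real.isLittleO_pow_log_id_atTop
  have h2 : (fun x : ℝ => Real.log x ^ 1) =o[Filter.atTop] id := Real.isLittleO_pow_log_id_atTop
  have e1 := (h1.def (show (0:ℝ) < 1 / (288 * 10 ^ 6 * 2) by norm_num))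
  have e2 := (h2.def (show (0:ℝ) < δ / 20 by positivity))
  have e3 := Real.tendsto_log_atTop.eventually_ge_atTop 1
  have e4 := Filter.eventually_ge_atTop (3:ℝ)
  have := tendsto_natCast_atTop_atTop (R := ℝ) |>.eventually (e1.and (e2.and (e3.and e4)))
  obtain ⟨m0, h⟩ := Filter.eventually_atTop.1 this
  refine ⟨max m0 3, le_max_right _ _, fun m hm => ?_⟩
  obtain ⟨a, b, c, d⟩ := h m ((le_max_left _ _).trans hm)
  have hm0 : (0:ℝ) < m := by linarith
  have hl : 0 ≤ Real.log m := by linarith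
  simp only [id, pow_one, Real.norm_eq_abs, abs_of_pos hm0, abs_of_nonneg hl] at a b
  rw [abs_of_nonneg (by positivity)] at a
  refine ⟨c, ?_, ?_⟩
  · rw [mul_pow]
    have : 1 / (288 * 10 ^ 6 * 2) * (m:ℝ) * (288 * 10 ^ 6) < m := by
      have : 1 / (288 * 10 ^ 6 * 2) * (m:ℝ) * (288 * 10 ^ 6) = m / 2 := by ring
      linarith
    nlinarith
  · linarith

lemma uni_case (δ : ℝ) (hδ : 0 < δ) : ∃ m0 : ℕ, ∀ (Ω : Type) [Fintype Ω] [DecidableEq Ω]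
    (G : Subgroup (Perm Ω)), IsPreprimitive G Ω → ¬ TwoTr G →
    m0 ≤ Fintype.card Ω → ∑ g ∈ (els G).erase 1, yy ^ g.support.card ≤ δ := by
  obtain ⟨m0, hm03, hm0⟩ := analytic2 δ hδ
  refine ⟨m0, fun Ω _ _ G hp hnt hm => ?_⟩
  obtain ⟨a1, a2, a3⟩ := hm0 _ hm
  have hbound := fun x y (hxy : x ≠ y) => uni_bound hp hnt (by omega) (hxy := hxy)
  set m := Fintype.card Ω with hmd
  have hm3 : (3:ℝ) ≤ m := by exact_mod_cast (by omega : 3 ≤ m)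
  set r := ⌈9 * Real.log m⌉₊ with hr
  have hr1 : 9 * Real.log m ≤ r := Nat.le_ceil _
  have hr2 : (r:ℝ) ≤ 10 * Real.log m := by
    have := Nat.ceil_lt_add_one (show 0 ≤ 9 * Real.log m by linarith)
    linarith
  have hr9 : (9:ℝ) ≤ r := by linarith
  have hrpos : 0 < r := by have : (0:ℝ) < r := by linarith
                           exact_mod_cast this
  have hd : ∀ x y : Ω, x ≠ y → 2 * r ^ 2 ≤ (DD G x y).card := by
    intro x y hxy
    have h1 := hbound x y hxy
    by_contra hcon
    push Not at hcon
    have h2 : (DD G x y).card ^ 3 ≤ (2 * r ^ 2) ^ 3 := Nat.pow_le_pow_left hcon.le 3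
    have h3 : m ≤ 288 * r ^ 6 := by
      calc m ≤ 36 * (2 * r ^ 2) ^ 3 := by omega
        _ = _ := by ring
    have h4 : (m:ℝ) ≤ 288 * r ^ 6 := by exact_mod_cast h3
    have h5 : (r:ℝ) ^ 6 ≤ (10 * Real.log m) ^ 6 := pow_le_pow_left₀ (by positivity) hr2 6
    linarith
  obtain ⟨f, hf⟩ := exists_colour (G := G) r hrpos (2 * r ^ 2) hd (by
    have h1 : (1 - 1 / (r:ℝ)) ^ (2 * r ^ 2) ≤ Real.exp (-(2 * r)) := by
      have h2 : 1 - 1 / (r:ℝ) ≤ Real.exp (-(1 / r)) := by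
        have := Real.add_one_le_exp (-(1 / (r:ℝ))); linarith
      have h3 : (0:ℝ) ≤ 1 - 1 / r := by
        rw [sub_nonneg, div_le_one (by linarith)]; linarith
      calc (1 - 1 / (r:ℝ)) ^ (2 * r ^ 2) ≤ Real.exp (-(1 / r)) ^ (2 * r ^ 2) :=
            pow_le_pow_left₀ h3 h2 _
        _ = Real.exp (-(2 * r)) := by
            rw [← Real.exp_nat_mul]
            congr 1
            push_cast
            field_simp
    have h2 : (m:ℝ) ^ 2 = Real.exp (2 * Real.log m) := by
      rw [two_mul, Real.exp_add, Real.exp_log (by linarith)]; ring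
    have h3 : (r:ℝ) ≤ Real.exp r := by have := Real.add_one_le_exp (r:ℝ); linarith
    rw [← hmd]
    calc (m:ℝ) ^ 2 * r * (1 - 1 / (r:ℝ)) ^ (2 * r ^ 2)
        ≤ Real.exp (2 * Real.log m) * Real.exp r * Real.exp (-(2 * r)) := by
          rw [h2]
          have h33 : (0:ℝ) ≤ 1 - 1 / r := by
            rw [sub_nonneg, div_le_one (by linarith)]; linarith
          have h34 := pow_nonneg h33 (2 * r ^ 2)
          gcongr
      _ = Real.exp (2 * Real.log m - r) := by
          rw [← Real.exp_add, ← Real.exp_add]; congr 1; ring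
      _ < 1 := by rw [Real.exp_lt_one_iff]; linarith)
  refine (colour_sum r hrpos f hf).trans ?_
  rw [← hmd]
  have hyr : yy ^ r ≤ 1 / (m:ℝ) ^ 3 := by
    rw [← Real.log_le_log_iff (yy_pow_pos r) (by positivity), Real.log_pow, log_yy, one_div,
      Real.log_inv, Real.log_pow]
    have := Real.log_two_gt_d9
    push_cast
    nlinarith
  have h1 : (1 + (m:ℝ) * yy ^ r) ^ m ≤ 1 + 2 / m := by
    have h2 : (m:ℝ) * yy ^ r ≤ 1 / (m:ℝ) ^ 2 := by
      calc (m:ℝ) * yy ^ r ≤ m * (1 / (m:ℝ) ^ 3) := by gcongr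
        _ = _ := by field_simp
    calc (1 + (m:ℝ) * yy ^ r) ^ m ≤ (Real.exp (1 / (m:ℝ) ^ 2)) ^ m := by
          apply pow_le_pow_left₀
          · have := yy_pow_pos r; positivity
          · have := Real.add_one_le_exp (1 / (m:ℝ) ^ 2); linarith
      _ = Real.exp (1 / m) := by
          rw [← Real.exp_nat_mul]; congr 1; field_simp
      _ ≤ 1 + 2 / m := by
          have h0 : (0:ℝ) ≤ 1 / m := by positivity
          have h1 : (1:ℝ) / m ≤ 1 := by rw [div_le_one (by linarith)]; linarith
          have := Real.abs_exp_sub_one_le (x := 1 / (m:ℝ)) (by rw [abs_of_nonneg h0]; exact h1)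
          rw [abs_of_nonneg h0] at this
          have h3 := (abs_le.1 this).2
          have h4 : 2 * (1 / (m:ℝ)) = 2 / m := by ring
          linarith
  calc (r:ℝ) * ((1 + (m:ℝ) * yy ^ r) ^ m - 1) ≤ r * (2 / m) := by gcongr; linarith
    _ ≤ δ := by
        rw [mul_div_assoc', div_le_iff₀ (by linarith)]
        linarith

/-- Theorem Q. -/
lemma prim_case (δ : ℝ) (hδ : 0 < δ) : ∃ m0 : ℕ, ∀ (Ω : Type) [Fintype Ω] [DecidableEq Ω]
    (G : Subgroup (Perm Ω)), IsPreprimitive G Ω → ¬ alternatingGroup Ω ≤ G →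
    m0 ≤ Fintype.card Ω → ∑ g ∈ (els G).erase 1, yy ^ g.support.card ≤ δ := by
  obtain ⟨m1, h1⟩ := two_tr_case δ hδ
  obtain ⟨m2, h2⟩ := uni_case δ hδ
  refine ⟨max m1 m2, fun Ω _ _ G hp hA hm => ?_⟩
  by_cases h : TwoTr G
  · exact h1 Ω G hp h hA ((le_max_left _ _).trans hm)
  · exact h2 Ω G hp h ((le_max_right _ _).trans hm)
end WS

namespace WS
open Finset
set_option linter.unusedSectionVars false
set_option linter.unusedSimpArgs false

lemma geom_le_inv {x : ℝ} {n : ℕ} (h0 : 0 ≤ x) (h1 : x < 1) : ∑ i ∈ range n, x ^ i ≤ (1 - x)⁻¹ := by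
  have h := geom_sum_mul_neg x n
  have h2 : 0 < 1 - x := by linarith
  rw [← one_div, le_div_iff₀ h2, h]
  have := pow_nonneg h0 n
  linarith

/-- index sets of multiplicities -/
def mults (m : ℕ) (i : Fin (m+1)) : Finset ℕ := if 2 ≤ (i:ℕ) then range (m+1) else {0}

lemma types_bound (m : ℕ) (S : Finset (Multiset ℕ)) (hS : ∀ c ∈ S, (∀ i ∈ c, 2 ≤ i) ∧ c.sum ≤ m)
    (z : ℝ) (hz : 0 < z) :
    ∑ c ∈ S, z ^ c.sum ≤ ∏ i : Fin (m+1), ∑ j ∈ mults m i, (z ^ (i:ℕ)) ^ j := by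
  rw [Finset.prod_univ_sum]
  let ψ : Multiset ℕ → (Fin (m+1) → ℕ) := fun c i => c.count (i:ℕ)
  have hmem : ∀ c ∈ S, ∀ i ∈ c, i ≤ m := fun c hc i hi =>
    (Multiset.single_le_sum (fun _ _ => Nat.zero_le _) i hi).trans (hS c hc).2
  have hinj : Set.InjOn ψ S := by
    intro c hc c' hc' h
    ext i
    by_cases hi : i ≤ m
    · exact congrFun h ⟨i, by omega⟩
    · rw [Multiset.count_eq_zero_of_notMem (fun h => hi (hmem c hc i h)),
        Multiset.count_eq_zero_of_notMem (fun h => hi (hmem c' hc' i h))]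
  have hval : ∀ c ∈ S, z ^ c.sum = ∏ i : Fin (m+1), (z ^ (i:ℕ)) ^ (ψ c i) := by
    intro c hc
    have h1 : c.sum = ∑ i ∈ range (m+1), c.count i * i := by
      rw [Finset.sum_multiset_count_of_subset c (range (m+1))]
      · simp
      · intro i hi
        have := hmem c hc i (Multiset.mem_toFinset.1 hi)
        simp; omega
    rw [h1, Finset.sum_range, ← Finset.prod_pow_eq_pow_sum]
    refine prod_congr rfl fun i _ => ?_
    rw [← pow_mul, mul_comm]
  rw [sum_congr rfl hval, ← sum_image (f := fun φ : Fin (m+1) → ℕ => ∏ i : Fin (m+1), (z ^ (i:ℕ)) ^ (φ i)) hinj]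
  apply sum_le_sum_of_subset_of_nonneg
  · intro φ hφ
    obtain ⟨c, hc, rfl⟩ := mem_image.1 hφ
    rw [Fintype.mem_piFinset]
    intro i
    simp only [mults, ψ]
    split_ifs with h
    · rw [mem_range]
      have h1 : Multiset.replicate (c.count (i:ℕ)) (i:ℕ) ≤ c := Multiset.le_count_iff_replicate_le.1 le_rfl
      have h2 : (Multiset.replicate (c.count (i:ℕ)) (i:ℕ)).sum ≤ c.sum := by
        obtain ⟨u, hu⟩ := Multiset.le_iff_exists_add.1 h1
        conv_rhs => rw [hu]
        rw [Multiset.sum_add]; omega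
      rw [Multiset.sum_replicate, smul_eq_mul] at h2
      have := (hS c hc).2
      nlinarith
    · rw [mem_singleton, Multiset.count_eq_zero]
      intro h'
      exact h ((hS c hc).1 _ h')
  · intro φ _ _
    exact prod_nonneg fun i _ => by positivity

lemma mults_sum_le (m : ℕ) (z : ℝ) (hz : 0 < z) (hz1 : z < 1) (i : Fin (m+1)) :
    ∑ j ∈ mults m i, (z ^ (i:ℕ)) ^ j ≤ if 2 ≤ (i:ℕ) then (1 - z ^ (i:ℕ))⁻¹ else 1 := by
  unfold mults
  split_ifs with h
  · have h1 : z ^ (i:ℕ) < 1 := pow_lt_one₀ hz.le hz1 (by omega)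
    have h0 : 0 < z ^ (i:ℕ) := by positivity
    exact geom_le_inv h0.le h1
  · simp

lemma types_bound2 (m : ℕ) (S : Finset (Multiset ℕ)) (hS : ∀ c ∈ S, (∀ i ∈ c, 2 ≤ i) ∧ c.sum ≤ m)
    (z : ℝ) (hz : 0 < z) (hz1 : z < 1) :
    ∑ c ∈ S, z ^ c.sum ≤ ∏ i ∈ range (m+1), (if 2 ≤ i then (1 - z ^ i)⁻¹ else 1) := by
  refine (types_bound m S hS z hz).trans ?_
  rw [Finset.prod_range]
  apply prod_le_prod
  · intro i _
    exact sum_nonneg fun j _ => by positivity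
  · intro i _
    exact mults_sum_le m z hz hz1 i

lemma prod_half (m : ℕ) : ∏ i ∈ range (m+1), (if 2 ≤ i then (1 - (1/2:ℝ) ^ i)⁻¹ else 1) ≤ 16/9 := by
  have key : ∀ m : ℕ, (3/4) * (3/4 + (1/2:ℝ)^(m+2)) ≤ ∏ i ∈ range (m+3), (if 2 ≤ i then (1 - (1/2:ℝ) ^ i) else 1) := by
    intro m
    induction m with
    | zero => norm_num [prod_range_succ]
    | succ m ih =>
      rw [prod_range_succ, if_pos (by omega)]
      have h1 : (0:ℝ) < (1/2)^(m+2) := by positivity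
      have h2 : ((1:ℝ)/2)^(m+2) ≤ 1/4 := by
        have : ((1:ℝ)/2)^(m+2) = (1/2)^m * (1/4) := by rw [pow_add]; norm_num
        rw [this]
        have := pow_le_one₀ (n := m) (by norm_num : (0:ℝ) ≤ 1/2) (by norm_num)
        linarith
      have h3 : ((1:ℝ)/2)^(m+1+2) = (1/2)^(m+2) * (1/2) := by rw [← pow_succ]
      have h4 : m + 3 = m + 1 + 2 := rfl
      rw [h4, h3]
      rw [h4] at ih
      nlinarith
  have h2 : ∀ m : ℕ, (9/16) ≤ ∏ i ∈ range (m+1), (if 2 ≤ i then (1 - (1/2:ℝ) ^ i) else 1) := by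
    intro m
    match m with
    | 0 => norm_num
    | 1 => norm_num [prod_range_succ]
    | m+2 =>
      have := key m
      have h1 : (0:ℝ) < (1/2)^(m+2) := by positivity
      linarith
  have h3 : ∏ i ∈ range (m+1), (if 2 ≤ i then (1 - (1/2:ℝ) ^ i)⁻¹ else 1) =
      (∏ i ∈ range (m+1), (if 2 ≤ i then (1 - (1/2:ℝ) ^ i) else 1))⁻¹ := by
    rw [← prod_inv_distrib]
    refine prod_congr rfl fun i _ => ?_
    split_ifs <;> simp
  rw [h3, inv_le_comm₀ (by have := h2 m; linarith) (by norm_num)]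
  have := h2 m
  linarith

lemma prod_gen (z : ℝ) (hz : 0 < z) (hz1 : z < 1) (m : ℕ) :
    ∏ i ∈ range (m+1), (if 2 ≤ i then (1 - z ^ i)⁻¹ else 1) ≤ Real.exp (1 / (1 - z) ^ 2) := by
  have hz2 : 0 < 1 - z := by linarith
  calc ∏ i ∈ range (m+1), (if 2 ≤ i then (1 - z ^ i)⁻¹ else 1)
      ≤ ∏ i ∈ range (m+1), Real.exp (z ^ i * (1 / (1 - z))) := by
        apply prod_le_prod
        · intro i _
          split_ifs
          · have : z ^ i ≤ 1 := pow_le_one₀ hz.le hz1.le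
            rw [inv_nonneg]; linarith
          · norm_num
        · intro i _
          have hp : 0 < z ^ i := by positivity
          split_ifs with h
          · have h1 : z ^ i ≤ z := by
              calc z ^ i ≤ z ^ 1 := pow_le_pow_of_le_one hz.le hz1.le (by omega)
                _ = z := pow_one z
            have h2 : 0 < 1 - z ^ i := by linarith
            have h3 : (1 - z ^ i)⁻¹ = 1 + z ^ i * (1 / (1 - z ^ i)) := by field_simp; ring
            rw [h3]
            have h4 : z ^ i * (1 / (1 - z ^ i)) ≤ z ^ i * (1 / (1 - z)) := by gcongr
            have := Real.add_one_le_exp (z ^ i * (1 / (1 - z)))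
            linarith
          · apply Real.one_le_exp; positivity
    _ = Real.exp ((∑ i ∈ range (m+1), z ^ i) * (1 / (1 - z))) := by
        rw [← Real.exp_sum, sum_mul]
    _ ≤ _ := by
        apply Real.exp_le_exp.2
        have := geom_le_inv (n := m+1) hz.le hz1
        calc (∑ i ∈ range (m+1), z ^ i) * (1 / (1 - z)) ≤ (1 - z)⁻¹ * (1 / (1 - z)) := by gcongr
          _ = _ := by field_simp

/-- general constant -/
noncomputable def AA : ℝ := Real.exp (1 / (1 - 7/8) ^ 2)
lemma AA_pos : 0 < AA := Real.exp_pos _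

section
variable {Ω : Type*} [Fintype Ω] [DecidableEq Ω]

/-- relation of conjugacy under a subgroup -/
def gconj (G : Subgroup (Perm Ω)) : Setoid (Perm Ω) where
  r s t := ∃ g ∈ G, g * s * g⁻¹ = t
  iseqv := by
    refine ⟨fun s => ⟨1, G.one_mem, by simp⟩, ?_, ?_⟩
    · rintro s t ⟨g, hg, rfl⟩
      exact ⟨g⁻¹, G.inv_mem hg, by group⟩
    · rintro s t u ⟨g, hg, rfl⟩ ⟨h, hh, rfl⟩
      exact ⟨h * g, G.mul_mem hh hg, by group⟩

lemma exists_reps (G : Subgroup (Perm Ω)) : ∃ T : Finset (Perm Ω), (∀ t ∈ T, t ∈ G) ∧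
    (∀ h ∈ G, ∃ t ∈ T, ∃ g ∈ G, g * h * g⁻¹ = t) ∧
    (∀ t ∈ T, ∀ t' ∈ T, (∃ g ∈ G, g * t * g⁻¹ = t') → t = t') := by
  classical
  let rep : Perm Ω → Perm Ω := fun s => (Quotient.mk (gconj G) s).out
  have hrep : ∀ s, ∃ g ∈ G, g * s * g⁻¹ = rep s := fun s =>
    (gconj G).symm (Quotient.exact (Quotient.out_eq (Quotient.mk (gconj G) s)))
  refine ⟨(els G).image rep, ?_, ?_, ?_⟩
  · intro t ht
    obtain ⟨s, hs, rfl⟩ := mem_image.1 ht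
    obtain ⟨g, hg, h⟩ := hrep s
    rw [← h]
    exact G.mul_mem (G.mul_mem hg (mem_els.1 hs)) (G.inv_mem hg)
  · intro h hh
    exact ⟨rep h, mem_image_of_mem _ (mem_els.2 hh), hrep h⟩
  · intro t ht t' ht' h
    obtain ⟨s, hs, rfl⟩ := mem_image.1 ht
    obtain ⟨s', hs', rfl⟩ := mem_image.1 ht'
    have h1 : (gconj G).r s s' :=
      (gconj G).trans (hrep s) ((gconj G).trans h ((gconj G).symm (hrep s')))
    have : Quotient.mk (gconj G) s = Quotient.mk (gconj G) s' := Quotient.sound h1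
    simp only [rep, this]

variable {G : Subgroup (Perm Ω)} {T : Finset (Perm Ω)}

lemma fib_two (hA : alternatingGroup Ω ≤ G)
    (hT : ∀ t ∈ T, ∀ t' ∈ T, (∃ g ∈ G, g * t * g⁻¹ = t') → t = t') (c : Multiset ℕ) :
    (T.filter (fun t => t.cycleType = c)).card ≤ 2 := by
  by_contra! h
  obtain ⟨a, b, d, ha, hb, hd, hab, had, hbd⟩ := Finset.two_lt_card_iff.1 h
  rw [mem_filter] at ha hb hd
  obtain ⟨g, hg⟩ := isConj_iff.1 (Perm.isConj_iff_cycleType_eq.2 (ha.2.trans hb.2.symm))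
  obtain ⟨g', hg'⟩ := isConj_iff.1 (Perm.isConj_iff_cycleType_eq.2 (ha.2.trans hd.2.symm))
  have h1 : Perm.sign g = -1 := by
    rcases Int.units_eq_one_or (Perm.sign g) with h | h
    · exact absurd (hT a ha.1 b hb.1 ⟨g, hA (Perm.mem_alternatingGroup.2 h), hg⟩) hab
    · exact h
  have h2 : Perm.sign g' = -1 := by
    rcases Int.units_eq_one_or (Perm.sign g') with h | h
    · exact absurd (hT a ha.1 d hd.1 ⟨g', hA (Perm.mem_alternatingGroup.2 h), hg'⟩) had
    · exact h
  refine hbd (hT b hb.1 d hd.1 ⟨g' * g⁻¹, hA (Perm.mem_alternatingGroup.2 (by simp [h1, h2])), ?_⟩)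
  rw [← hg, ← hg']; group

lemma fib_one (hA : alternatingGroup Ω ≤ G)
    (hT : ∀ t ∈ T, ∀ t' ∈ T, (∃ g ∈ G, g * t * g⁻¹ = t') → t = t') (c : Multiset ℕ)
    (hc : c.sum + 2 ≤ Fintype.card Ω) :
    (T.filter (fun t => t.cycleType = c)).card ≤ 1 := by
  rw [card_le_one]
  intro a ha b hb
  rw [mem_filter] at ha hb
  obtain ⟨g, hg⟩ := isConj_iff.1 (Perm.isConj_iff_cycleType_eq.2 (ha.2.trans hb.2.symm))
  have h0 : 1 < (univ \ a.support).card := by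
    rw [card_sdiff_of_subset (subset_univ _), card_univ, ← Perm.sum_cycleType, ha.2]; omega
  obtain ⟨x, hx, y, hy, hxy⟩ := one_lt_card.1 h0
  simp only [mem_sdiff, mem_univ, true_and, Perm.notMem_support] at hx hy
  have hs : swap x y * a * (swap x y)⁻¹ = a := by
    rw [mul_inv_eq_iff_eq_mul]
    rw [Equiv.mul_swap_eq_swap_mul, hx, hy]
  rcases Int.units_eq_one_or (Perm.sign g) with h | h
  · exact hT a ha.1 b hb.1 ⟨g, hA (Perm.mem_alternatingGroup.2 h), hg⟩
  · refine hT a ha.1 b hb.1 ⟨g * swap x y, hA (Perm.mem_alternatingGroup.2 ?_), ?_⟩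
    · simp [h, Perm.sign_swap hxy]
    · rw [← hg]
      conv_rhs => rw [← hs]
      group
end
end WS

namespace WS
open Finset
set_option linter.unusedSectionVars false
set_option linter.unusedSimpArgs false

section
variable {Ω : Type*} [Fintype Ω] [DecidableEq Ω]
variable {G : Subgroup (Perm Ω)} {T : Finset (Perm Ω)}

lemma sum_fib (f : ℕ → ℝ) (S : Finset (Perm Ω)) :
    ∑ t ∈ S, f t.support.card = ∑ c ∈ S.image (fun t : Perm Ω => t.cycleType),
      ((S.filter (fun t => t.cycleType = c)).card : ℝ) * f c.sum := by
  rw [← sum_fiberwise_of_maps_to (g := fun t : Perm Ω => t.cycleType)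
    (fun t ht => mem_image_of_mem _ ht)]
  refine sum_congr rfl fun c _ => ?_
  rw [← nsmul_eq_mul, ← sum_const]
  refine sum_congr rfl fun t ht => ?_
  rw [← (mem_filter.1 ht).2, Perm.sum_cycleType]

lemma types_ok (S : Finset (Perm Ω)) : ∀ c ∈ S.image (fun t : Perm Ω => t.cycleType),
    (∀ i ∈ c, 2 ≤ i) ∧ c.sum ≤ Fintype.card Ω := by
  intro c hc
  obtain ⟨t, _, rfl⟩ := mem_image.1 hc
  refine ⟨fun i hi => Perm.two_le_of_mem_cycleType hi, ?_⟩
  rw [Perm.sum_cycleType]; exact card_le_univ _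

lemma reps_sum_gen (hA : alternatingGroup Ω ≤ G)
    (hT : ∀ t ∈ T, ∀ t' ∈ T, (∃ g ∈ G, g * t * g⁻¹ = t') → t = t') :
    ∑ t ∈ T, (7/8 : ℝ) ^ t.support.card ≤ 2 * AA := by
  rw [sum_fib (fun s => (7/8 : ℝ) ^ s)]
  calc _ ≤ ∑ c ∈ T.image (fun t : Perm Ω => t.cycleType), 2 * (7/8 : ℝ) ^ c.sum := by
        refine sum_le_sum fun c _ => ?_
        have : ((T.filter (fun t => t.cycleType = c)).card : ℝ) ≤ 2 := by
          exact_mod_cast fib_two hA hT c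
        gcongr
    _ ≤ 2 * AA := by
        rw [← mul_sum]
        have := types_bound2 _ _ (types_ok T) (7/8 : ℝ) (by norm_num) (by norm_num)
        have h2 := prod_gen (7/8) (by norm_num) (by norm_num) (Fintype.card Ω)
        unfold AA
        linarith

lemma reps_sum_half (hA : alternatingGroup Ω ≤ G)
    (hT : ∀ t ∈ T, ∀ t' ∈ T, (∃ g ∈ G, g * t * g⁻¹ = t') → t = t') :
    ∑ t ∈ T.filter (fun t => t.support.card + 2 ≤ Fintype.card Ω), (1/2 : ℝ) ^ t.support.card ≤ 16/9 := by
  set S := T.filter (fun t => t.support.card + 2 ≤ Fintype.card Ω) with hS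
  rw [sum_fib (fun s => (1/2 : ℝ) ^ s)]
  calc _ ≤ ∑ c ∈ S.image (fun t : Perm Ω => t.cycleType), (1/2 : ℝ) ^ c.sum := by
        refine sum_le_sum fun c hc => ?_
        obtain ⟨t, ht, rfl⟩ := mem_image.1 hc
        have : ((S.filter (fun t' => t'.cycleType = t.cycleType)).card : ℝ) ≤ 1 := by
          have h1 := fib_one (T := S) hA (fun a ha b hb => hT a (mem_filter.1 ha).1 b (mem_filter.1 hb).1)
            t.cycleType (by rw [Perm.sum_cycleType]; exact (mem_filter.1 ht).2)
          exact_mod_cast h1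
        have h0 : (0:ℝ) < (1/2 : ℝ) ^ t.cycleType.sum := by positivity
        nlinarith
    _ ≤ _ := (types_bound2 _ _ (types_ok S) (1/2 : ℝ) (by norm_num) (by norm_num)).trans
        (prod_half _)

lemma master2 {X : Type*} [Group X] [Finite X] {H : Subgroup (Perm Ω)} (hk : 2 ≤ kclass X)
    (T : Finset (Perm Ω)) (hTH : ∀ t ∈ T, t ∈ H)
    (hT : ∀ h ∈ H, ∃ t ∈ T, ∃ g ∈ H, g * h * g⁻¹ = t)
    (L : Perm Ω → Subgroup (Perm Ω)) (hL : ∀ t ∈ T, L t ≤ H)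
    (hd : ∀ t ∈ T, ∀ g ∈ L t, g.Disjoint t)
    (hsum : ∑ t ∈ T, (∑ g ∈ els (L t), yy ^ (g * t).support.card) / (els (L t)).card ≤ 1) :
    kclass (Wreath X H) ≤ kclass X ^ (Fintype.card Ω) := by
  have h1 := master (X := X) T hTH hT L hL hd
  have h2 : ∑ t ∈ T, (∑ g ∈ els (L t), (inv (ConjClasses X) (g * t) : ℝ)) / (els (L t)).card ≤
      (kclass X : ℝ) ^ (Fintype.card Ω) *
        ∑ t ∈ T, (∑ g ∈ els (L t), yy ^ (g * t).support.card) / (els (L t)).card := by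
    rw [mul_sum]
    refine sum_le_sum fun t _ => ?_
    rw [← mul_div_assoc, mul_sum]
    gcongr with g _
    exact inv_le _ hk _
  have h3 : (0:ℝ) ≤ (kclass X : ℝ) ^ (Fintype.card Ω) := by positivity
  have : (kclass (Wreath X H) : ℝ) ≤ (kclass X : ℝ) ^ (Fintype.card Ω) := by nlinarith
  exact_mod_cast this

lemma exists_cyc (F : Finset Ω) (hF : 2 ≤ F.card) : ∃ c : Perm Ω, c.IsCycle ∧ c.support = F := by
  refine ⟨F.toList.formPerm, ?_, ?_⟩
  · apply List.isCycle_formPerm F.nodup_toList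
    rw [length_toList]; exact hF
  · rw [List.support_formPerm_of_nodup _ F.nodup_toList]
    · simp
    · intro x h
      have := congrArg List.length h
      rw [length_toList] at this
      simp at this; omega

lemma avg_cycle (t : Perm Ω) (F : Finset Ω) (hF : Disjoint F t.support) (h2 : 2 ≤ F.card)
    (hodd : Odd F.card) : ∃ L : Subgroup (Perm Ω), L ≤ alternatingGroup Ω ∧
      (∀ g ∈ L, g.Disjoint t) ∧
      (∑ g ∈ els L, yy ^ (g * t).support.card) / (els L).card ≤
        yy ^ t.support.card * (1 / F.card + yy ^ F.card) := by
  obtain ⟨c, hc, hcs⟩ := exists_cyc F h2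
  have hord : orderOf c = F.card := by rw [hc.orderOf, hcs]
  have hdis : ∀ g ∈ Subgroup.zpowers c, g.Disjoint t := by
    intro g hg
    obtain ⟨i, rfl⟩ := Subgroup.mem_zpowers_iff.1 hg
    have : c.Disjoint t := by rw [Perm.disjoint_iff_disjoint_support, hcs]; exact hF
    have h := this.zpow_disjoint_zpow i 1
    rwa [zpow_one] at h
  have hsup : ∀ g ∈ Subgroup.zpowers c, g ≠ 1 → g.support = F := by
    intro g hg hg1
    obtain ⟨i, hi, rfl⟩ := mem_image.1 (mem_zpowers_iff_mem_range_orderOf.1 hg)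
    rw [← hcs]
    apply hc.support_pow_eq_iff.2
    intro h
    exact hg1 (orderOf_dvd_iff_pow_eq_one.1 h)
  have hcard : (els (Subgroup.zpowers c)).card = F.card := by
    rw [card_els, Nat.card_zpowers, hord]
  refine ⟨Subgroup.zpowers c, ?_, hdis, ?_⟩
  · rw [Subgroup.zpowers_le, Perm.mem_alternatingGroup, hc.sign, hcs, hodd.neg_one_pow]; simp
  · have hp : (0:ℝ) < F.card := by exact_mod_cast (by omega : 0 < F.card)
    rw [hcard, div_le_iff₀ hp]
    have h1 : (1 : Perm Ω) ∈ els (Subgroup.zpowers c) := mem_els.2 (Subgroup.one_mem _)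
    rw [← add_sum_erase _ _ h1, one_mul]
    have h3 : ∑ g ∈ (els (Subgroup.zpowers c)).erase 1, yy ^ (g * t).support.card ≤
        ∑ g ∈ (els (Subgroup.zpowers c)).erase 1, yy ^ (F.card + t.support.card) := by
      refine sum_le_sum fun g hg => ?_
      obtain ⟨hg1, hg⟩ := mem_erase.1 hg
      have hg := mem_els.1 hg
      rw [(hdis g hg).card_support_mul, hsup g hg hg1]
    rw [sum_const, card_erase_of_mem h1, hcard, nsmul_eq_mul] at h3
    have h4 : ((F.card - 1 : ℕ) : ℝ) ≤ F.card := by exact_mod_cast Nat.sub_le _ _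
    have h5 : (0:ℝ) < yy ^ (F.card + t.support.card) := yy_pow_pos _
    have h6 : yy ^ t.support.card * (1 / F.card + yy ^ F.card) * F.card =
        yy ^ t.support.card + F.card * yy ^ (F.card + t.support.card) := by
      rw [pow_add]; field_simp
    rw [h6]
    nlinarith
end

lemma yy_le : yy ≤ 3/4 := by
  have := yy_sq
  have := yy_pos
  nlinarith

lemma caseA : ∃ n0 : ℕ, ∀ (Ω : Type) [Fintype Ω] [DecidableEq Ω] (X : Type) [Group X] [Finite X]
    (H : Subgroup (Perm Ω)), 2 ≤ kclass X → alternatingGroup Ω ≤ H → n0 ≤ Fintype.card Ω →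
    kclass (Wreath X H) ≤ kclass X ^ (Fintype.card Ω) := by
  have hAA := AA_pos
  obtain ⟨q, hq⟩ : ∃ q : ℕ, ∀ p : ℕ, q ≤ p → 2 * AA * (1 / p + yy ^ p) ≤ 1/2 := by
    have h1 : Filter.Tendsto (fun p : ℕ => 2 * AA * (1 / (p:ℝ) + yy ^ p)) Filter.atTop (nhds (2 * AA * (0 + 0))) :=
      (tendsto_one_div_atTop_nhds_zero_nat.add
        (tendsto_pow_atTop_nhds_zero_of_lt_one yy_pos.le yy_lt_one)).const_mul _
    simp only [add_zero, mul_zero] at h1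
    exact Filter.eventually_atTop.1 (h1.eventually_le_const (by norm_num))
  set p := 2 * q + 3 with hp
  have hq := hq p (by omega)
  obtain ⟨r, hr⟩ : ∃ r : ℕ, ∀ s : ℕ, r ≤ s → 2 * AA * (6/7 : ℝ) ^ s ≤ 1/2 := by
    have h1 : Filter.Tendsto (fun p : ℕ => 2 * AA * (6/7 : ℝ) ^ p) Filter.atTop (nhds (2 * AA * 0)) :=
      (tendsto_pow_atTop_nhds_zero_of_lt_one (by norm_num) (by norm_num)).const_mul _
    simp only [mul_zero] at h1
    exact Filter.eventually_atTop.1 (h1.eventually_le_const (by norm_num))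
  refine ⟨p + r, fun Ω _ _ X _ _ H hk hA hn => ?_⟩
  obtain ⟨T, hTH, hTc, hTu⟩ := exists_reps H
  have hL : ∀ t : Perm Ω, ∃ L : Subgroup (Perm Ω), L ≤ alternatingGroup Ω ∧
      (∀ g ∈ L, g.Disjoint t) ∧ (∑ g ∈ els L, yy ^ (g * t).support.card) / (els L).card ≤
        (7/8:ℝ) ^ t.support.card * (1 / p + yy ^ p + (6/7) ^ r) := by
    intro t
    have hpos : 0 < yy ^ p := yy_pow_pos p
    have hbase : yy ^ t.support.card ≤ (7/8:ℝ) ^ t.support.card * (6/7) ^ t.support.card := by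
      rw [← mul_pow]
      apply pow_le_pow_left₀ yy_pos.le
      have := yy_le
      norm_num; linarith
    by_cases h : t.support.card + p ≤ Fintype.card Ω
    · obtain ⟨F, hF, hFc⟩ := exists_subset_card_eq (s := univ \ t.support) (n := p) (by
        rw [card_sdiff_of_subset (subset_univ _), card_univ]; omega)
      obtain ⟨L, h1, h2, h3⟩ := avg_cycle t F (by
        rw [Finset.disjoint_left]; intro x hx
        exact (mem_sdiff.1 (hF hx)).2) (by omega) (by rw [hFc, hp]; exact ⟨q + 1, by ring⟩)
      refine ⟨L, h1, h2, h3.trans ?_⟩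
      rw [hFc]
      have h4 : (6/7:ℝ) ^ t.support.card ≤ 1 := pow_le_one₀ (by norm_num) (by norm_num)
      have h5 : yy ^ t.support.card ≤ (7/8:ℝ) ^ t.support.card := by
        refine hbase.trans (mul_le_of_le_one_right (by positivity) h4)
      have h6 : (0:ℝ) < (6/7)^r := by positivity
      have h7 : 0 ≤ 1 / (p:ℝ) + yy ^ p := by positivity
      exact mul_le_mul h5 (by linarith) h7 (by positivity)
    · refine ⟨⊥, bot_le, ?_, ?_⟩
      · intro g hg
        rw [Subgroup.mem_bot.1 hg]
        exact Perm.disjoint_one_left t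
      · have h1 : els (⊥ : Subgroup (Perm Ω)) = {1} := by
          ext g; rw [mem_els, Subgroup.mem_bot, mem_singleton]
        rw [h1, sum_singleton, one_mul, card_singleton, Nat.cast_one, div_one]
        refine hbase.trans ?_
        gcongr
        have h2 : (6/7:ℝ) ^ t.support.card ≤ (6/7) ^ r :=
          pow_le_pow_of_le_one (by norm_num) (by norm_num) (by omega)
        have h3 : (0:ℝ) ≤ 1 / p := by positivity
        linarith
  choose L hL1 hL2 hL3 using hL
  refine master2 hk T hTH hTc L (fun t _ => (hL1 t).trans hA) (fun t _ => hL2 t) ?_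
  refine (sum_le_sum fun t _ => hL3 t).trans ?_
  rw [← sum_mul]
  have h1 := reps_sum_gen hA hTu
  have h2 := hr r le_rfl
  have h3 : 0 ≤ 1 / (p:ℝ) + yy ^ p + (6/7) ^ r := by
    have hpos : 0 < yy ^ p := yy_pow_pos p
    positivity
  calc _ ≤ 2 * AA * (1 / (p:ℝ) + yy ^ p + (6/7) ^ r) := by gcongr
    _ ≤ 1 := by linarith
end WS

namespace WS
open Finset
set_option linter.unusedSectionVars false
set_option linter.unusedSimpArgs false

structure Blk {Ω : Type} [Fintype Ω] [DecidableEq Ω] (H : Subgroup (Perm Ω))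
    (S : Type) [Fintype S] [DecidableEq S] (f : H →* Perm S) (π : Ω → S) (d : ℕ) : Prop where
  equi : ∀ (h : H) (w : Ω), π ((h : Perm Ω) w) = f h (π w)
  fib : ∀ s, (univ.filter (fun w => π w = s)).card = d
  two : 2 ≤ Fintype.card S
  prim : IsPreprimitive f.range S
  semi : ∀ h : H, f h = 1 → ∀ w, (h : Perm Ω) w = w → h = 1

section
variable {Ω : Type} [Fintype Ω] [DecidableEq Ω]

lemma exists_blk (H : Subgroup (Perm Ω)) (htr : IsPretransitive H Ω) (hn : 2 ≤ Fintype.card Ω)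
    (hs : ∀ N : Subgroup H, N.Normal →
        IsPretransitive N Ω ∨ ∀ (g : N) (x : Ω), g • x = x → g = 1) :
    ∃ (S : Type) (_ : Fintype S) (_ : DecidableEq S) (f : H →* Perm S) (π : Ω → S) (d : ℕ),
      Blk H S f π d := by
  classical
  have hnt : Nontrivial Ω := Fintype.one_lt_card_iff_nontrivial.1 (by omega)
  obtain ⟨a⟩ : Nonempty Ω := inferInstance
  have hne : stabilizer H a ≠ ⊤ := by
    intro h
    obtain ⟨b, hb⟩ := exists_ne a
    obtain ⟨g, hg⟩ := htr.exists_smul_eq a b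
    have : g ∈ stabilizer H a := by rw [h]; trivial
    rw [mem_stabilizer_iff] at this
    exact hb (hg.symm.trans this)
  obtain ⟨M, hM, hSM⟩ := (eq_top_or_exists_le_coatom (stabilizer H a)).resolve_left hne
  let S := H ⧸ M
  have : Fintype S := Fintype.ofFinite _
  have hSnt : Nontrivial S := by
    obtain ⟨g, hg⟩ : ∃ g, g ∉ M := by
      by_contra! h
      exact hM.1 (eq_top_iff.2 fun g _ => h g)
    refine ⟨⟨(g : S), ((1 : H) : S), fun h => hg ?_⟩⟩
    have := QuotientGroup.eq.1 h
    simpa using this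
  have hStr : IsPretransitive H S := inferInstance
  have hSprim : IsPreprimitive H S := by
    rw [← isCoatom_stabilizer_iff_preprimitive H ((1 : H) : S), stabilizer_quotient]
    exact hM
  choose r hr using fun w => htr.exists_smul_eq a w
  let π : Ω → S := fun w => (r w : S)
  let f : H →* Perm S := toPermHom H S
  have hequi : ∀ (h : H) (w : Ω), π ((h : Perm Ω) w) = f h (π w) := by
    intro h w
    change ((r ((h : Perm Ω) w) : H) : S) = ((h * r w : H) : S)
    refine QuotientGroup.eq.2 (hSM ?_)
    rw [mem_stabilizer_iff, mul_smul, inv_smul_eq_iff, hr, mul_smul, hr]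
    rfl
  have hfib : ∀ s s' : S, (univ.filter (fun w => π w = s)).card ≤ (univ.filter (fun w => π w = s')).card := by
    intro s s'
    obtain ⟨g, hg⟩ := hStr.exists_smul_eq s s'
    refine card_le_card_of_injOn (fun w => (g : Perm Ω) w) ?_ ((g : Perm Ω).injective.injOn)
    intro w hw
    simp only [coe_filter, mem_univ, true_and, Set.mem_ofPred_eq] at hw ⊢
    rw [hequi, hw]; exact hg
  have hprim : IsPreprimitive f.range S := by
    let F : S →ₑ[f.rangeRestrict] S := ⟨id, fun h s => rfl⟩
    exact IsPreprimitive.of_surjective (f := F) Function.surjective_id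
  refine ⟨S, inferInstance, inferInstance, f, π, (univ.filter (fun w => π w = ((1:H) : S))).card, ?_⟩
  refine ⟨hequi, fun s => le_antisymm (hfib _ _) (hfib _ _), Fintype.one_lt_card_iff_nontrivial.2 hSnt, hprim, ?_⟩
  rcases hs f.ker inferInstance with h | h
  · exfalso
    obtain ⟨s, hs⟩ := exists_ne (π a)
    obtain ⟨g, hg⟩ := hStr.exists_smul_eq (π a) s
    obtain ⟨⟨k, hk⟩, hk2⟩ := h.exists_smul_eq a ((g : Perm Ω) a)
    have h1 : π ((k : Perm Ω) a) = π ((g : Perm Ω) a) := congrArg π hk2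
    rw [hequi, hequi, MonoidHom.mem_ker.1 hk] at h1
    exact hs (hg.symm.trans h1.symm)
  · intro g hg w hw
    have := h ⟨g, MonoidHom.mem_ker.2 hg⟩ w hw
    exact congrArg Subtype.val this

variable {H : Subgroup (Perm Ω)} {S : Type} [Fintype S] [DecidableEq S] {f : H →* Perm S}
  {π : Ω → S} {d : ℕ}

lemma Blk.card (B : Blk H S f π d) : Fintype.card Ω = d * Fintype.card S := by
  rw [← card_univ, card_eq_sum_card_fiberwise (f := π) (t := univ) (fun _ _ => by simp),
    sum_congr rfl (fun s _ => B.fib s), sum_const, card_univ, smul_eq_mul, mul_comm]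

lemma Blk.supp (B : Blk H S f π d) (h : H) : d * (f h).support.card ≤ (h : Perm Ω).support.card := by
  have h1 : (univ.filter (fun w => π w ∈ (f h).support)) ⊆ (h : Perm Ω).support := by
    intro w hw
    simp only [mem_filter, mem_univ, true_and, Perm.mem_support] at hw ⊢
    intro h2
    apply hw
    rw [← B.equi, h2]
  refine le_trans ?_ (card_le_card h1)
  rw [card_eq_sum_card_fiberwise (f := π) (t := (f h).support) (fun w hw => by simpa using hw)]
  rw [mul_comm, ← smul_eq_mul, ← sum_const]
  refine sum_le_sum fun s hs => ?_
  rw [← B.fib s]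
  apply card_le_card
  intro w hw
  simp only [mem_filter, mem_univ, true_and] at hw ⊢
  exact ⟨by rw [hw]; exact hs, hw⟩

lemma Blk.dpos (B : Blk H S f π d) (hn : 0 < Fintype.card Ω) : 0 < d := by
  rcases Nat.eq_zero_or_pos d with h | h
  · have := B.card; rw [h] at this; omega
  · exact h

/-- size of fibres of `f` -/
lemma Blk.fib_card [Fintype H] (B : Blk H S f π d) (hn : 0 < Fintype.card Ω) (t : Perm S) :
    (univ.filter (fun h : H => f h = t)).card ≤ d := by
  rcases (univ.filter (fun h : H => f h = t)).eq_empty_or_nonempty with h | ⟨h0, hh0⟩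
  · rw [h]; simp
  rw [mem_filter] at hh0
  obtain ⟨a⟩ := Fintype.card_pos_iff.1 hn
  rw [← B.fib (t (π a))]
  refine card_le_card_of_injOn (fun h : H => (h : Perm Ω) a) ?_ ?_
  · intro h hh
    simp only [coe_filter, mem_univ, true_and, Set.mem_ofPred_eq] at hh ⊢
    rw [B.equi, hh]
  · intro h hh h' hh' heq
    simp only [coe_filter, mem_univ, true_and, Set.mem_ofPred_eq] at hh hh' heq
    have := B.semi (h⁻¹ * h') (by rw [map_mul, map_inv, hh, hh']; simp) a (by
      simp only [Subgroup.coe_mul, Subgroup.coe_inv, Perm.mul_apply]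
      rw [← heq]; simp)
    exact inv_mul_eq_one.1 this

lemma Blk.fib_supp (B : Blk H S f π d) (h h' : H) (hf : f h = f h') (hne : h ≠ h') :
    Fintype.card Ω ≤ (h : Perm Ω).support.card + (h' : Perm Ω).support.card := by
  refine le_trans ?_ (card_union_le _ _)
  rw [← card_univ]
  apply card_le_card
  intro w _
  rw [mem_union, Perm.mem_support, Perm.mem_support]
  by_contra! hcon
  apply hne
  have := B.semi (h⁻¹ * h') (by rw [map_mul, map_inv, hf]; simp) w (by
      simp only [Subgroup.coe_mul, Subgroup.coe_inv, Perm.mul_apply]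
      rw [hcon.2, Perm.inv_eq_iff_eq, hcon.1])
  exact inv_mul_eq_one.1 this

lemma Blk.ker_supp (B : Blk H S f π d) (h : H) (hf : f h = 1) (hne : h ≠ 1) :
    (h : Perm Ω).support.card = Fintype.card Ω := by
  have := B.fib_supp h 1 (by rw [hf, map_one]) hne
  simp at this
  exact le_antisymm (card_le_univ _) this

lemma Blk.coset_sum [Fintype H] (B : Blk H S f π d) (hn : 0 < Fintype.card Ω) (t : Perm S) :
    ∑ h ∈ univ.filter (fun h : H => f h = t), yy ^ (h : Perm Ω).support.card ≤
      yy ^ (d * t.support.card) + d * yy ^ (Fintype.card Ω / 2) := by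
  set Q := univ.filter (fun h : H => f h = t) with hQ
  set n := Fintype.card Ω
  rw [← sum_filter_add_sum_filter_not Q (fun h : H => 2 * (h : Perm Ω).support.card < n)]
  apply add_le_add
  · have h1 : (Q.filter (fun h : H => 2 * (h : Perm Ω).support.card < n)).card ≤ 1 := by
      rw [card_le_one]
      intro h hh h' hh'
      simp only [hQ, mem_filter, mem_univ, true_and] at hh hh'
      by_contra hne
      have := B.fib_supp h h' (hh.1.trans hh'.1.symm) hne
      omega
    have h2 : ∀ h ∈ Q.filter (fun h : H => 2 * (h : Perm Ω).support.card < n),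
        yy ^ (h : Perm Ω).support.card ≤ yy ^ (d * t.support.card) := by
      intro h hh
      simp only [hQ, mem_filter, mem_univ, true_and] at hh
      have := B.supp h
      rw [hh.1] at this
      exact yy_pow_le this
    refine (sum_le_card_nsmul _ _ _ h2).trans ?_
    rw [nsmul_eq_mul]
    have h3 : ((Q.filter (fun h : H => 2 * (h : Perm Ω).support.card < n)).card : ℝ) ≤ 1 := by exact_mod_cast h1
    have := yy_pow_pos (d * t.support.card)
    nlinarith
  · have h2 : ∀ h ∈ Q.filter (fun h : H => ¬ 2 * (h : Perm Ω).support.card < n),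
        yy ^ (h : Perm Ω).support.card ≤ yy ^ (n / 2) := by
      intro h hh
      simp only [hQ, mem_filter, mem_univ, true_and] at hh
      exact yy_pow_le (by omega)
    refine (sum_le_card_nsmul _ _ _ h2).trans ?_
    rw [nsmul_eq_mul]
    have h3 : ((Q.filter (fun h : H => ¬ 2 * (h : Perm Ω).support.card < n)).card : ℝ) ≤ d := by
      exact_mod_cast (card_le_card (filter_subset _ _)).trans (B.fib_card hn t)
    have := yy_pow_pos (n / 2)
    gcongr

lemma Blk.coset_sum2 [Fintype H] (B : Blk H S f π d) (hn : 0 < Fintype.card Ω) (t : Perm S) :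
    ∑ h ∈ univ.filter (fun h : H => f h = t), yy ^ (h : Perm Ω).support.card ≤
      d * yy ^ (d * t.support.card) := by
  have h2 : ∀ h ∈ univ.filter (fun h : H => f h = t),
        yy ^ (h : Perm Ω).support.card ≤ yy ^ (d * t.support.card) := by
      intro h hh
      simp only [mem_filter, mem_univ, true_and] at hh
      have := B.supp h
      rw [hh] at this
      exact yy_pow_le this
  refine (sum_le_card_nsmul _ _ _ h2).trans ?_
  rw [nsmul_eq_mul]
  have h3 : ((univ.filter (fun h : H => f h = t)).card : ℝ) ≤ d := by exact_mod_cast B.fib_card hn t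
  have := yy_pow_pos (d * t.support.card)
  gcongr

/-- main reduction -/
lemma Blk.main [Fintype H] (B : Blk H S f π d) (htr : IsPretransitive H Ω) (hn : 0 < Fintype.card Ω)
    {X : Type*} [Group X] [Finite X] (hk : 2 ≤ kclass X)
    (T : Finset (Perm S)) (hT1 : 1 ∈ T)
    (hT : ∀ h ∈ f.range, ∃ t ∈ T, ∃ g ∈ f.range, g * h * g⁻¹ = t)
    (hsum : yy ^ (Fintype.card Ω / 2) + 2 / Fintype.card Ω + Fintype.card Ω * yy ^ Fintype.card Ω +
      ∑ t ∈ T.erase 1, ∑ h ∈ univ.filter (fun h : H => f h = t), yy ^ (h : Perm Ω).support.card ≤ 1) :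
    kclass (Wreath X H) ≤ kclass X ^ (Fintype.card Ω) := by
  let T' : Finset (Perm Ω) := (univ.filter (fun h : H => f h ∈ T)).image (fun h : H => (h : Perm Ω))
  let L : Perm Ω → Subgroup (Perm Ω) := fun t => if t = 1 then H else ⊥
  refine master2 hk T' ?_ ?_ L ?_ ?_ ?_
  · intro t ht
    obtain ⟨h, _, rfl⟩ := mem_image.1 ht
    exact h.2
  · intro h hh
    obtain ⟨t, ht, _, ⟨g, rfl⟩, hg⟩ := hT (f ⟨h, hh⟩) ⟨_, rfl⟩
    refine ⟨_, mem_image.2 ⟨g * ⟨h, hh⟩ * g⁻¹, ?_, rfl⟩, g, g.2, rfl⟩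
    simp only [mem_filter, mem_univ, true_and, map_mul, map_inv, hg, ht]
  · intro t _
    simp only [L]; split_ifs
    · exact le_rfl
    · exact bot_le
  · intro t _ g hg
    simp only [L] at hg
    split_ifs at hg with h
    · rw [h]; exact Perm.disjoint_one_right g
    · rw [Subgroup.mem_bot.1 hg]; exact Perm.disjoint_one_left t
  · have h1 : (1 : Perm Ω) ∈ T' := mem_image.2 ⟨1, by simp [hT1], rfl⟩
    rw [← add_sum_erase _ _ h1]
    refine le_trans ?_ hsum
    have h2 := avg_bound H htr hn
    have e1 : (∑ g ∈ els (L 1), yy ^ (g * 1).support.card) / (els (L 1)).card =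
      (∑ g ∈ els H, yy ^ g.support.card) / (els H).card := by simp [L]
    rw [e1]
    have e2 : ∑ t ∈ T'.erase 1, (∑ g ∈ els (L t), yy ^ (g * t).support.card) / (els (L t)).card =
        ∑ t ∈ T'.erase 1, yy ^ t.support.card := by
      refine sum_congr rfl fun t ht => ?_
      have h3 : els (⊥ : Subgroup (Perm Ω)) = {1} := by
        ext g; rw [mem_els, Subgroup.mem_bot, mem_singleton]
      simp only [L, if_neg (mem_erase.1 ht).1]
      rw [h3, sum_singleton, one_mul, card_singleton, Nat.cast_one, div_one]
    rw [e2]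
    have e3 : ∑ t ∈ T'.erase 1, yy ^ t.support.card =
        ∑ h ∈ (univ.filter (fun h : H => f h ∈ T)).erase 1, yy ^ (h : Perm Ω).support.card := by
      rw [← sum_image (f := fun t : Perm Ω => yy ^ t.support.card) (g := fun h : H => (h : Perm Ω))
        (fun _ _ _ _ h => Subtype.ext h)]
      congr 1
      rw [image_erase Subtype.val_injective]
      rfl
    rw [e3]
    have e4 : ∑ h ∈ (univ.filter (fun h : H => f h ∈ T)).erase 1, yy ^ (h : Perm Ω).support.card ≤
        ∑ h ∈ (univ.filter (fun h : H => f h = 1)).erase 1, yy ^ (h : Perm Ω).support.card +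
        ∑ t ∈ T.erase 1, ∑ h ∈ univ.filter (fun h : H => f h = t), yy ^ (h : Perm Ω).support.card := by
      rw [← sum_filter_add_sum_filter_not ((univ.filter (fun h : H => f h ∈ T)).erase 1)
        (fun h => f h = 1)]
      apply add_le_add
      · apply sum_le_sum_of_subset_of_nonneg
        · intro h hh
          simp only [mem_filter, mem_univ, true_and, mem_erase] at hh ⊢
          exact ⟨hh.1.1, hh.2⟩
        · intro _ _ _; exact (yy_pow_pos _).le
      · rw [← sum_fiberwise_of_maps_to (t := T.erase 1) (g := fun h : H => f h)]
        · refine sum_le_sum fun t _ => ?_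
          apply sum_le_sum_of_subset_of_nonneg
          · intro h hh
            simp only [mem_filter, mem_univ, true_and, mem_erase] at hh ⊢
            exact hh.2
          · intro _ _ _; exact (yy_pow_pos _).le
        · intro h hh
          simp only [mem_filter, mem_univ, true_and, mem_erase] at hh ⊢
          exact ⟨hh.2, hh.1.2⟩
    have e5 : ∑ h ∈ (univ.filter (fun h : H => f h = 1)).erase 1, yy ^ (h : Perm Ω).support.card ≤
        Fintype.card Ω * yy ^ Fintype.card Ω := by
      have h3 : ∀ h ∈ (univ.filter (fun h : H => f h = 1)).erase 1,
          yy ^ (h : Perm Ω).support.card ≤ yy ^ Fintype.card Ω := by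
        intro h hh
        simp only [mem_filter, mem_univ, true_and, mem_erase] at hh
        rw [B.ker_supp h hh.2 hh.1]
      refine (sum_le_card_nsmul _ _ _ h3).trans ?_
      rw [nsmul_eq_mul]
      have h4 : (((univ.filter (fun h : H => f h = 1)).erase 1).card : ℝ) ≤ Fintype.card Ω := by
        have h5 := (card_le_card (erase_subset 1 (univ.filter (fun h : H => f h = 1)))).trans (B.fib_card hn 1)
        have h6 := B.card
        have h7 := B.two
        have : ((univ.filter (fun h : H => f h = 1)).erase 1).card ≤ Fintype.card Ω := by nlinarith
        exact_mod_cast this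
      have := yy_pow_pos (Fintype.card Ω)
      gcongr
    linarith

lemma Blk.alt (B : Blk H S f π d) (hd : d = 1) (hA : alternatingGroup S ≤ f.range) :
    alternatingGroup Ω ≤ H := by
  have hbij : Function.Bijective π := by
    rw [Fintype.bijective_iff_surjective_and_card]
    refine ⟨fun s => ?_, by rw [B.card, hd, one_mul]⟩
    have := B.fib s
    rw [hd] at this
    obtain ⟨w, hw⟩ := card_pos.1 (by omega : 0 < (univ.filter (fun w => π w = s)).card)
    exact ⟨w, (mem_filter.1 hw).2⟩
  let e : Ω ≃ S := Equiv.ofBijective π hbij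
  intro s hs
  obtain ⟨h, hh⟩ := hA (Perm.mem_alternatingGroup.2 ((Perm.sign_permCongr e s).trans (Perm.mem_alternatingGroup.1 hs)))
  have : (h : Perm Ω) = s := by
    ext w
    apply hbij.1
    rw [B.equi, hh]
    change e (s (e.symm (e w))) = e (s w)
    rw [Equiv.symm_apply_apply]
  rw [← this]; exact h.2
end
end WS

namespace WS
open Finset
set_option linter.unusedSectionVars false
set_option linter.unusedSimpArgs false

lemma decay (r : ℝ) (h0 : 0 < r) (h1 : r < 1) (q : ℕ) (hq : 0 < q) (ε : ℝ) (hε : 0 < ε) :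
    ∃ n0 : ℕ, ∀ n : ℕ, n0 ≤ n → n * r ^ (n / q) ≤ ε := by
  have t1 : Filter.Tendsto (fun k : ℕ => (q:ℝ) * ((k:ℝ) * r ^ k + r ^ k)) Filter.atTop (nhds (q * (0 + 0))) :=
    ((tendsto_self_mul_const_pow_of_lt_one h0.le h1).add
      (tendsto_pow_atTop_nhds_zero_of_lt_one h0.le h1)).const_mul _
  simp only [add_zero, mul_zero] at t1
  obtain ⟨k0, hk0⟩ := Filter.eventually_atTop.1 (t1.eventually_le_const hε)
  refine ⟨q * k0, fun n hn => ?_⟩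
  have h2 : k0 ≤ n / q := by rw [Nat.le_div_iff_mul_le hq, mul_comm]; exact hn
  refine le_trans ?_ (hk0 _ h2)
  have h3 : n ≤ q * (n / q + 1) := by
    have := Nat.lt_mul_div_succ n hq
    exact this.le
  have h4 : (n:ℝ) ≤ q * ((n / q : ℕ) + 1) := by exact_mod_cast h3
  have h5 : 0 < r ^ (n / q) := by positivity
  calc (n:ℝ) * r ^ (n / q) ≤ (q * ((n / q : ℕ) + 1)) * r ^ (n / q) := by gcongr
    _ = _ := by ring

lemma d_half (d : ℕ) (hd : 0 < d) : (d:ℝ) * (1/2) ^ (d - 1) ≤ 1 := by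
  obtain ⟨e, rfl⟩ : ∃ e, d = e + 1 := ⟨d - 1, by omega⟩
  rw [Nat.add_sub_cancel, one_div, inv_pow, ← div_eq_mul_inv, div_le_one (by positivity)]
  exact_mod_cast Nat.lt_two_pow_self

lemma caseBig : ∃ n0 : ℕ, ∀ (Ω : Type) [Fintype Ω] [DecidableEq Ω] (X : Type) [Group X] [Finite X]
    (H : Subgroup (Perm Ω)), 2 ≤ kclass X → IsPretransitive H Ω →
    (∀ N : Subgroup H, N.Normal →
        IsPretransitive N Ω ∨ ∀ (g : N) (x : Ω), g • x = x → g = 1) →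
    n0 ≤ Fintype.card Ω → kclass (Wreath X H) ≤ kclass X ^ (Fintype.card Ω) := by
  classical
  have hAA := AA_pos
  obtain ⟨nA, hA⟩ := caseA
  obtain ⟨m0, hm0⟩ := prim_case (1/4) (by norm_num)
  obtain ⟨m1, hm1⟩ : ∃ r : ℕ, ∀ s : ℕ, r ≤ s → 2 * AA * (4/7 : ℝ) ^ s ≤ 1/36 := by
    have h1 : Filter.Tendsto (fun p : ℕ => 2 * AA * (4/7 : ℝ) ^ p) Filter.atTop (nhds (2 * AA * 0)) :=
      (tendsto_pow_atTop_nhds_zero_of_lt_one (by norm_num) (by norm_num)).const_mul _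
    simp only [mul_zero] at h1
    exact Filter.eventually_atTop.1 (h1.eventually_le_const (by norm_num))
  set M := m0 + m1 + 1 with hM
  obtain ⟨n1, hn1⟩ := decay (6/7) (by norm_num) (by norm_num) 2 (by norm_num) (1/36) (by norm_num)
  obtain ⟨n2, hn2⟩ := decay (6/7) (by norm_num) (by norm_num) 2 (by norm_num) (1/36 / (2 * AA)) (by positivity)
  obtain ⟨n3, hn3⟩ := decay yy yy_pos yy_lt_one M (by omega) (1/4 / (M.factorial)) (by positivity)
  refine ⟨nA + n1 + n2 + n3 + 72, fun Ω _ _ X _ _ H hk htr hs hn => ?_⟩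
  by_cases hAlt : alternatingGroup Ω ≤ H
  · exact hA Ω X H hk hAlt (by omega)
  obtain ⟨S, _, _, f, π, d, B⟩ := exists_blk H htr (by omega) hs
  have : Fintype H := Fintype.ofFinite H
  have hnpos : 0 < Fintype.card Ω := by omega
  have hcard := B.card
  have hd := B.dpos hnpos
  have htwo := B.two
  set n := Fintype.card Ω with hnd
  set m := Fintype.card S with hmd
  have hn1 := hn1 n (by omega)
  have hn2 := hn2 n (by omega)
  have hn3 := hn3 n (by omega)
  have hnR : (72:ℝ) ≤ n := by exact_mod_cast (by omega : 72 ≤ n)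
  have hyy67 : yy ≤ 6/7 := by have := yy_le; linarith
  have hpow : yy ^ (n/2) ≤ (6/7:ℝ) ^ (n/2) := pow_le_pow_left₀ yy_pos.le hyy67 _
  have b1 : yy ^ (n/2) ≤ 1/36 := by
    have h1 : (0:ℝ) < (6/7:ℝ) ^ (n/2) := by positivity
    nlinarith
  have b2 : 2 / (n:ℝ) ≤ 1/36 := by
    rw [div_le_iff₀ (by linarith)]; linarith
  have b3 : n * yy ^ n ≤ 1/36 := by
    have h1 : yy ^ n ≤ yy ^ (n/2) := yy_pow_le (Nat.div_le_self _ _)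
    have : (n:ℝ) * yy ^ n ≤ n * (6/7:ℝ) ^ (n/2) := by gcongr; linarith
    linarith
  by_cases hsmall : m < M
  · -- few blocks
    refine B.main htr hnpos hk (els f.range) (mem_els.2 (Subgroup.one_mem _))
      (fun h hh => ⟨h, mem_els.2 hh, 1, Subgroup.one_mem _, by simp⟩) ?_
    rw [← hnd]
    have h1 : ∑ t ∈ (els f.range).erase 1, ∑ h ∈ univ.filter (fun h : H => f h = t),
        yy ^ (h : Perm Ω).support.card ≤ ∑ t ∈ (els f.range).erase 1, n * yy ^ (n / M) := by
      refine sum_le_sum fun t ht => (B.coset_sum2 hnpos t).trans ?_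
      have h2 : 0 < t.support.card := by
        rw [card_pos, Finset.nonempty_iff_ne_empty, ne_eq, Perm.support_eq_empty_iff]
        exact (mem_erase.1 ht).1
      have h3 : n / M ≤ d * t.support.card := by
        have : n / M ≤ d := by
          apply Nat.div_le_of_le_mul
          rw [hcard, mul_comm]
          exact Nat.mul_le_mul_right _ hsmall.le
        nlinarith
      have h4 : (d:ℝ) ≤ n := by
        have : d ≤ n := by nlinarith
        exact_mod_cast this
      have := yy_pow_pos (d * t.support.card)
      exact mul_le_mul h4 (yy_pow_le h3) this.le (by positivity)
    rw [sum_const, nsmul_eq_mul] at h1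
    have h5 : (((els f.range).erase 1).card : ℝ) ≤ M.factorial := by
      have : ((els f.range).erase 1).card ≤ M.factorial := by
        calc ((els f.range).erase 1).card ≤ (univ : Finset (Perm S)).card := card_le_card (subset_univ _)
          _ = m.factorial := by rw [card_univ, Fintype.card_perm]
          _ ≤ _ := Nat.factorial_le hsmall.le
      exact_mod_cast this
    have h6 : (0:ℝ) ≤ n * yy ^ (n / M) := by have := yy_pow_pos (n / M); positivity
    have h7 : (((els f.range).erase 1).card : ℝ) * (n * yy ^ (n / M)) ≤ M.factorial * (1/4 / M.factorial) := by
      gcongr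
    have h8 : (M.factorial : ℝ) * (1/4 / M.factorial) = 1/4 := by
      have : (0:ℝ) < M.factorial := by positivity
      field_simp
    linarith
  push Not at hsmall
  by_cases hA2 : alternatingGroup S ≤ f.range
  · have hd2 : 2 ≤ d := by
      by_contra h
      exact hAlt (B.alt (by omega) hA2)
    obtain ⟨T, hTG, hTc, hTu⟩ := exists_reps f.range
    have hT1 : 1 ∈ T := by
      obtain ⟨t, ht, g, _, hg⟩ := hTc 1 (Subgroup.one_mem _)
      simp at hg
      rwa [hg]
    refine B.main htr hnpos hk T hT1 hTc ?_
    rw [← hnd]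
    have h2m : m ≤ n / 2 := by
      rw [Nat.le_div_iff_mul_le (by norm_num)]; nlinarith
    have h1 : ∑ t ∈ T.erase 1, ∑ h ∈ univ.filter (fun h : H => f h = t),
        yy ^ (h : Perm Ω).support.card ≤ ∑ t ∈ T.erase 1, ((1/2:ℝ) ^ t.support.card + n * yy ^ (n/2)) := by
      refine sum_le_sum fun t ht => (B.coset_sum hnpos t).trans ?_
      rw [← hnd]
      have h3 : yy ^ (d * t.support.card) ≤ (1/2:ℝ) ^ t.support.card := by
        rw [← yy_sq, ← pow_mul]
        exact yy_pow_le (Nat.mul_le_mul_right _ hd2)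
      have h4 : (d:ℝ) ≤ n := by
        have : d ≤ n := by nlinarith
        exact_mod_cast this
      have := yy_pow_pos (n/2)
      gcongr
    rw [sum_add_distrib, sum_const, nsmul_eq_mul] at h1
    have hgen := reps_sum_gen hA2 hTu
    have hhalf := reps_sum_half hA2 hTu
    -- the count
    have h2 : ((T.erase 1).card : ℝ) * (7/8:ℝ) ^ (n/2) ≤ 2 * AA := by
      refine le_trans ?_ hgen
      calc ((T.erase 1).card : ℝ) * (7/8:ℝ) ^ (n/2) ≤ (T.card : ℝ) * (7/8:ℝ) ^ (n/2) := by
            gcongr; exact erase_subset _ _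
        _ = ∑ t ∈ T, (7/8:ℝ) ^ (n/2) := by rw [sum_const, nsmul_eq_mul]
        _ ≤ _ := by
            refine sum_le_sum fun t _ => ?_
            apply pow_le_pow_of_le_one (by norm_num) (by norm_num)
            exact (card_le_univ _).trans h2m
    have h3 : ((T.erase 1).card : ℝ) * (n * yy ^ (n/2)) ≤ 1/36 := by
      have h4 : yy ^ (n/2) ≤ (7/8:ℝ) ^ (n/2) * (6/7) ^ (n/2) := by
        rw [← mul_pow]
        apply pow_le_pow_left₀ yy_pos.le
        have := yy_le
        norm_num; linarith
      calc ((T.erase 1).card : ℝ) * (n * yy ^ (n/2)) ≤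
          (T.erase 1).card * (n * ((7/8:ℝ) ^ (n/2) * (6/7) ^ (n/2))) := by gcongr
        _ = ((T.erase 1).card * (7/8:ℝ) ^ (n/2)) * (n * (6/7) ^ (n/2)) := by ring
        _ ≤ (2 * AA) * (1/36 / (2 * AA)) := by gcongr
        _ = 1/36 := by field_simp
    -- main term
    have h4 : ∑ t ∈ T.erase 1, (1/2:ℝ) ^ t.support.card ≤ 7/9 + 1/36 := by
      have e0 : ∑ t ∈ T, (1/2:ℝ) ^ t.support.card = 1 + ∑ t ∈ T.erase 1, (1/2:ℝ) ^ t.support.card := by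
        rw [← add_sum_erase _ _ hT1]; simp
      have e1 := sum_filter_add_sum_filter_not T (fun t => t.support.card + 2 ≤ Fintype.card S)
        (fun t => (1/2:ℝ) ^ t.support.card)
      have e2 : ∑ t ∈ T.filter (fun t => ¬ t.support.card + 2 ≤ Fintype.card S),
          (1/2:ℝ) ^ t.support.card ≤ 1/36 := by
        calc _ ≤ ∑ t ∈ T.filter (fun t => ¬ t.support.card + 2 ≤ Fintype.card S),
              (7/8:ℝ) ^ t.support.card * (4/7) ^ (m - 1) := by
              refine sum_le_sum fun t ht => ?_
              have ht := (mem_filter.1 ht).2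
              have h5 : ((4:ℝ)/7) ^ t.support.card ≤ (4/7) ^ (m - 1) :=
                pow_le_pow_of_le_one (by norm_num) (by norm_num) (by omega)
              have h6 : (1/2:ℝ) ^ t.support.card = (7/8:ℝ) ^ t.support.card * (4/7) ^ t.support.card := by
                rw [← mul_pow]; norm_num
              rw [h6]
              gcongr
          _ ≤ ∑ t ∈ T, (7/8:ℝ) ^ t.support.card * (4/7) ^ (m - 1) :=
              sum_le_sum_of_subset_of_nonneg (filter_subset _ _) (fun _ _ _ => by positivity)
          _ ≤ 2 * AA * (4/7) ^ (m - 1) := by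
              rw [← sum_mul]; gcongr
          _ ≤ 1/36 := hm1 _ (by omega)
      linarith
    linarith
  · refine B.main htr hnpos hk (els f.range) (mem_els.2 (Subgroup.one_mem _))
      (fun h hh => ⟨h, mem_els.2 hh, 1, Subgroup.one_mem _, by simp⟩) ?_
    rw [← hnd]
    have h0 := hm0 S f.range B.prim hA2 (by omega)
    have h1 : ∑ t ∈ (els f.range).erase 1, ∑ h ∈ univ.filter (fun h : H => f h = t),
        yy ^ (h : Perm Ω).support.card ≤ ∑ t ∈ (els f.range).erase 1, yy ^ t.support.card := by
      refine sum_le_sum fun t ht => (B.coset_sum2 hnpos t).trans ?_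
      have h2 : 2 ≤ t.support.card := Perm.two_le_card_support_of_ne_one (mem_erase.1 ht).1
      have h3 : yy ^ (d * t.support.card) ≤ yy ^ (2 * (d - 1) + t.support.card) := by
        apply yy_pow_le
        obtain ⟨e, rfl⟩ : ∃ e, d = e + 1 := ⟨d - 1, by omega⟩
        rw [Nat.add_sub_cancel]
        nlinarith
      have h4 : yy ^ (2 * (d - 1) + t.support.card) = (1/2) ^ (d - 1) * yy ^ t.support.card := by
        rw [pow_add, pow_mul, yy_sq]
      have h5 := d_half d hd
      have h6 := yy_pow_pos t.support.card
      calc (d:ℝ) * yy ^ (d * t.support.card) ≤ d * ((1/2) ^ (d - 1) * yy ^ t.support.card) := by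
            rw [← h4]; gcongr
        _ = (d * (1/2) ^ (d - 1)) * yy ^ t.support.card := by ring
        _ ≤ 1 * yy ^ t.support.card := by gcongr
        _ = _ := one_mul _
    linarith

lemma two_le_kclass (X : Type) [Group X] [Finite X] [Nontrivial X] : 2 ≤ kclass X := by
  obtain ⟨x, hx⟩ := exists_ne (1 : X)
  have : Nontrivial (ConjClasses X) := by
    refine ⟨⟨ConjClasses.mk 1, ConjClasses.mk x, fun h => hx ?_⟩⟩
    have := ConjClasses.mk_eq_mk_iff_isConj.1 h
    exact isConj_one_right.1 this
  have : Finite (ConjClasses X) := inferInstance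
  unfold kclass
  exact Finite.one_lt_card

lemma caseOne {Ω : Type} [Fintype Ω] [DecidableEq Ω] (X : Type) [Group X] [Finite X]
    (H : Subgroup (Perm Ω)) (hn : Fintype.card Ω ≤ 1) :
    kclass (Wreath X H) ≤ kclass X ^ (Fintype.card Ω) := by
  have hs : Subsingleton Ω := Fintype.card_le_one_iff_subsingleton.1 hn
  have h1 := master (X := X) (H := H) {1} (by simp [H.one_mem])
    (fun h _ => ⟨1, by simp, 1, H.one_mem, Subsingleton.elim _ _⟩) (fun _ => ⊥) (fun _ _ => bot_le)
    (by intro t ht g _; rw [mem_singleton.1 ht]; exact Perm.disjoint_one_right g)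
  have h3 : els (⊥ : Subgroup (Perm Ω)) = {1} := by
    ext g; rw [mem_els, Subgroup.mem_bot, mem_singleton]
  rw [sum_singleton, h3, sum_singleton, mul_one, inv_one] at h1
  simp at h1
  exact_mod_cast h1

lemma caseSmall (C0 : ℕ) : ∃ C1 : ℕ, ∀ (Ω : Type) [Fintype Ω] [DecidableEq Ω] (X : Type) [Group X] [Finite X]
    (H : Subgroup (Perm Ω)), IsPretransitive H Ω → 2 ≤ Fintype.card Ω → Fintype.card Ω ≤ C0 →
    C1 ≤ kclass X → kclass (Wreath X H) ≤ kclass X ^ (Fintype.card Ω) := by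
  refine ⟨2 * (1 + C0.factorial), fun Ω _ _ X _ _ H htr hn2 hnC hk => ?_⟩
  let L : Perm Ω → Subgroup (Perm Ω) := fun t => if t = 1 then H else ⊥
  have h1 := master (X := X) (H := H) (els H) (fun t ht => mem_els.1 ht)
    (fun h hh => ⟨h, mem_els.2 hh, 1, H.one_mem, by simp⟩) L (by
      intro t _
      simp only [L]; split_ifs
      · exact le_rfl
      · exact bot_le) (by
      intro t _ g hg
      simp only [L] at hg
      split_ifs at hg with h
      · rw [h]; exact Perm.disjoint_one_right g
      · rw [Subgroup.mem_bot.1 hg]; exact Perm.disjoint_one_left t)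
  set n := Fintype.card Ω with hnd
  set k := kclass X with hkd
  have hkR : (2 * (1 + C0.factorial) : ℝ) ≤ k := by exact_mod_cast hk
  have hone : (1 : Perm Ω) ∈ els H := mem_els.2 H.one_mem
  have hc2 : 2 ≤ (els H).card := by
    have : Nontrivial Ω := Fintype.one_lt_card_iff_nontrivial.1 (by omega)
    obtain ⟨a, b, hab⟩ := exists_pair_ne Ω
    obtain ⟨g, hg⟩ := htr.exists_smul_eq a b
    apply one_lt_card.2
    refine ⟨1, hone, g, mem_els.2 g.2, fun h => hab ?_⟩
    have h2 : (g : Perm Ω) a = b := hg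
    rw [← h] at h2
    exact h2
  have hcf : ((els H).card : ℝ) ≤ C0.factorial := by
    have : (els H).card ≤ C0.factorial := by
      calc (els H).card ≤ (univ : Finset (Perm Ω)).card := card_le_card (subset_univ _)
        _ = n.factorial := by rw [card_univ, Fintype.card_perm]
        _ ≤ _ := Nat.factorial_le hnC
    exact_mod_cast this
  have hc2R : (2:ℝ) ≤ (els H).card := by exact_mod_cast hc2
  have hsum1 : ∑ g ∈ (els H).erase 1, (inv (ConjClasses X) g : ℝ) ≤ (els H).card * (k:ℝ) ^ (n - 1) := by
    have h2 : ∀ g ∈ (els H).erase 1, (inv (ConjClasses X) g : ℝ) ≤ (k:ℝ) ^ (n - 1) := by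
      intro g hg
      have := inv_le_of_ne (ConjClasses X) (show 2 ≤ kclass X by omega) (mem_erase.1 hg).1
      exact_mod_cast this
    refine (sum_le_card_nsmul _ _ _ h2).trans ?_
    rw [nsmul_eq_mul]
    gcongr
    exact erase_subset _ _
  have hinv1 : (inv (ConjClasses X) (1 : Perm Ω) : ℝ) = (k:ℝ) ^ n := by
    rw [inv_one]; push_cast; rfl
  rw [← add_sum_erase _ _ hone] at h1
  have e1 : (∑ g ∈ els (L 1), (inv (ConjClasses X) (g * 1) : ℝ)) / (els (L 1)).card ≤
      (k:ℝ) ^ n / 2 + (k:ℝ) ^ (n - 1) := by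
    simp only [L, if_true, mul_one]
    rw [← add_sum_erase _ _ hone, hinv1, add_div]
    apply add_le_add
    · gcongr
    · rw [div_le_iff₀ (by linarith), mul_comm]; exact hsum1
  have e2 : ∑ t ∈ (els H).erase 1, (∑ g ∈ els (L t), (inv (ConjClasses X) (g * t) : ℝ)) / (els (L t)).card =
      ∑ t ∈ (els H).erase 1, (inv (ConjClasses X) t : ℝ) := by
    refine sum_congr rfl fun t ht => ?_
    have h3 : els (⊥ : Subgroup (Perm Ω)) = {1} := by
      ext g; rw [mem_els, Subgroup.mem_bot, mem_singleton]
    simp only [L, if_neg (mem_erase.1 ht).1]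
    rw [h3, sum_singleton, one_mul, card_singleton, Nat.cast_one, div_one]
  rw [e2] at h1
  have hk0 : (0:ℝ) ≤ (k:ℝ) ^ (n - 1) := by positivity
  have hkn : (k:ℝ) ^ n = (k:ℝ) ^ (n - 1) * k := by
    rw [← pow_succ]; congr 1; omega
  have : (kclass (Wreath X H) : ℝ) ≤ (k:ℝ) ^ n := by
    rw [hkn] at e1 ⊢
    nlinarith
  exact_mod_cast this

end WS

/-- If `H` is a transitive, semiprimitive permutation group of degree `n` and `X` is a
nontrivial finite group with `k` conjugacy classes, then `k(X ≀ H) ≤ k^n` whenever `n` or `k`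
is sufficiently large. -/
theorem statement0 :
    ∃ C : ℕ, ∀ (n : ℕ) (X : Type) [Group X] [Finite X], Nontrivial X →
      ∀ H : Subgroup (Perm (Fin n)), IsPretransitive H (Fin n) →
      (∀ N : Subgroup H, N.Normal →
        IsPretransitive N (Fin n) ∨ ∀ (g : N) (x : Fin n), g • x = x → g = 1) →
      (C ≤ n ∨ C ≤ kclass X) → kclass (Wreath X H) ≤ kclass X ^ n := by
  obtain ⟨n0, h0⟩ := WS.caseBig
  obtain ⟨C1, h1⟩ := WS.caseSmall n0
  refine ⟨n0 + C1, fun n X _ _ hX H htr hs hC => ?_⟩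
  have hk := WS.two_le_kclass X
  have hcard : Fintype.card (Fin n) = n := Fintype.card_fin n
  by_cases hn1 : n ≤ 1
  · have := WS.caseOne X H (by rw [hcard]; exact hn1)
    rwa [hcard] at this
  by_cases hn : n0 ≤ n
  · have := h0 (Fin n) X H hk htr hs (by rw [hcard]; exact hn)
    rwa [hcard] at this
  · have := h1 (Fin n) X H htr (by rw [hcard]; omega) (by rw [hcard]; omega) (by omega)
    rwa [hcard] at this
end

section
/- Let H ≤ Sym({1,…,n}) be a nontrivial permutation group that contains no transposition. Then for every fixed n there exists a constant K (depending on n and H) such that for every nontrivial finite group X with k := k(X) ≥ K, the wreath product G = X ≀ H satisfies k(G) < (1 + 1/(kn)) · k^n/|H|. -/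
open Equiv MulAction

/-- Pairs of base-group elements that commute after attaching `g` and `h`. -/
def CommFib {n : ℕ} (X : Type) [Group X] (g h : Perm (Fin n)) : Type :=
  {p : (Fin n → X) × (Fin n → X) // ∀ i, p.1 i * p.2 (g.symm i) = p.2 i * p.1 (h.symm i)}

/-- `h`-invariant functions to `C`. -/
def InvFun {n : ℕ} (C : Type) (h : Perm (Fin n)) : Type :=
  {c : Fin n → C // ∀ i, c (h.symm i) = c i}

instance {n : ℕ} (X : Type) [Group X] [Finite X] (g h : Perm (Fin n)) : Finite (CommFib X g h) := by
  unfold CommFib; infer_instance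

instance {n : ℕ} (C : Type) [Finite C] (h : Perm (Fin n)) : Finite (InvFun C h) := by
  unfold InvFun; infer_instance

lemma commFib_one_le {n : ℕ} (X : Type) [Group X] [Finite X] (h : Perm (Fin n)) :
    Nat.card (CommFib X 1 h) ≤ Nat.card (InvFun (ConjClasses X) h) * Nat.card (Fin n → X) := by
  classical
  have hrep : ∀ x : X, ∃ s : X, s * (Quotient.out (ConjClasses.mk x)) * s⁻¹ = x := by
    intro x
    have h1 : ConjClasses.mk (Quotient.out (ConjClasses.mk x)) = ConjClasses.mk x :=
      Quotient.out_eq (ConjClasses.mk x)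
    exact isConj_iff.1 (ConjClasses.mk_eq_mk_iff_isConj.1 h1)
  choose s hs using hrep
  have hcl : ∀ (p : CommFib X 1 h) i,
      ConjClasses.mk (p.1.1 (h.symm i)) = ConjClasses.mk (p.1.1 i) := by
    intro p i
    rw [ConjClasses.mk_eq_mk_iff_isConj, isConj_iff]
    refine ⟨p.1.2 i, ?_⟩
    have := p.2 i
    rw [← this]
    show p.1.1 i * p.1.2 i * _ = _
    group
  rw [← Nat.card_prod]
  refine Nat.card_le_card_of_injective
    (fun p : CommFib X 1 h => ((⟨fun i => ConjClasses.mk (p.1.1 i), hcl p⟩ :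
      InvFun (ConjClasses X) h), fun i => p.1.2 i * s (p.1.1 (h.symm i)))) ?_
  have key : ∀ (p : CommFib X 1 h) i,
      (p.1.2 i * s (p.1.1 (h.symm i))) * Quotient.out (ConjClasses.mk (p.1.1 i)) *
        (p.1.2 i * s (p.1.1 (h.symm i)))⁻¹ = p.1.1 i := by
    intro p i
    have h1 : p.1.1 i * p.1.2 i = p.1.2 i * p.1.1 (h.symm i) := p.2 i
    have h2 := hs (p.1.1 (h.symm i))
    rw [hcl p i] at h2
    calc _ = p.1.2 i * (s (p.1.1 (h.symm i)) * Quotient.out (ConjClasses.mk (p.1.1 i)) *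
        (s (p.1.1 (h.symm i)))⁻¹) * (p.1.2 i)⁻¹ := by group
      _ = _ := by rw [h2, ← h1]; group
  intro p q hpq
  have e1 : ∀ i, ConjClasses.mk (p.1.1 i) = ConjClasses.mk (q.1.1 i) := by
    intro i
    exact congrFun (congrArg Subtype.val (congrArg Prod.fst hpq)) i
  have e2 : ∀ i, p.1.2 i * s (p.1.1 (h.symm i)) = q.1.2 i * s (q.1.1 (h.symm i)) := by
    intro i
    exact congrFun (congrArg Prod.snd hpq) i
  have e3 : p.1.1 = q.1.1 := by
    funext i
    rw [← key p i, ← key q i, e1 i, e2 i]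
  have e4 : p.1.2 = q.1.2 := by
    funext i
    have := e2 i
    rw [e3] at this
    exact mul_right_cancel this
  exact Subtype.ext (Prod.ext e3 e4)

lemma commFib_le_one {n : ℕ} (X : Type) [Group X] [Finite X] (g h : Perm (Fin n)) :
    Nat.card (CommFib X g h) ≤ Nat.card (CommFib X 1 h) := by
  classical
  have : ∀ f : Fin n → X, ∃ a0 : Fin n → X,
      (∃ a : Fin n → X, ∀ i, a i * f (g.symm i) = f i * a (h.symm i)) →
      ∀ i, a0 i * f (g.symm i) = f i * a0 (h.symm i) := by
    intro f
    by_cases hf : ∃ a : Fin n → X, ∀ i, a i * f (g.symm i) = f i * a (h.symm i)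
    · exact ⟨hf.choose, fun _ => hf.choose_spec⟩
    · exact ⟨1, fun h' => absurd h' hf⟩
  choose a0 ha0 using this
  refine Nat.card_le_card_of_injective
    (fun p : CommFib X g h => (⟨(p.1.1 * (a0 p.1.2)⁻¹, p.1.2), ?_⟩ : CommFib X 1 h)) ?_
  · intro i
    have h1 := p.2 i
    have h2 := ha0 p.1.2 ⟨p.1.1, p.2⟩ i
    have h3 : p.1.1 i = p.1.2 i * p.1.1 (h.symm i) * (p.1.2 (g.symm i))⁻¹ :=
      eq_mul_inv_of_mul_eq h1
    have h4 : a0 p.1.2 i = p.1.2 i * a0 p.1.2 (h.symm i) * (p.1.2 (g.symm i))⁻¹ :=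
      eq_mul_inv_of_mul_eq h2
    show p.1.1 i * (a0 p.1.2 i)⁻¹ * p.1.2 i
      = p.1.2 i * (p.1.1 (h.symm i) * (a0 p.1.2 (h.symm i))⁻¹)
    rw [h3, h4]
    group
  · intro p q hpq
    have e1 : p.1.1 * (a0 p.1.2)⁻¹ = q.1.1 * (a0 q.1.2)⁻¹ :=
      congrArg (fun z : CommFib X 1 h => z.1.1) hpq
    have e2 : p.1.2 = q.1.2 := congrArg (fun z : CommFib X 1 h => z.1.2) hpq
    rw [e2] at e1
    exact Subtype.ext (Prod.ext (mul_right_cancel e1) e2)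

lemma commFib_symm {n : ℕ} (X : Type) [Group X] [Finite X] (g h : Perm (Fin n)) :
    Nat.card (CommFib X g h) ≤ Nat.card (CommFib X h g) := by
  refine Nat.card_le_card_of_injective
    (fun p : CommFib X g h => (⟨(p.1.2, p.1.1), fun i => (p.2 i).symm⟩ : CommFib X h g)) ?_
  intro p q hpq
  have e1 : p.1.1 = q.1.1 := congrArg (fun z : CommFib X h g => z.1.2) hpq
  have e2 : p.1.2 = q.1.2 := congrArg (fun z : CommFib X h g => z.1.1) hpq
  exact Subtype.ext (Prod.ext e1 e2)

lemma exists_two {n : ℕ} (h : Perm (Fin n)) (h1 : h ≠ 1) (h2 : ¬ h.IsSwap) :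
    ∃ i j u v : Fin n, i ≠ j ∧ u ≠ i ∧ u ≠ j ∧ v ≠ i ∧ v ≠ j ∧
      ∀ (C : Type) (c : InvFun C h), c.1 i = c.1 u ∧ c.1 j = c.1 v := by
  have inv : ∀ (C : Type) (c : InvFun C h) x, c.1 x = c.1 (h x) := by
    intro C c x
    have := c.2 (h x)
    simpa using this
  obtain ⟨i, hi⟩ : ∃ i, h i ≠ i := by
    by_contra! hc
    exact h1 (Equiv.ext hc)
  by_cases hh : h (h i) = i
  · obtain ⟨j, hj⟩ : ∃ j, h j ≠ swap i (h i) j := by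
      by_contra! hc
      exact h2 ⟨i, h i, hi.symm, Equiv.ext hc⟩
    have ji : j ≠ i := by
      rintro rfl; simp at hj
    have jhi : j ≠ h i := by
      rintro rfl; simp [hh] at hj
    rw [swap_apply_of_ne_of_ne ji jhi] at hj
    refine ⟨i, j, h i, h j, ji.symm, hi, jhi.symm, ?_, hj, fun C c => ⟨inv C c i, inv C c j⟩⟩
    intro hji
    exact jhi (h.injective (hji.trans hh.symm))
  · refine ⟨i, h i, h (h i), h (h i), hi.symm, hh, ?_, hh, ?_,
      fun C c => ⟨(inv C c i).trans (inv C c _), inv C c _⟩⟩ <;>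
    exact fun e => hi (h.injective e)

lemma invFun_le {n : ℕ} (C : Type) [Finite C] (h : Perm (Fin n)) (h1 : h ≠ 1) (h2 : ¬ h.IsSwap) :
    Nat.card (InvFun C h) ≤ Nat.card C ^ (n - 2) := by
  classical
  obtain ⟨i, j, u, v, hij, hui, huj, hvi, hvj, hc⟩ := exists_two h h1 h2
  have hcard : Nat.card {x : Fin n // x ∉ ({i, j} : Finset (Fin n))} = n - 2 := by
    rw [Nat.card_eq_fintype_card, Fintype.card_subtype_compl, Fintype.card_coe,
      Finset.card_pair hij, Fintype.card_fin]
  rw [← hcard, ← Nat.card_fun]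
  refine Nat.card_le_card_of_injective (fun (c : InvFun C h) x => c.1 x.1) ?_
  intro c d hcd
  have key : ∀ x, x ≠ i → x ≠ j → c.1 x = d.1 x := fun x hx hx' =>
    congrFun hcd ⟨x, by simp [hx, hx']⟩
  apply Subtype.ext
  funext x
  by_cases hx : x = i
  · subst hx
    rw [(hc C c).1, (hc C d).1, key u hui huj]
  by_cases hx' : x = j
  · subst hx'
    rw [(hc C c).2, (hc C d).2, key v hvi hvj]
  exact key x hx hx'

lemma invFun_le' {n : ℕ} (C : Type) [Finite C] (h : Perm (Fin n)) :
    Nat.card (InvFun C h) ≤ Nat.card C ^ n := by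
  have : Nat.card (Fin n → C) = Nat.card C ^ n := by simp [Nat.card_fun]
  rw [← this]
  exact Nat.card_le_card_of_injective (fun c : InvFun C h => c.1) Subtype.val_injective

lemma kclass_wreath_le {n : ℕ} (H : Subgroup (Perm (Fin n)))
    (hswap : ∀ h : H, ¬ Perm.IsSwap (h : Perm (Fin n))) (X : Type) [Group X] [Finite X] :
    kclass (Wreath X H) * Nat.card H ≤
      kclass X ^ n + Nat.card H ^ 2 * kclass X ^ (n - 2) := by
  classical
  have : Finite (ConjClasses X) := Quotient.finite _
  have : Fintype H := Fintype.ofFinite _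
  set N := Nat.card (Fin n → X) with hN
  have hNpos : 0 < N := Nat.card_pos
  have hfin : Finite (Wreath X H) := Finite.of_equiv _ SemidirectProduct.equivProd.symm
  have hG : Nat.card (Wreath X H) = N * Nat.card H := by
    rw [Nat.card_congr SemidirectProduct.equivProd, Nat.card_prod]
  have hcomm := card_comm_eq_card_conjClasses_mul_card (Wreath X H)
  have hle : Nat.card {p : Wreath X H × Wreath X H // Commute p.1 p.2} ≤
      Nat.card (Σ gh : H × H, CommFib X (gh.1 : Perm (Fin n)) (gh.2 : Perm (Fin n))) := by
    refine Nat.card_le_card_of_injective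
      (fun p => (⟨(p.1.1.right, p.1.2.right), ⟨(p.1.1.left, p.1.2.left), ?_⟩⟩ :
        Σ gh : H × H, CommFib X (gh.1 : Perm (Fin n)) (gh.2 : Perm (Fin n)))) ?_
    · intro i
      have := congrArg (fun z : Wreath X H => z.left i) p.2.eq
      exact this
    · rintro ⟨⟨⟨a, g⟩, ⟨f, h⟩⟩, hp⟩ ⟨⟨⟨a', g'⟩, ⟨f', h'⟩⟩, hp'⟩ hpq
      have e1 : (g, h) = (g', h') := congrArg Sigma.fst hpq
      obtain ⟨rfl, rfl⟩ := Prod.mk.inj e1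
      have e2 := eq_of_heq (Sigma.mk.inj hpq).2
      have e3 : (a, f) = (a', f') := congrArg Subtype.val e2
      obtain ⟨rfl, rfl⟩ := Prod.mk.inj e3
      rfl
  have hfib : ∀ gh : H × H, Nat.card (CommFib X (gh.1 : Perm (Fin n)) (gh.2 : Perm (Fin n))) ≤
      (if gh = 1 then kclass X ^ n * N else 0) + kclass X ^ (n - 2) * N := by
    rintro ⟨g, h⟩
    by_cases hh : h = 1
    · by_cases hg : g = 1
      · subst hh hg
        rw [if_pos (show ((1 : H), (1 : H)) = 1 from rfl)]
        refine le_trans ?_ (Nat.le_add_right _ _)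
        exact (commFib_one_le X _).trans (Nat.mul_le_mul_right _ (invFun_le' _ _))
      · refine le_trans ?_ (Nat.le_add_left _ _)
        refine (commFib_symm X _ _).trans ((commFib_le_one X _ _).trans
          ((commFib_one_le X _).trans (Nat.mul_le_mul_right _ (invFun_le _ _ ?_ (hswap g)))))
        exact fun e => hg (Subtype.ext e)
    · refine le_trans ?_ (Nat.le_add_left _ _)
      refine ((commFib_le_one X _ _).trans
          ((commFib_one_le X _).trans (Nat.mul_le_mul_right _ (invFun_le _ _ ?_ (hswap h)))))
      exact fun e => hh (Subtype.ext e)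
  rw [Nat.card_sigma, hcomm, hG] at hle
  have hsum := hle.trans (Finset.sum_le_sum fun gh _ => hfib gh)
  rw [Finset.sum_add_distrib, Finset.sum_ite_eq' Finset.univ (1 : H × H)] at hsum
  simp only [Finset.mem_univ, if_true, Finset.sum_const, Finset.card_univ,
    smul_eq_mul, ← Nat.card_eq_fintype_card] at hsum
  refine Nat.le_of_mul_le_mul_right ?_ hNpos
  calc _ = Nat.card (ConjClasses (Wreath X H)) * (N * Nat.card H) := by unfold kclass; ring
    _ ≤ _ := hsum
    _ = _ := by rw [Nat.card_prod]; ring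

/-- If the nontrivial permutation group `H` of degree `n` contains no transposition, then for
every fixed `n` there is `K` such that `k(X ≀ H) < (1 + 1/(kn)) k^n / |H|` for all nontrivial
finite `X` with `k = k(X) ≥ K`. -/
theorem statement7 (n : ℕ) (H : Subgroup (Perm (Fin n))) [Nontrivial H]
    (hswap : ∀ h : H, ¬ Perm.IsSwap (h : Perm (Fin n))) :
    ∃ K : ℕ, ∀ (X : Type) [Group X] [Finite X], Nontrivial X → K ≤ kclass X →
      (kclass (Wreath X H) : ℝ) <
        (1 + 1 / ((kclass X : ℝ) * n)) * ((kclass X : ℝ) ^ n / (Nat.card H : ℝ)) := by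
  refine ⟨Nat.card H ^ 2 * n + 1, ?_⟩
  intro X _ _ _ hK
  have hmain := kclass_wreath_le H hswap X
  obtain ⟨m, rfl⟩ : ∃ m, n = m + 2 := by
    obtain ⟨h, hh⟩ := exists_ne (1 : H)
    obtain ⟨i, j, _, _, hij, _⟩ := exists_two (h : Perm (Fin n))
      (fun e => hh (Subtype.ext e)) (hswap h)
    refine ⟨n - 2, ?_⟩
    have := i.2
    have := j.2
    have := fun e => hij (Fin.ext e)
    omega
  have hHpos : (0 : ℝ) < Nat.card H := by exact_mod_cast Nat.card_pos
  have hkpos : (0 : ℝ) < kclass X := by exact_mod_cast (by omega : 0 < kclass X)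
  have hK' : (Nat.card H : ℝ) ^ 2 * ((m + 2 : ℕ) : ℝ) < kclass X := by
    exact_mod_cast (by omega : Nat.card H ^ 2 * (m + 2) < kclass X)
  have hm : (kclass (Wreath X H) : ℝ) * Nat.card H ≤
      (kclass X : ℝ) ^ (m + 2) + (Nat.card H : ℝ) ^ 2 * (kclass X : ℝ) ^ m := by
    exact_mod_cast hmain
  have hn : (0 : ℝ) < ((m + 2 : ℕ) : ℝ) := by positivity
  generalize ((m + 2 : ℕ) : ℝ) = N at *
  generalize (kclass X : ℝ) = k at *
  generalize (Nat.card H : ℝ) = c at *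
  rw [← mul_div_assoc, lt_div_iff₀ hHpos]
  refine hm.trans_lt ?_
  have e : (1 + 1 / (k * N)) * k ^ (m + 2) = k ^ (m + 2) + k / N * k ^ m := by
    field_simp
    ring
  rw [e]
  have : c ^ 2 < k / N := by rwa [lt_div_iff₀ hn]
  have := mul_lt_mul_of_pos_right this (pow_pos hkpos m)
  linarith
end
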